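/- Let (v, B, p) be a smooth solution of the stationary Hall-MHD system in ℝ³: −Δv + (v·∇)v = −∇p + (B·∇)B, −ΔB + (v·∇)B − (B·∇)v = ∇×((∇×B)×B), ∇·v = ∇·B = 0. Assume r^{−8} ∫_{B(r)} |B − B_{B(r)}|⁶ dx → 0 as r → ∞, and that there exist smooth matrix potentials Φ, Ψ with ∇·Φ = v, ∇·Ψ = B satisfying ⨍_{B(r)} |Φ − Φ_{B(r)}|⁶ dx + ⨍_{B(r)} |Ψ − Ψ_{B(r)}|⁶ dx ≤ C r for all r > 1. Then v ≡ 0 and B ≡ 0. -/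

import Mathlib

open MeasureTheory

noncomputable abbrev E3 : Type := EuclideanSpace ℝ (Fin 3)

/-- Partial derivative `∂_i f (x)`. -/
noncomputable def pd (f : E3 → ℝ) (i : Fin 3) (x : E3) : ℝ :=
  fderiv ℝ f x (EuclideanSpace.single i 1)

/-- Laplacian `Δf = ∑_i ∂_i∂_i f`. -/
noncomputable def lap (f : E3 → ℝ) (x : E3) : ℝ :=
  ∑ i, pd (fun y => pd f i y) i x

/-- Divergence of a vector field. -/
noncomputable def divg (F : E3 → Fin 3 → ℝ) (x : E3) : ℝ :=
  ∑ i, pd (fun y => F y i) i x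

/-- Divergence of a matrix field: `(∇·Φ)_j = ∑_i ∂_i Φ_{ij}`. -/
noncomputable def matDiv (Φ : E3 → Fin 3 → Fin 3 → ℝ) (x : E3) (j : Fin 3) : ℝ :=
  ∑ i, pd (fun y => Φ y i j) i x

/-- Cross product on `ℝ³`. -/
def cross3 (a b : Fin 3 → ℝ) : Fin 3 → ℝ :=
  ![a 1 * b 2 - a 2 * b 1, a 2 * b 0 - a 0 * b 2, a 0 * b 1 - a 1 * b 0]

/-- Curl of a vector field on `ℝ³`. -/
noncomputable def curl3 (F : E3 → Fin 3 → ℝ) (x : E3) : Fin 3 → ℝ :=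
  ![pd (fun y => F y 2) 1 x - pd (fun y => F y 1) 2 x,
    pd (fun y => F y 0) 2 x - pd (fun y => F y 2) 0 x,
    pd (fun y => F y 1) 0 x - pd (fun y => F y 0) 1 x]

/-- The `L^q` norm of `f` over the ball of radius `r` centred at the origin. -/
noncomputable def nrm (q : ℝ) (f : E3 → ℝ) (r : ℝ) : ℝ :=
  (∫ x in Metric.ball (0 : E3) r, |f x| ^ q) ^ (1 / q)

theorem continuous_integrableOn_ball {f : E3 → ℝ} (hf : Continuous f) (r : ℝ) :
    IntegrableOn f (Metric.ball (0 : E3) r) :=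
  (hf.continuousOn.integrableOn_compact (isCompact_closedBall 0 r)).mono_set
    Metric.ball_subset_closedBall

theorem continuous_memLp_ball {f : E3 → ℝ} (hf : Continuous f) (r : ℝ) (p : ENNReal) :
    MemLp f p (volume.restrict (Metric.ball (0 : E3) r)) := by
  obtain ⟨C, hC⟩ := (isCompact_closedBall (0 : E3) r).exists_bound_of_continuousOn hf.continuousOn
  have : IsFiniteMeasure (volume.restrict (Metric.ball (0 : E3) r)) :=
    ⟨by rw [Measure.restrict_apply_univ]; exact measure_ball_lt_top⟩
  refine MemLp.of_bound hf.aestronglyMeasurable C ?_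
  filter_upwards [ae_restrict_mem Metric.isOpen_ball.measurableSet] with x hx
  exact hC x (Metric.ball_subset_closedBall hx)

theorem nrm_nonneg (q : ℝ) (f : E3 → ℝ) (r : ℝ) : 0 ≤ nrm q f r :=
  Real.rpow_nonneg (integral_nonneg fun _ => Real.rpow_nonneg (abs_nonneg _) _) _

theorem nrm_rpow {q : ℝ} (hq : 0 < q) (f : E3 → ℝ) (r : ℝ) :
    nrm q f r ^ q = ∫ x in Metric.ball (0 : E3) r, |f x| ^ q := by
  rw [nrm, ← Real.rpow_mul (integral_nonneg fun _ => Real.rpow_nonneg (abs_nonneg _) _),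
    one_div_mul_cancel hq.ne', Real.rpow_one]

theorem continuous_abs_rpow {q : ℝ} (hq : 0 < q) {f : E3 → ℝ} (hf : Continuous f) :
    Continuous fun x => |f x| ^ q :=
  hf.abs.rpow_const fun _ => Or.inr hq.le

theorem nrm_mono {q : ℝ} (hq : 0 < q) {f g : E3 → ℝ} (hf : Continuous f) (hg : Continuous g)
    {r s : ℝ} (hrs : r ≤ s) (h : ∀ x ∈ Metric.ball (0 : E3) r, |f x| ≤ |g x|) :
    nrm q f r ≤ nrm q g s := by
  refine Real.rpow_le_rpow (integral_nonneg fun _ => Real.rpow_nonneg (abs_nonneg _) _) ?_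
    (by positivity)
  calc _ ≤ ∫ x in Metric.ball (0 : E3) r, |g x| ^ q :=
        setIntegral_mono_on (continuous_integrableOn_ball (continuous_abs_rpow hq hf) r)
          (continuous_integrableOn_ball (continuous_abs_rpow hq hg) r)
          Metric.isOpen_ball.measurableSet
          fun x hx => Real.rpow_le_rpow (abs_nonneg _) (h x hx) hq.le
    _ ≤ _ := setIntegral_mono_set (continuous_integrableOn_ball (continuous_abs_rpow hq hg) s)
        (Filter.Eventually.of_forall fun _ => Real.rpow_nonneg (abs_nonneg _) _)
        (Metric.ball_subset_ball hrs).eventuallyLE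

theorem nrm_const_mul {q : ℝ} (hq : 0 < q) (f : E3 → ℝ) (r c : ℝ) :
    nrm q (fun x => c * f x) r = |c| * nrm q f r := by
  simp only [nrm, abs_mul, Real.mul_rpow (abs_nonneg c) (abs_nonneg _)]
  rw [integral_const_mul, Real.mul_rpow (by positivity)
    (integral_nonneg fun _ => Real.rpow_nonneg (abs_nonneg _) _),
    ← Real.rpow_mul (abs_nonneg c), mul_one_div_cancel hq.ne', Real.rpow_one]

/-- Hölder's inequality on balls. -/
theorem nrm_mul_le {p q s : ℝ} (hs : 0 < s) (hp : 0 < p) (hq : 0 < q) (h : 1 / p + 1 / q = 1 / s)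
    {f g : E3 → ℝ} (hf : Continuous f) (hg : Continuous g) (r : ℝ) :
    nrm s (fun x => f x * g x) r ≤ nrm p f r * nrm q g r := by
  have hps : s < p := by
    have h1 : 1 / p < 1 / s := by
      have : 0 < 1 / q := by positivity
      linarith
    exact (one_div_lt_one_div hp hs).1 h1
  have hc : (p / s).HolderConjugate (q / s) := by
    rw [Real.holderConjugate_iff]
    refine ⟨by rwa [one_lt_div hs], ?_⟩
    field_simp
    field_simp at h
    linarith
  have H := integral_mul_le_Lp_mul_Lq_of_nonneg (μ := volume.restrict (Metric.ball (0 : E3) r)) hc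
    (f := fun x => |f x| ^ s) (g := fun x => |g x| ^ s)
    (Filter.Eventually.of_forall fun _ => Real.rpow_nonneg (abs_nonneg _) _)
    (Filter.Eventually.of_forall fun _ => Real.rpow_nonneg (abs_nonneg _) _)
    (continuous_memLp_ball (continuous_abs_rpow hs hf) r _)
    (continuous_memLp_ball (continuous_abs_rpow hs hg) r _)
  simp only [← Real.rpow_mul (abs_nonneg _), mul_div_cancel₀ _ hs.ne'] at H
  have H2 := Real.rpow_le_rpow
    (integral_nonneg fun _ => mul_nonneg (Real.rpow_nonneg (abs_nonneg _) _)
      (Real.rpow_nonneg (abs_nonneg _) _)) H (z := 1 / s) (by positivity)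
  rw [Real.mul_rpow (Real.rpow_nonneg (integral_nonneg fun _ => Real.rpow_nonneg (abs_nonneg _) _) _)
    (Real.rpow_nonneg (integral_nonneg fun _ => Real.rpow_nonneg (abs_nonneg _) _) _),
    ← Real.rpow_mul (integral_nonneg fun _ => Real.rpow_nonneg (abs_nonneg _) _),
    ← Real.rpow_mul (integral_nonneg fun _ => Real.rpow_nonneg (abs_nonneg _) _)] at H2
  have e1 : 1 / (p / s) * (1 / s) = 1 / p := by field_simp
  have e2 : 1 / (q / s) * (1 / s) = 1 / q := by field_simp
  rw [e1, e2] at H2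
  simpa only [nrm, abs_mul, Real.mul_rpow (abs_nonneg _) (abs_nonneg _)] using H2

theorem integral_abs_mul_le {p q : ℝ} (hp : 0 < p) (hq : 0 < q) (h : 1 / p + 1 / q = 1)
    {f g : E3 → ℝ} (hf : Continuous f) (hg : Continuous g) (r : ℝ) :
    ∫ x in Metric.ball (0 : E3) r, |f x| * |g x| ≤ nrm p f r * nrm q g r := by
  have := nrm_mul_le (s := 1) one_pos hp hq (by simpa using h) hf hg r
  simpa [nrm, abs_mul] using this

theorem integral_abs_mul_mul_le {p q s : ℝ} (hp : 0 < p) (hq : 0 < q) (hs : 0 < s)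
    (h : 1 / p + 1 / q + 1 / s = 1)
    {f g k : E3 → ℝ} (hf : Continuous f) (hg : Continuous g) (hk : Continuous k) (r : ℝ) :
    ∫ x in Metric.ball (0 : E3) r, |f x| * |g x| * |k x| ≤ nrm p f r * nrm q g r * nrm s k r := by
  have hpq : 0 < 1 / p + 1 / q := by positivity
  have h1 := integral_abs_mul_le (p := 1 / (1 / p + 1 / q)) (q := s) (by positivity) hs
    (by simpa using h) (hf.mul hg) hk r
  have h2 := nrm_mul_le (s := 1 / (1 / p + 1 / q)) (by positivity) hp hq (by simp) hf hg r
  simp only [Pi.mul_apply, abs_mul] at h1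
  exact h1.trans (mul_le_mul_of_nonneg_right h2 (nrm_nonneg _ _ _))

/-- The volume of the unit ball of `ℝ³`. -/
noncomputable def ballVol : ℝ := volume.real (Metric.ball (0 : E3) 1)

theorem ballVol_pos : 0 < ballVol :=
  ENNReal.toReal_pos (Metric.measure_ball_pos _ _ one_pos).ne' measure_ball_lt_top.ne

theorem volume_real_ball {r : ℝ} (hr : 0 ≤ r) :
    volume.real (Metric.ball (0 : E3) r) = r ^ 3 * ballVol := by
  rw [Measure.real, Measure.addHaar_ball _ _ hr, ENNReal.toReal_mul,
    ENNReal.toReal_ofReal (by positivity)]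
  simp [ballVol, Measure.real]

theorem nrm_le_nrm {p q t : ℝ} (hp : 0 < p) (hq : 0 < q) (ht : 0 < t)
    (h : 1 / p + 1 / t = 1 / q) {f : E3 → ℝ} (hf : Continuous f) {r : ℝ} (hr : 0 ≤ r) :
    nrm q f r ≤ nrm p f r * (r ^ 3 * ballVol) ^ (1 / t) := by
  have := nrm_mul_le hq hp ht h hf (continuous_const (y := (1 : ℝ))) r
  simpa [nrm, volume_real_ball hr] using this

theorem nrm_add_le {q : ℝ} (hq : 1 ≤ q) {f g : E3 → ℝ} (hf : Continuous f) (hg : Continuous g)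
    (r : ℝ) : nrm q (fun x => f x + g x) r ≤ nrm q f r + nrm q g r := by
  have key : ∀ h : E3 → ℝ, Continuous h → nrm q h r =
      (eLpNorm h (ENNReal.ofReal q) (volume.restrict (Metric.ball (0 : E3) r))).toReal := by
    intro h hh
    rw [(continuous_memLp_ball hh r _).eLpNorm_eq_integral_rpow_norm
      (by simpa using by linarith) ENNReal.ofReal_ne_top,
      ENNReal.toReal_ofReal (Real.rpow_nonneg (integral_nonneg fun _ => Real.rpow_nonneg (norm_nonneg _) _) _),
      ENNReal.toReal_ofReal (by linarith)]
    simp [nrm, Real.norm_eq_abs]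
  rw [key _ hf, key _ hg, key _ (show Continuous fun x => f x + g x from hf.add hg), ← ENNReal.toReal_add
    (continuous_memLp_ball hf r _).eLpNorm_lt_top.ne (continuous_memLp_ball hg r _).eLpNorm_lt_top.ne]
  refine ENNReal.toReal_mono (ENNReal.add_ne_top.2 ⟨(continuous_memLp_ball hf r _).eLpNorm_lt_top.ne,
    (continuous_memLp_ball hg r _).eLpNorm_lt_top.ne⟩) ?_
  exact eLpNorm_add_le hf.aestronglyMeasurable hg.aestronglyMeasurable (by simpa using hq)

theorem contDiff_pd {f : E3 → ℝ} (hf : ContDiff ℝ (⊤ : ℕ∞) f) (i : Fin 3) :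
    ContDiff ℝ (⊤ : ℕ∞) (pd f i) := by
  have h : ContDiff ℝ (⊤ : ℕ∞) (fderiv ℝ f) := hf.fderiv_right (by simp)
  exact h.clm_apply contDiff_const

theorem continuous_pd {f : E3 → ℝ} (hf : ContDiff ℝ 1 f) (i : Fin 3) : Continuous (pd f i) :=
  (hf.continuous_fderiv one_ne_zero).clm_apply continuous_const

theorem contDiff_one_of_top {f : E3 → ℝ} (hf : ContDiff ℝ (⊤ : ℕ∞) f) : ContDiff ℝ 1 f :=
  hf.of_le (by exact_mod_cast le_top)

theorem differentiableAt_of_contDiff_one {f : E3 → ℝ} (hf : ContDiff ℝ 1 f) (x : E3) :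
    DifferentiableAt ℝ f x := hf.differentiable one_ne_zero x

theorem pd_mul {f g : E3 → ℝ} {x : E3} (hf : DifferentiableAt ℝ f x)
    (hg : DifferentiableAt ℝ g x) (i : Fin 3) :
    pd (fun y => f y * g y) i x = pd f i x * g x + f x * pd g i x := by
  simp only [pd]
  rw [fderiv_fun_mul hf hg]
  simp only [add_apply, smul_apply, smul_eq_mul]
  ring

theorem pd_add {f g : E3 → ℝ} {x : E3} (hf : DifferentiableAt ℝ f x)
    (hg : DifferentiableAt ℝ g x) (i : Fin 3) :
    pd (fun y => f y + g y) i x = pd f i x + pd g i x := by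
  simp only [pd]
  rw [fderiv_fun_add hf hg]
  rfl

theorem pd_sub {f g : E3 → ℝ} {x : E3} (hf : DifferentiableAt ℝ f x)
    (hg : DifferentiableAt ℝ g x) (i : Fin 3) :
    pd (fun y => f y - g y) i x = pd f i x - pd g i x := by
  simp only [pd]
  rw [fderiv_fun_sub hf hg]
  rfl

theorem pd_sub_const {f : E3 → ℝ} (c : ℝ) (i : Fin 3) (x : E3) :
    pd (fun y => f y - c) i x = pd f i x := by
  simp only [pd, fderiv_sub_const]

theorem pd_const_mul {f : E3 → ℝ} {x : E3} (hf : DifferentiableAt ℝ f x) (c : ℝ) (i : Fin 3) :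
    pd (fun y => c * f y) i x = c * pd f i x := by
  simp only [pd, fderiv_const_mul hf]
  rfl

theorem pd_sum {ι : Type*} {s : Finset ι} {f : ι → E3 → ℝ} {x : E3}
    (hf : ∀ k ∈ s, DifferentiableAt ℝ (f k) x) (i : Fin 3) :
    pd (fun y => ∑ k ∈ s, f k y) i x = ∑ k ∈ s, pd (f k) i x := by
  simp only [pd]
  rw [fderiv_fun_sum hf]
  simp

theorem fderiv_eq_sum_pd (f : E3 → ℝ) (x h : E3) :
    fderiv ℝ f x h = ∑ i, h i * pd f i x := by
  have : h = ∑ i, h i • (EuclideanSpace.single i (1 : ℝ) : E3) := by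
    ext j
    simp [Pi.single_apply]
  conv_lhs => rw [this]
  simp [map_sum, pd]

/-- `f` vanishes outside the closed ball of radius `s`. -/
def SuppIn (f : E3 → ℝ) (s : ℝ) : Prop := ∀ x : E3, s < ‖x‖ → f x = 0

theorem SuppIn.mul_right {f : E3 → ℝ} {s : ℝ} (hf : SuppIn f s) (g : E3 → ℝ) :
    SuppIn (fun x => f x * g x) s := fun x hx => by simp [hf x hx]

theorem SuppIn.mul_left {f : E3 → ℝ} {s : ℝ} (hf : SuppIn f s) (g : E3 → ℝ) :
    SuppIn (fun x => g x * f x) s := fun x hx => by simp [hf x hx]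

theorem SuppIn.pd {f : E3 → ℝ} {s : ℝ} (hf : SuppIn f s) (i : Fin 3) : SuppIn (pd f i) s := by
  intro x hx
  have : f =ᶠ[nhds x] fun _ => 0 := by
    filter_upwards [(isOpen_lt continuous_const continuous_norm).mem_nhds hx] with y hy
    exact hf y hy
  simp [_root_.pd, this.fderiv_eq]

theorem SuppIn.hasCompactSupport {f : E3 → ℝ} {s : ℝ} (hf : SuppIn f s) : HasCompactSupport f :=
  HasCompactSupport.intro (isCompact_closedBall (0 : E3) s) fun x hx => hf x (by simpa using hx)

theorem SuppIn.integrable {f : E3 → ℝ} {s : ℝ} (hf : SuppIn f s) (hc : Continuous f) :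
    Integrable f := hc.integrable_of_hasCompactSupport hf.hasCompactSupport

theorem SuppIn.setIntegral_eq {f : E3 → ℝ} {s : ℝ} (hf : SuppIn f s) {r : ℝ} (h : s < r) :
    ∫ x in Metric.ball (0 : E3) r, f x = ∫ x, f x :=
  setIntegral_eq_integral_of_forall_compl_eq_zero fun x hx => hf x (by
    simp only [Metric.mem_ball, dist_zero_right, not_lt] at hx; linarith)

theorem integral_mul_pd {f g : E3 → ℝ} (hf : ContDiff ℝ 1 f) (hg : ContDiff ℝ 1 g) {s : ℝ}
    (hs : SuppIn f s) (i : Fin 3) : ∫ x, f x * pd g i x = -∫ x, pd f i x * g x := by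
  refine integral_mul_fderiv_eq_neg_fderiv_mul_of_integrable ?_ ?_ ?_ ?_ ?_
  · exact ((hs.pd i).mul_right g).integrable ((continuous_pd hf i).mul hg.continuous)
  · exact (hs.mul_right (pd g i)).integrable (hf.continuous.mul (continuous_pd hg i))
  · exact (hs.mul_right g).integrable (hf.continuous.mul hg.continuous)
  · exact fun x _ => differentiableAt_of_contDiff_one hf x
  · exact fun x _ => differentiableAt_of_contDiff_one hg x

theorem integral_pd_eq_zero {f : E3 → ℝ} (hf : ContDiff ℝ 1 f) {s : ℝ}
    (hs : SuppIn f s) (i : Fin 3) : ∫ x, pd f i x = 0 := by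
  have := integral_mul_pd hf (contDiff_const (c := (1 : ℝ))) hs i
  have h0 : ∀ x, pd (fun _ : E3 => (1 : ℝ)) i x = 0 := fun x => by simp [pd]
  simp only [h0, mul_zero, integral_zero, mul_one] at this
  linarith

theorem nrm_translate_le {q : ℝ} (hq : 0 < q) {f : E3 → ℝ} (hf : Continuous f) {k : E3} {r s : ℝ}
    (h : r + ‖k‖ ≤ s) : nrm q (fun x => f (x - k)) r ≤ nrm q f s := by
  refine Real.rpow_le_rpow (integral_nonneg fun _ => Real.rpow_nonneg (abs_nonneg _) _) ?_
    (by positivity)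
  have e : ∫ x in Metric.ball (0 : E3) r, |f (x - k)| ^ q
      = ∫ x in Metric.ball (-k) r, |f x| ^ q := by
    have hm : MeasurePreserving (fun x : E3 => x - k) volume volume :=
      measurePreserving_sub_right volume k
    rw [← hm.setIntegral_preimage_emb (MeasurableEquiv.subRight k).measurableEmbedding
      (fun x => |f x| ^ q)]
    congr 2
    ext x
    simp [dist_eq_norm]
  rw [e]
  refine setIntegral_mono_set (continuous_integrableOn_ball (continuous_abs_rpow hq hf) s)
        (Filter.Eventually.of_forall fun _ => Real.rpow_nonneg (abs_nonneg _) _)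
        (LE.le.eventuallyLE ?_)
  refine Metric.ball_subset_ball' ?_
  simpa using h

/-- Hölder's inequality for the product of a translate with a compactly supported function. -/
theorem integral_abs_translate_mul_le {p q : ℝ} (hp : 0 < p) (hq : 0 < q) (h : 1 / p + 1 / q = 1)
    {f g : E3 → ℝ} (hf : Continuous f) (hg : Continuous g) {k : E3} {s r t : ℝ} (hs : SuppIn g s)
    (hsr : s < r) (hk : r + ‖k‖ ≤ t) :
    ∫ x, |f (x - k)| * |g x| ≤ nrm p f t * nrm q g r := by
  have hc : Continuous fun x => f (x - k) := hf.comp (continuous_id.sub continuous_const)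
  have h1 := integral_abs_mul_le hp hq h hc hg r
  have hs' : SuppIn (fun x => |f (x - k)| * |g x|) s := fun x hx => by simp [hs x hx]
  rw [hs'.setIntegral_eq hsr] at h1
  exact h1.trans (mul_le_mul_of_nonneg_right (nrm_translate_le hp hf hk) (nrm_nonneg _ _ _))

theorem exists_bound_deriv_smoothTransition :
    ∃ C : ℝ, 0 < C ∧ ∀ t, |deriv Real.smoothTransition t| ≤ C ∧
      |deriv (deriv Real.smoothTransition) t| ≤ C := by
  have hsm : ContDiff ℝ (⊤ : ℕ∞) Real.smoothTransition := Real.smoothTransition.contDiff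
  have h1 : ContDiff ℝ (⊤ : ℕ∞) (deriv Real.smoothTransition) := hsm.iterate_deriv 1
  have h2 : ContDiff ℝ (⊤ : ℕ∞) (deriv (deriv Real.smoothTransition)) := hsm.iterate_deriv 2
  have hc : HasCompactSupport (deriv Real.smoothTransition) := by
    refine HasCompactSupport.intro (isCompact_Icc (a := (0 : ℝ)) (b := 1)) fun x hx => ?_
    rcases lt_or_ge x 0 with h | h
    · have : Real.smoothTransition =ᶠ[nhds x] fun _ => 0 := by
        filter_upwards [Iio_mem_nhds h] with y hy
        exact Real.smoothTransition.zero_of_nonpos (le_of_lt hy)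
      simp [this.deriv_eq]
    · have h' : 1 < x := by
        by_contra hh
        exact hx ⟨h, not_lt.1 hh⟩
      have : Real.smoothTransition =ᶠ[nhds x] fun _ => 1 := by
        filter_upwards [Ioi_mem_nhds h'] with y hy
        exact Real.smoothTransition.one_of_one_le (le_of_lt hy)
      simp [this.deriv_eq]
  obtain ⟨C1, hC1⟩ := hc.exists_bound_of_continuous h1.continuous
  obtain ⟨C2, hC2⟩ := hc.deriv.exists_bound_of_continuous h2.continuous
  refine ⟨max (max C1 C2) 1, by positivity, fun t => ⟨?_, ?_⟩⟩
  · exact (hC1 t).trans ((le_max_left _ _).trans (le_max_left _ _))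
  · exact (hC2 t).trans ((le_max_right _ _).trans (le_max_left _ _))

theorem abs_coord_le (x : E3) (i : Fin 3) : |x i| ≤ ‖x‖ := by
  simpa [Real.norm_eq_abs] using PiLp.norm_apply_le x i

theorem pd_coord (i j : Fin 3) (x : E3) : pd (fun y : E3 => y i) j x = if i = j then 1 else 0 := by
  have : (fun y : E3 => y i) = (EuclideanSpace.proj i : E3 →L[ℝ] ℝ) := rfl
  rw [pd, this, ContinuousLinearMap.fderiv]
  simp

theorem pd_norm_sq (i : Fin 3) (x : E3) : pd (fun y : E3 => ‖y‖ ^ 2) i x = 2 * x i := by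
  rw [pd, fderiv_norm_sq_apply]
  simp [EuclideanSpace.inner_single_right]

theorem pd_comp {g : ℝ → ℝ} {f : E3 → ℝ} {x : E3} (hg : DifferentiableAt ℝ g (f x))
    (hf : DifferentiableAt ℝ f x) (i : Fin 3) :
    pd (fun y => g (f y)) i x = deriv g (f x) * pd f i x := by
  have h := (hg.hasDerivAt.comp_hasFDerivAt x hf.hasFDerivAt).fderiv
  have h' : fderiv ℝ (fun y => g (f y)) x = deriv g (f x) • fderiv ℝ f x := h
  simp [pd, h']

/-- Smooth cutoff functions between concentric balls, with bounds on two derivatives. -/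
theorem exists_cutoff : ∃ C : ℝ, 0 < C ∧ ∀ r s : ℝ, 0 < r → r < s →
    ∃ φ : E3 → ℝ, ContDiff ℝ (⊤ : ℕ∞) φ ∧ (∀ x, 0 ≤ φ x) ∧ (∀ x, φ x ≤ 1) ∧
      (∀ x, ‖x‖ ≤ r → φ x = 1) ∧ SuppIn φ s ∧
      (∀ i x, |pd φ i x| ≤ C / (s - r)) ∧ ∀ i j x, |pd (pd φ i) j x| ≤ C / (s - r) ^ 2 := by
  obtain ⟨C, hC, hCb⟩ := exists_bound_deriv_smoothTransition
  refine ⟨6 * C, by positivity, fun r s hr hrs => ?_⟩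
  have hd : 0 < s - r := sub_pos.2 hrs
  have hs : 0 < s := hr.trans hrs
  have hD : 0 < s ^ 2 - r ^ 2 := by nlinarith
  set w : ℝ := (s ^ 2 - r ^ 2)⁻¹ with hw
  have hw0 : 0 < w := inv_pos.2 hD
  have hsw : s * w ≤ 1 / (s - r) := by
    rw [hw, ← div_eq_mul_inv, div_le_div_iff₀ hD hd]
    nlinarith
  have hww : w ≤ 1 / (s - r) ^ 2 := by
    rw [hw, ← one_div]
    exact one_div_le_one_div_of_le (by positivity) (by nlinarith)
  set Q : E3 → ℝ := fun x => w * (s ^ 2 - ‖x‖ ^ 2) with hQ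
  have hnsq : ContDiff ℝ (⊤ : ℕ∞) fun x : E3 => ‖x‖ ^ 2 := contDiff_norm_sq ℝ
  have hQs : ContDiff ℝ (⊤ : ℕ∞) Q := contDiff_const.mul (contDiff_const.sub hnsq)
  have hsm : ContDiff ℝ (⊤ : ℕ∞) Real.smoothTransition := Real.smoothTransition.contDiff
  have hsm1 : ContDiff ℝ (⊤ : ℕ∞) (deriv Real.smoothTransition) := hsm.iterate_deriv 1
  have hpdQ : ∀ i x, pd Q i x = -(2 * w) * x i := by
    intro i x
    have hdn : DifferentiableAt ℝ (fun y : E3 => ‖y‖ ^ 2) x := hnsq.differentiable (by simp) x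
    have hdn' : DifferentiableAt ℝ (fun y : E3 => s ^ 2 - ‖y‖ ^ 2) x :=
      (differentiableAt_const _).sub hdn
    rw [hQ, pd_const_mul hdn', pd_sub (differentiableAt_const _) hdn, pd_norm_sq]
    simp [pd]
    ring
  have hsupp : SuppIn (fun x => Real.smoothTransition (Q x)) s := by
    intro x hx
    refine Real.smoothTransition.zero_of_nonpos ?_
    have : s ^ 2 ≤ ‖x‖ ^ 2 := by nlinarith
    exact mul_nonpos_of_nonneg_of_nonpos hw0.le (by linarith)
  have hpd1 : ∀ i, pd (fun x => Real.smoothTransition (Q x)) i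
      = fun x => deriv Real.smoothTransition (Q x) * (-(2 * w) * x i) := by
    intro i
    funext x
    rw [pd_comp (hsm.differentiable (by simp) _) (hQs.differentiable (by simp) _), hpdQ]
  have hcoord : ∀ (i : Fin 3) (x : E3), DifferentiableAt ℝ (fun y : E3 => y i) x := fun i x =>
    (EuclideanSpace.proj i : E3 →L[ℝ] ℝ).differentiableAt
  have hpd2 : ∀ i j x, pd (pd (fun x => Real.smoothTransition (Q x)) i) j x
      = deriv (deriv Real.smoothTransition) (Q x) * (-(2 * w) * x j) * (-(2 * w) * x i)
        + deriv Real.smoothTransition (Q x) * (-(2 * w) * if i = j then 1 else 0) := by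
    intro i j x
    have h1 : DifferentiableAt ℝ (fun x => deriv Real.smoothTransition (Q x)) x :=
      (hsm1.comp hQs).differentiable (by simp) x
    have h2 : DifferentiableAt ℝ (fun y : E3 => -(2 * w) * y i) x :=
      (differentiableAt_const _).mul (hcoord i x)
    rw [hpd1, pd_mul h1 h2,
      pd_comp (hsm1.differentiable (by simp) _) (hQs.differentiable (by simp) _), hpdQ,
      pd_const_mul (hcoord i x), pd_coord]
  have hxb : ∀ (i : Fin 3) (x : E3), ‖x‖ ≤ s → |-(2 * w) * x i| ≤ 2 / (s - r) := by
    intro i x hx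
    rw [abs_mul, abs_neg, abs_of_pos (by positivity : 0 < 2 * w)]
    calc 2 * w * |x i| ≤ 2 * w * s :=
          mul_le_mul_of_nonneg_left ((abs_coord_le x i).trans hx) (by positivity)
      _ = 2 * (s * w) := by ring
      _ ≤ 2 * (1 / (s - r)) := by linarith
      _ = _ := by ring
  refine ⟨fun x => Real.smoothTransition (Q x), hsm.comp hQs,
    fun x => Real.smoothTransition.nonneg _, fun x => Real.smoothTransition.le_one _,
    fun x hx => ?_, hsupp, fun i x => ?_, fun i j x => ?_⟩
  · refine Real.smoothTransition.one_of_one_le ?_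
    have : ‖x‖ ^ 2 ≤ r ^ 2 := by
      have := norm_nonneg x
      nlinarith
    calc (1 : ℝ) = w * (s ^ 2 - r ^ 2) := (inv_mul_cancel₀ hD.ne').symm
      _ ≤ _ := mul_le_mul_of_nonneg_left (by linarith) hw0.le
  · rcases lt_or_ge s ‖x‖ with h | h
    · rw [hsupp.pd i x h, abs_zero]
      positivity
    · rw [hpd1, abs_mul]
      calc _ ≤ C * (2 / (s - r)) :=
            mul_le_mul (hCb _).1 (hxb i x h) (abs_nonneg _) hC.le
        _ = 2 * C / (s - r) := by ring
        _ ≤ _ := by gcongr; norm_num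
  · rcases lt_or_ge s ‖x‖ with h | h
    · rw [(hsupp.pd i).pd j x h, abs_zero]
      positivity
    · rw [hpd2]
      have e1 : |deriv (deriv Real.smoothTransition) (Q x) * (-(2 * w) * x j) * (-(2 * w) * x i)|
          ≤ C * (2 / (s - r)) * (2 / (s - r)) := by
        rw [abs_mul, abs_mul]
        have h1 := (hCb (Q x)).2
        have h2 := hxb i x h
        have h3 := hxb j x h
        gcongr
      have e2 : |deriv Real.smoothTransition (Q x) * (-(2 * w) * if i = j then 1 else 0)|
          ≤ C * (2 * (1 / (s - r) ^ 2)) := by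
        rw [abs_mul, abs_mul, abs_neg, abs_of_pos (by positivity : 0 < 2 * w)]
        have h1 := (hCb (Q x)).1
        have h3 : |(if i = j then 1 else 0 : ℝ)| ≤ 1 := by split_ifs <;> simp
        calc _ ≤ C * (2 * w * 1) := by gcongr
          _ ≤ _ := by rw [mul_one]; gcongr
      calc _ ≤ _ := abs_add_le _ _
        _ ≤ C * (2 / (s - r)) * (2 / (s - r)) + C * (2 * (1 / (s - r) ^ 2)) := add_le_add e1 e2
        _ = _ := by field_simp; ring

/-- Cutoff functions whose support stays away from the outer sphere. -/
theorem exists_cutoff_mid : ∃ C : ℝ, 0 < C ∧ ∀ r s : ℝ, 0 < r → r < s →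
    ∃ φ : E3 → ℝ, ContDiff ℝ (⊤ : ℕ∞) φ ∧ (∀ x, 0 ≤ φ x) ∧ (∀ x, φ x ≤ 1) ∧
      (∀ x, ‖x‖ ≤ r → φ x = 1) ∧ SuppIn φ ((r + s) / 2) ∧
      (∀ i x, |pd φ i x| ≤ C / (s - r)) ∧ ∀ i j x, |pd (pd φ i) j x| ≤ C / (s - r) ^ 2 := by
  obtain ⟨C, hC, h⟩ := exists_cutoff
  refine ⟨4 * C, by positivity, fun r s hr hrs => ?_⟩
  obtain ⟨φ, h1, h2, h3, h4, h5, h6, h7⟩ := h r ((r + s) / 2) hr (by linarith)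
  have hd : 0 < s - r := by linarith
  have e : (r + s) / 2 - r = (s - r) / 2 := by ring
  rw [e] at h6 h7
  refine ⟨φ, h1, h2, h3, h4, h5, fun i x => (h6 i x).trans ?_, fun i j x => (h7 i j x).trans ?_⟩
  · rw [div_le_div_iff₀ (by positivity) hd]
    nlinarith [mul_pos hC hd]
  · apply le_of_eq
    field_simp
    norm_num

theorem nrm_pow_three (f : E3 → ℝ) (r : ℝ) :
    nrm 3 f r ^ 3 = ∫ x in Metric.ball (0 : E3) r, |f x| ^ 3 := by
  have := nrm_rpow (q := 3) (by norm_num) f r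
  norm_cast at this

theorem nrm_two_sq (f : E3 → ℝ) (r : ℝ) :
    nrm 2 f r ^ 2 = ∫ x in Metric.ball (0 : E3) r, f x ^ 2 := by
  have := nrm_rpow (q := 2) (by norm_num) f r
  norm_cast at this
  simpa using this

theorem hasDerivAt_abs_mul_self (t : ℝ) : HasDerivAt (fun t : ℝ => |t| * t) (2 * |t|) t := by
  rcases lt_trichotomy t 0 with h | h | h
  · have h1 : HasDerivAt (fun t : ℝ => -(t * t)) (2 * |t|) t := by
      have := ((hasDerivAt_id t).mul (hasDerivAt_id t)).neg
      rw [abs_of_neg h]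
      refine this.congr_deriv ?_
      simp only [id]
      ring
    refine h1.congr_of_eventuallyEq ?_
    filter_upwards [Iio_mem_nhds h] with y hy
    rw [abs_of_neg hy]
    ring
  · subst h
    rw [hasDerivAt_iff_tendsto_slope_zero]
    have : Filter.Tendsto (fun t : ℝ => |t|) (nhdsWithin 0 {0}ᶜ) (nhds 0) := by
      have := (continuous_abs.tendsto (0 : ℝ)).mono_left (nhdsWithin_le_nhds (s := {0}ᶜ))
      simpa using this
    simp only [abs_zero, mul_zero]
    refine this.congr' ?_
    filter_upwards [self_mem_nhdsWithin] with t ht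
    have ht' : t ≠ 0 := ht
    simp
    field_simp
  · have h1 : HasDerivAt (fun t : ℝ => t * t) (2 * |t|) t := by
      have := ((hasDerivAt_id t).mul (hasDerivAt_id t))
      rw [abs_of_pos h]
      refine this.congr_deriv ?_
      simp only [id]
      ring
    refine h1.congr_of_eventuallyEq ?_
    filter_upwards [Ioi_mem_nhds h] with y hy
    rw [abs_of_pos hy]

theorem contDiff_abs_mul_self : ContDiff ℝ 1 (fun t : ℝ => |t| * t) := by
  rw [contDiff_one_iff_deriv]
  refine ⟨fun t => (hasDerivAt_abs_mul_self t).differentiableAt, ?_⟩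
  have : deriv (fun t : ℝ => |t| * t) = fun t => 2 * |t| :=
    funext fun t => (hasDerivAt_abs_mul_self t).deriv
  rw [this]
  exact continuous_const.mul continuous_abs

/-- Testing `u = div Ψ` against `φ |u| u`. -/
theorem integral_cutoff_cube_le {u φ : E3 → ℝ} {Ψ : Fin 3 → E3 → ℝ} (hu : ContDiff ℝ 1 u)
    (hφ : ContDiff ℝ 1 φ) (hΨ : ∀ i, ContDiff ℝ 1 (Ψ i)) (h : ∀ x, u x = ∑ i, pd (Ψ i) i x)
    {s : ℝ} (hs : SuppIn φ s) :
    ∫ x, φ x * |u x| ^ 3 ≤ ∑ i, ∫ x, (|pd φ i x| * u x ^ 2 * |Ψ i x|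
      + 2 * |φ x| * |u x| * |pd u i x| * |Ψ i x|) := by
  have hg : ContDiff ℝ 1 fun x => |u x| * u x := contDiff_abs_mul_self.comp hu
  have hf : ContDiff ℝ 1 fun x => φ x * (|u x| * u x) := hφ.mul hg
  have hsf : SuppIn (fun x => φ x * (|u x| * u x)) s := hs.mul_right _
  have hpd : ∀ i x, pd (fun x => φ x * (|u x| * u x)) i x
      = pd φ i x * (|u x| * u x) + φ x * (2 * |u x| * pd u i x) := by
    intro i x
    rw [pd_mul (differentiableAt_of_contDiff_one hφ x) (differentiableAt_of_contDiff_one hg x)]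
    have := pd_comp (hasDerivAt_abs_mul_self (u x)).differentiableAt
      (differentiableAt_of_contDiff_one hu x) i
    rw [this, (hasDerivAt_abs_mul_self (u x)).deriv]
  have e1 : ∫ x, φ x * |u x| ^ 3 = ∑ i, ∫ x, φ x * (|u x| * u x) * pd (Ψ i) i x := by
    rw [← integral_finsetSum]
    · congr 1
      funext x
      rw [← Finset.mul_sum, ← h]
      have := abs_mul_abs_self (u x)
      linear_combination (φ x * |u x|) * this
    · exact fun i _ => (hsf.mul_right _).integrable (hf.continuous.mul (continuous_pd (hΨ i) i))
  rw [e1]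
  refine Finset.sum_le_sum fun i _ => ?_
  rw [integral_mul_pd hf (hΨ i) hsf i, ← integral_neg]
  have hcu : Continuous u := hu.continuous
  have hcφ : Continuous φ := hφ.continuous
  have hcΨ := (hΨ i).continuous
  have hcpφ := continuous_pd hφ i
  have hcpu := continuous_pd hu i
  refine integral_mono ?_ ?_ fun x => ?_
  · exact (((hsf.pd i).mul_right _).integrable ((continuous_pd hf i).mul hcΨ)).neg
  · refine SuppIn.integrable (s := s) (fun x hx => ?_) (by fun_prop)
    simp [hs x hx, hs.pd i x hx]
  · simp only [hpd]
    calc _ ≤ |-((pd φ i x * (|u x| * u x) + φ x * (2 * |u x| * pd u i x)) * Ψ i x)| := le_abs_self _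
      _ ≤ _ := by
        rw [abs_neg, add_mul]
        refine (abs_add_le _ _).trans (le_of_eq ?_)
        simp only [abs_mul, abs_abs, ← sq_abs (u x), abs_two]
        ring

theorem sq_le_of_cube_le {X a b : ℝ} (hX : 0 ≤ X) (ha : 0 ≤ a)
    (h : X ^ 3 ≤ a * X + b * X ^ 2) : X ^ 2 ≤ 2 * a + b ^ 2 := by
  rcases hX.eq_or_lt with h0 | h0
  · rw [← h0]
    nlinarith [sq_nonneg b]
  · have : X ^ 2 ≤ a + b * X := by
      have : X * X ^ 2 ≤ X * (a + b * X) := by nlinarith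
      exact le_of_mul_le_mul_left this h0
    nlinarith [sq_nonneg (X - b)]

theorem cube_le_of_cube_le {X a b : ℝ} (hX : 0 ≤ X) (ha : 0 ≤ a) (hb : 0 ≤ b)
    (h : X ^ 3 ≤ a + b * X ^ 2) : X ^ 3 ≤ 2 * a + 8 * b ^ 3 := by
  rcases le_or_gt X (2 * b) with h0 | h0
  · have : X ^ 3 ≤ (2 * b) ^ 3 := pow_le_pow_left₀ hX h0 3
    nlinarith
  · have : 2 * (b * X ^ 2) ≤ X ^ 3 := by nlinarith [sq_nonneg X]
    have : 0 ≤ b ^ 3 := by positivity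
    linarith

/-- Interpolation estimates for a function which is the divergence of a potential. -/
theorem exists_nrm_three_le : ∃ C : ℝ, 0 < C ∧ ∀ (u : E3 → ℝ) (Ψ : Fin 3 → E3 → ℝ),
    ContDiff ℝ 1 u → (∀ i, ContDiff ℝ 1 (Ψ i)) → (∀ x, u x = ∑ i, pd (Ψ i) i x) →
    ∀ r s M M3 D N : ℝ, 0 < r → r < s → (∀ i, nrm 6 (Ψ i) s ≤ M) → (∀ i, nrm 3 (Ψ i) s ≤ M3) →
    (∀ i, nrm 2 (pd u i) s ≤ D) → (∀ i, nrm (6 / 5) (fun x => u x * pd u i x) s ≤ N) →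
    nrm 3 u r ^ 2 ≤ C * (M * D + (M3 / (s - r)) ^ 2) ∧
    nrm 3 u r ^ 3 ≤ C * (M * N + (M3 / (s - r)) ^ 3) := by
  obtain ⟨C, hC, hcut⟩ := exists_cutoff_mid
  refine ⟨12 + (9 * C) ^ 2 + 8 * (9 * C) ^ 3, by positivity, ?_⟩
  intro u Ψ hu hΨ h r s M M3 D N hr hrs hM hM3 hD hN
  obtain ⟨ζ, hζ, hζ0, hζ1, hζr, hζs, hζd, -⟩ := hcut r s hr hrs
  have hd : 0 < s - r := by linarith
  have hs2 : (r + s) / 2 < s := by linarith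
  have hM0 : 0 ≤ M := (nrm_nonneg _ _ _).trans (hM 0)
  have hM30 : 0 ≤ M3 := (nrm_nonneg _ _ _).trans (hM3 0)
  have hD0 : 0 ≤ D := (nrm_nonneg _ _ _).trans (hD 0)
  have hN0 : 0 ≤ N := (nrm_nonneg _ _ _).trans (hN 0)
  have hζ1' : ContDiff ℝ 1 ζ := contDiff_one_of_top hζ
  have hcu := hu.continuous
  have hcζ := hζ1'.continuous
  have hcw : Continuous fun x => ζ x * u x := hcζ.mul hcu
  set X := nrm 3 (fun x => ζ x * u x) s with hX
  have hX0 : 0 ≤ X := nrm_nonneg _ _ _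
  have hrX : nrm 3 u r ≤ X := nrm_mono (by norm_num) hcu hcw hrs.le fun x hx => by
    
    have hx' : ‖x‖ < r := by simpa using hx
    simp [hζr x hx'.le]
  have hpd : ∀ i x, pd (fun x => ζ x ^ 3) i x = 3 * ζ x ^ 2 * pd ζ i x := by
    intro i x
    have := pd_comp (g := fun t : ℝ => t ^ 3) (f := ζ) (x := x) (by fun_prop)
      (differentiableAt_of_contDiff_one hζ1' x) i
    rw [this]
    simp
  have hX3 : X ^ 3 = ∫ x, ζ x ^ 3 * |u x| ^ 3 := by
    have hsup : SuppIn (fun x => ζ x ^ 3 * |u x| ^ 3) ((r + s) / 2) := fun x hx => by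
      simp [hζs x hx]
    rw [hX, nrm_pow_three, ← hsup.setIntegral_eq hs2]
    congr 1
    funext x
    rw [abs_mul, mul_pow, abs_of_nonneg (hζ0 x)]
  have hmain := integral_cutoff_cube_le hu (hζ1'.pow 3) hΨ h (s := (r + s) / 2)
    (fun x hx => by simp [hζs x hx])
  rw [← hX3] at hmain
  have hT2 : ∀ i, ∫ x in Metric.ball (0 : E3) s, |ζ x * u x| * |ζ x * u x| * |Ψ i x| ≤ X ^ 2 * M3 := by
    intro i
    refine (integral_abs_mul_mul_le (p := 3) (q := 3) (s := 3) (by norm_num) (by norm_num)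
      (by norm_num) (by norm_num) hcw hcw (hΨ i).continuous s).trans ?_
    rw [sq]
    exact mul_le_mul_of_nonneg_left (hM3 i) (by positivity)
  have hT1 : ∀ i, ∫ x in Metric.ball (0 : E3) s, |Ψ i x| * |ζ x * u x| * |pd u i x| ≤ M * X * D := by
    intro i
    refine (integral_abs_mul_mul_le (p := 6) (q := 3) (s := 2) (by norm_num) (by norm_num)
      (by norm_num) (by norm_num) (hΨ i).continuous hcw (continuous_pd hu i) s).trans ?_
    have := hM i
    have := hD i
    have := nrm_nonneg 2 (pd u i) s
    gcongr
  have hT1' : ∀ i, ∫ x in Metric.ball (0 : E3) s, |Ψ i x| * |u x * pd u i x| ≤ M * N := by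
    intro i
    refine (integral_abs_mul_le (p := 6) (q := 6 / 5) (by norm_num) (by norm_num)
      (by norm_num) (hΨ i).continuous (hcu.mul (continuous_pd hu i)) s).trans ?_
    have := hM i
    have := hN i
    exact mul_le_mul (hM i) (hN i) (nrm_nonneg _ _ _) hM0
  have hterm : ∀ (i : Fin 3) (K : ℝ) (k : E3 → ℝ), Continuous k →
      (∀ x, |ζ x ^ 3| * |u x| * |pd u i x| * |Ψ i x| ≤ k x) →
      ∫ x in Metric.ball (0 : E3) s, k x ≤ K →
      ∫ x, (|pd (fun x => ζ x ^ 3) i x| * u x ^ 2 * |Ψ i x|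
        + 2 * |ζ x ^ 3| * |u x| * |pd u i x| * |Ψ i x|) ≤ 2 * K + 3 * C / (s - r) * (X ^ 2 * M3) := by
    intro i K k hk hkb hK
    have hcΨ := (hΨ i).continuous
    have hcpu := continuous_pd hu i
    have hcpζ := continuous_pd hζ1' i
    have hsup : SuppIn (fun x => |pd (fun x => ζ x ^ 3) i x| * u x ^ 2 * |Ψ i x|
        + 2 * |ζ x ^ 3| * |u x| * |pd u i x| * |Ψ i x|) ((r + s) / 2) := fun x hx => by
      simp [hpd, hζs x hx]
    rw [← hsup.setIntegral_eq hs2]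
    have hcw2 : Continuous fun x => |ζ x * u x| * |ζ x * u x| * |Ψ i x| := by fun_prop
    calc _ ≤ ∫ x in Metric.ball (0 : E3) s,
          (2 * k x + 3 * C / (s - r) * (|ζ x * u x| * |ζ x * u x| * |Ψ i x|)) := by
          refine integral_mono (continuous_integrableOn_ball ?_ s)
            (continuous_integrableOn_ball (by fun_prop) s) fun x => ?_
          · simp only [hpd]
            fun_prop
          · simp only [hpd]
            have h1 := hζd i x
            have h2 := hkb x
            have h3 : |3 * ζ x ^ 2 * pd ζ i x| * u x ^ 2 * |Ψ i x|
                = 3 * |pd ζ i x| * (|ζ x * u x| * |ζ x * u x| * |Ψ i x|) := by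
              rw [abs_mul_abs_self, abs_mul, abs_mul, abs_of_nonneg (sq_nonneg (ζ x))]
              norm_num
              ring
            rw [h3]
            have h4 : 3 * |pd ζ i x| * (|ζ x * u x| * |ζ x * u x| * |Ψ i x|)
                ≤ 3 * (C / (s - r)) * (|ζ x * u x| * |ζ x * u x| * |Ψ i x|) := by gcongr
            have h5 : 3 * (C / (s - r)) = 3 * C / (s - r) := by ring
            rw [h5] at h4
            linarith
      _ = 2 * (∫ x in Metric.ball (0 : E3) s, k x) + 3 * C / (s - r) *
          ∫ x in Metric.ball (0 : E3) s, |ζ x * u x| * |ζ x * u x| * |Ψ i x| := by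
          rw [integral_add ((continuous_integrableOn_ball hk s).const_mul _)
            ((continuous_integrableOn_ball hcw2 s).const_mul _), integral_const_mul,
            integral_const_mul]
      _ ≤ _ := by
          have := hT2 i
          gcongr
  have hA : X ^ 3 ≤ 6 * (M * X * D) + 9 * C / (s - r) * (X ^ 2 * M3) := by
    refine hmain.trans ?_
    calc _ ≤ ∑ _i : Fin 3, (2 * (M * X * D) + 3 * C / (s - r) * (X ^ 2 * M3)) := by
          refine Finset.sum_le_sum fun i _ => hterm i (M * X * D)
            (fun x => |Ψ i x| * |ζ x * u x| * |pd u i x|) ?_ ?_ (hT1 i)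
          · have hcΨ := (hΨ i).continuous
            have hcpu := continuous_pd hu i
            fun_prop
          · intro x
            have h1 : |ζ x ^ 3| ≤ |ζ x| := by
              rw [abs_of_nonneg (pow_nonneg (hζ0 x) 3), abs_of_nonneg (hζ0 x)]
              exact pow_le_of_le_one (hζ0 x) (hζ1 x) (by norm_num)
            calc _ ≤ |ζ x| * |u x| * |pd u i x| * |Ψ i x| := by gcongr
              _ = _ := by rw [abs_mul]; ring
      _ = _ := by simp; ring
  have hB : X ^ 3 ≤ 6 * (M * N) + 9 * C / (s - r) * (X ^ 2 * M3) := by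
    refine hmain.trans ?_
    calc _ ≤ ∑ _i : Fin 3, (2 * (M * N) + 3 * C / (s - r) * (X ^ 2 * M3)) := by
          refine Finset.sum_le_sum fun i _ => hterm i (M * N)
            (fun x => |Ψ i x| * |u x * pd u i x|) ?_ ?_ (hT1' i)
          · have hcΨ := (hΨ i).continuous
            have hcpu := continuous_pd hu i
            fun_prop
          · intro x
            have h1 : |ζ x ^ 3| ≤ 1 := by
              rw [abs_of_nonneg (pow_nonneg (hζ0 x) 3)]
              exact pow_le_one₀ (hζ0 x) (hζ1 x)
            calc _ ≤ 1 * |u x| * |pd u i x| * |Ψ i x| := by gcongr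
              _ = _ := by rw [abs_mul]; ring
      _ = _ := by simp; ring
  have hq : 0 ≤ M3 / (s - r) := by positivity
  have hA2 := sq_le_of_cube_le (X := X) (a := 6 * (M * D)) (b := 9 * C * (M3 / (s - r))) hX0
    (by positivity) (hA.trans (le_of_eq (by ring)))
  have hB2 := cube_le_of_cube_le (X := X) (a := 6 * (M * N)) (b := 9 * C * (M3 / (s - r))) hX0
    (by positivity) (by positivity) (hB.trans (le_of_eq (by ring)))
  have hu0 := nrm_nonneg 3 u r
  constructor
  · refine ((pow_le_pow_left₀ hu0 hrX 2).trans hA2).trans ?_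
    have h1 : 0 ≤ M * D := by positivity
    have h2 : 0 ≤ (M3 / (s - r)) ^ 2 := by positivity
    have h3 : 0 ≤ ((9 * C) ^ 2 + 8 * (9 * C) ^ 3) * (M * D) := by positivity
    have h4 : 0 ≤ (12 + 8 * (9 * C) ^ 3) * (M3 / (s - r)) ^ 2 := by positivity
    nlinarith
  · refine ((pow_le_pow_left₀ hu0 hrX 3).trans hB2).trans ?_
    have h1 : 0 ≤ M * N := by positivity
    have h2 : 0 ≤ (M3 / (s - r)) ^ 3 := by positivity
    have h3 : 0 ≤ ((9 * C) ^ 2 + 8 * (9 * C) ^ 3) * (M * N) := by positivity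
    have h4 : 0 ≤ (12 + (9 * C) ^ 2) * (M3 / (s - r)) ^ 3 := by positivity
    nlinarith

theorem ofReal_nrm {q : ℝ} (hq : 0 < q) {f : E3 → ℝ} (hf : Continuous f) (r : ℝ) :
    ENNReal.ofReal (nrm q f r) =
      eLpNorm f (ENNReal.ofReal q) (volume.restrict (Metric.ball (0 : E3) r)) := by
  rw [(continuous_memLp_ball hf r _).eLpNorm_eq_integral_rpow_norm
    (by simpa using hq) ENNReal.ofReal_ne_top, ENNReal.toReal_ofReal hq.le]
  simp [nrm, Real.norm_eq_abs]

theorem nrm_sum_le {ι : Type*} (t : Finset ι) {q : ℝ} (hq : 1 ≤ q) {f : ι → E3 → ℝ}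
    (hf : ∀ i, Continuous (f i)) (r : ℝ) :
    nrm q (fun x => ∑ i ∈ t, f i x) r ≤ ∑ i ∈ t, nrm q (f i) r := by
  classical
  induction t using Finset.induction_on with
  | empty =>
    have : q ≠ 0 := by linarith
    simp [nrm, Real.zero_rpow this]
    rw [Real.zero_rpow (inv_ne_zero this)]
  | insert a t ha ih =>
    simp only [Finset.sum_insert ha]
    exact (nrm_add_le hq (hf a) (continuous_finsetSum _ fun i _ => hf i) r).trans
      (add_le_add le_rfl ih)

theorem nrm_abs (q : ℝ) (f : E3 → ℝ) (r : ℝ) : nrm q (fun x => |f x|) r = nrm q f r := by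
  simp [nrm]

theorem norm_fderiv_le (u : E3 → ℝ) (x : E3) : ‖fderiv ℝ u x‖ ≤ ∑ i, |pd u i x| := by
  refine ContinuousLinearMap.opNorm_le_bound _ (Finset.sum_nonneg fun i _ => abs_nonneg _) fun h => ?_
  rw [fderiv_eq_sum_pd, Real.norm_eq_abs, Finset.sum_mul]
  refine (Finset.abs_sum_le_sum_abs _ _).trans (Finset.sum_le_sum fun i _ => ?_)
  rw [abs_mul, mul_comm]
  exact mul_le_mul_of_nonneg_left (abs_coord_le h i) (abs_nonneg _)

/-- The Sobolev inequality `W^{1,2} → L⁶` between concentric balls. -/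
theorem exists_nrm_six_le : ∃ C : ℝ, 0 < C ∧ ∀ u : E3 → ℝ, ContDiff ℝ 1 u →
    ∀ r s : ℝ, 0 < r → r < s →
      nrm 6 u r ≤ C * (∑ i, nrm 2 (pd u i) s + nrm 2 u s / (s - r)) := by
  obtain ⟨C, hC, hcut⟩ := exists_cutoff_mid
  obtain ⟨K, hK⟩ : ∃ K : NNReal, K = SNormLESNormFDerivOfEqConst ℝ (volume : Measure E3) (2 : NNReal) :=
    ⟨_, rfl⟩
  refine ⟨(K + 1) * (1 + 3 * C), by positivity, fun u hu r s hr hrs => ?_⟩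
  obtain ⟨ζ, hζ, hζ0, hζ1, hζr, hζs, hζd, -⟩ := hcut r s hr hrs
  have hd : 0 < s - r := by linarith
  have hs2 : (r + s) / 2 < s := by linarith
  have hζ1' : ContDiff ℝ 1 ζ := contDiff_one_of_top hζ
  have hw : ContDiff ℝ 1 fun x => ζ x * u x := hζ1'.mul hu
  have hws : SuppIn (fun x => ζ x * u x) ((r + s) / 2) := hζs.mul_right u
  have hcu := hu.continuous
  have hcpu := fun i => continuous_pd hu i
  set H : E3 → ℝ := fun x => (∑ i, |pd u i x|) + 3 * C / (s - r) * |u x| with hH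
  have hcH : Continuous H := by fun_prop
  have hH0 : ∀ x, 0 ≤ H x := fun x =>
    add_nonneg (Finset.sum_nonneg fun i _ => abs_nonneg _) (by positivity)
  have hbound : ∀ x, ‖fderiv ℝ (fun x => ζ x * u x) x‖ ≤
      ‖(Metric.ball (0 : E3) s).indicator H x‖ := by
    intro x
    refine (norm_fderiv_le _ x).trans ?_
    by_cases hx : x ∈ Metric.ball (0 : E3) s
    · rw [Set.indicator_of_mem hx, Real.norm_of_nonneg (hH0 x)]
      have e : ∀ i, |pd (fun x => ζ x * u x) i x| ≤ |pd u i x| + C / (s - r) * |u x| := by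
        intro i
        rw [pd_mul (differentiableAt_of_contDiff_one hζ1' x) (differentiableAt_of_contDiff_one hu x)]
        refine (abs_add_le _ _).trans ?_
        rw [abs_mul, abs_mul, add_comm, abs_of_nonneg (hζ0 x)]
        exact add_le_add (mul_le_of_le_one_left (abs_nonneg _) (hζ1 x))
          (mul_le_mul_of_nonneg_right (hζd i x) (abs_nonneg _))
      refine (Finset.sum_le_sum fun i _ => e i).trans (le_of_eq ?_)
      rw [Finset.sum_add_distrib, hH]
      simp
      ring
    · have hx' : (r + s) / 2 < ‖x‖ := by
        simp only [Metric.mem_ball, dist_zero_right, not_lt] at hx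
        linarith
      have : ∀ i, pd (fun x => ζ x * u x) i x = 0 := fun i => hws.pd i x hx'
      simp [this]
  have h1 := eLpNorm_le_eLpNorm_fderiv_of_eq (volume : Measure E3) (F := ℝ) (p := 2) (p' := 6) hw
    hws.hasCompactSupport (by norm_num) (by simp) (by
      simp
      norm_num)
  simp only [NNReal.coe_ofNat] at h1 hK
  rw [← hK] at h1
  have h2 : eLpNorm (fderiv ℝ fun x => ζ x * u x) ((2 : NNReal) : ENNReal) volume ≤
      ENNReal.ofReal (nrm 2 H s) := by
    refine (eLpNorm_mono hbound).trans ?_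
    rw [eLpNorm_indicator_eq_eLpNorm_restrict measurableSet_ball, ofReal_nrm (by norm_num) hcH]
    simp
  have h3 : ENNReal.ofReal (nrm 6 u r) ≤ eLpNorm (fun x => ζ x * u x) ((6 : NNReal) : ENNReal) volume := by
    rw [ofReal_nrm (by norm_num) hcu,
      ← eLpNorm_indicator_eq_eLpNorm_restrict (f := u) measurableSet_ball]
    have e6 : ENNReal.ofReal 6 = ((6 : NNReal) : ENNReal) := by simp
    rw [e6]
    refine eLpNorm_mono fun x => ?_
    by_cases hx : x ∈ Metric.ball (0 : E3) r
    · have hx' : ‖x‖ < r := by simpa using hx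
      simp [Set.indicator_of_mem hx, hζr x hx'.le]
    · rw [Set.indicator_of_notMem hx, norm_zero]
      exact norm_nonneg _
  have h4 : nrm 6 u r ≤ K * nrm 2 H s := by
    have h5 : ENNReal.ofReal (nrm 6 u r) ≤ ENNReal.ofReal (K * nrm 2 H s) := by
      rw [ENNReal.ofReal_mul K.coe_nonneg, ENNReal.ofReal_coe_nnreal]
      exact h3.trans (h1.trans (by gcongr))
    exact (ENNReal.ofReal_le_ofReal_iff (mul_nonneg K.coe_nonneg (nrm_nonneg _ _ _))).1 h5
  have h6 : nrm 2 H s ≤ ∑ i, nrm 2 (pd u i) s + 3 * C / (s - r) * nrm 2 u s := by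
    refine (nrm_add_le (by norm_num) (by fun_prop) (by fun_prop) s).trans (add_le_add ?_ ?_)
    · refine (nrm_sum_le _ (by norm_num) (fun i => (hcpu i).abs) s).trans (le_of_eq ?_)
      simp [nrm_abs]
    · rw [nrm_const_mul (by norm_num), nrm_abs, abs_of_nonneg (by positivity)]
  have hD : 0 ≤ ∑ i, nrm 2 (pd u i) s := Finset.sum_nonneg fun i _ => nrm_nonneg _ _ _
  have hU : 0 ≤ nrm 2 u s / (s - r) := div_nonneg (nrm_nonneg _ _ _) hd.le
  have hK0 : (0 : ℝ) ≤ K := K.coe_nonneg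
  calc nrm 6 u r ≤ K * nrm 2 H s := h4
    _ ≤ (K + 1) * (∑ i, nrm 2 (pd u i) s + 3 * C / (s - r) * nrm 2 u s) := by
        apply mul_le_mul _ h6 (nrm_nonneg _ _ _) (by positivity)
        linarith
    _ ≤ (K + 1) * ((1 + 3 * C) * (∑ i, nrm 2 (pd u i) s + nrm 2 u s / (s - r))) := by
        apply mul_le_mul_of_nonneg_left _ (by positivity)
        have e : 3 * C / (s - r) * nrm 2 u s = 3 * C * (nrm 2 u s / (s - r)) := by ring
        rw [e]
        nlinarith [mul_nonneg hC.le hD]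
    _ = _ := by ring

/-- A divergence has small mean, so its `L⁶` norm is controlled by its oscillation. -/
theorem exists_nrm_six_le_osc : ∃ C : ℝ, 0 < C ∧ ∀ (b : E3 → ℝ) (Ψ : Fin 3 → E3 → ℝ),
    Continuous b → (∀ i, ContDiff ℝ 1 (Ψ i)) → (∀ x, b x = ∑ i, pd (Ψ i) i x) →
    ∀ s m M β : ℝ, 0 < s → (∀ i, nrm 6 (Ψ i) s ≤ M) → nrm 6 (fun x => b x - m) s ≤ β →
      nrm 6 b s ≤ C * (M / s + β) := by
  obtain ⟨C, hC, hcut⟩ := exists_cutoff_mid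
  refine ⟨9 + 48 * C, by positivity, fun b Ψ hb hΨ h s m M β hs hM hβ => ?_⟩
  obtain ⟨χ, hχ, hχ0, hχ1, hχr, hχs, hχd, -⟩ := hcut (s / 2) s (by linarith) (by linarith)
  have hs2 : (s / 2 + s) / 2 < s := by linarith
  have hχ1' : ContDiff ℝ 1 χ := contDiff_one_of_top hχ
  have hcχ := hχ1'.continuous
  have hcb : Continuous fun x => b x - m := hb.sub continuous_const
  set V : ℝ := s ^ 3 * ballVol with hV
  have hV0 : 0 < V := mul_pos (by positivity) ballVol_pos
  have hM0 : 0 ≤ M := (nrm_nonneg _ _ _).trans (hM 0)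
  have hβ0 : 0 ≤ β := (nrm_nonneg _ _ _).trans hβ
  have hL1 : ∀ (f : E3 → ℝ) (A : ℝ), Continuous f → nrm 6 f s ≤ A →
      ∫ x in Metric.ball (0 : E3) s, |f x| ≤ A * V ^ (5 / 6 : ℝ) := by
    intro f A hf hA
    have := nrm_le_nrm (p := 6) (q := 1) (t := 6 / 5) (by norm_num) (by norm_num) (by norm_num)
      (by norm_num) hf hs.le
    have e : nrm 1 f s = ∫ x in Metric.ball (0 : E3) s, |f x| := by simp [nrm]
    rw [e] at this
    norm_num at this
    exact this.trans (mul_le_mul_of_nonneg_right hA (by positivity))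
  have h1 : |∫ x, χ x * b x| ≤ 6 * C / s * M * V ^ (5 / 6 : ℝ) := by
    have e : ∫ x, χ x * b x = ∑ i, ∫ x, -(pd χ i x * Ψ i x) := by
      simp_rw [h, Finset.mul_sum]
      rw [integral_finsetSum]
      · refine Finset.sum_congr rfl fun i _ => ?_
        rw [integral_mul_pd hχ1' (hΨ i) hχs i, integral_neg]
      · exact fun i _ => (hχs.mul_right _).integrable (hcχ.mul (continuous_pd (hΨ i) i))
    rw [e]
    refine (Finset.abs_sum_le_sum_abs _ _).trans ?_
    have : ∀ i, |∫ x, -(pd χ i x * Ψ i x)| ≤ 2 * C / s * (M * V ^ (5 / 6 : ℝ)) := by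
      intro i
      have hsp : SuppIn (fun x => -(pd χ i x * Ψ i x)) ((s / 2 + s) / 2) := fun x hx => by
        simp [hχs.pd i x hx]
      rw [← hsp.setIntegral_eq hs2]
      have hcp := continuous_pd hχ1' i
      have hcΨ := (hΨ i).continuous
      calc _ ≤ ∫ x in Metric.ball (0 : E3) s, |-(pd χ i x * Ψ i x)| := abs_integral_le_integral_abs
        _ ≤ ∫ x in Metric.ball (0 : E3) s, 2 * C / s * |Ψ i x| := by
            refine integral_mono (continuous_integrableOn_ball (by fun_prop) s)
              (continuous_integrableOn_ball (by fun_prop) s) fun x => ?_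
            simp only [abs_neg, abs_mul]
            refine mul_le_mul_of_nonneg_right ((hχd i x).trans (le_of_eq ?_)) (abs_nonneg _)
            field_simp
            ring
        _ ≤ _ := by
            rw [integral_const_mul]
            exact mul_le_mul_of_nonneg_left (hL1 _ _ hcΨ (hM i)) (by positivity)
    refine (Finset.sum_le_sum fun i _ => this i).trans (le_of_eq ?_)
    simp
    ring
  have h2 : |∫ x, χ x * (b x - m)| ≤ β * V ^ (5 / 6 : ℝ) := by
    have hsp : SuppIn (fun x => χ x * (b x - m)) ((s / 2 + s) / 2) := hχs.mul_right _
    rw [← hsp.setIntegral_eq hs2]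
    calc _ ≤ ∫ x in Metric.ball (0 : E3) s, |χ x * (b x - m)| := abs_integral_le_integral_abs
      _ ≤ ∫ x in Metric.ball (0 : E3) s, |b x - m| := by
          refine integral_mono (continuous_integrableOn_ball (by fun_prop) s)
            (continuous_integrableOn_ball (by fun_prop) s) fun x => ?_
          simp only [abs_mul, abs_of_nonneg (hχ0 x)]
          exact mul_le_of_le_one_left (abs_nonneg _) (hχ1 x)
      _ ≤ _ := hL1 _ _ hcb hβ
  have hiχ : Integrable χ := hχs.integrable hcχ
  have h3 : ∫ x, χ x * b x = (∫ x, χ x * (b x - m)) + m * ∫ x, χ x := by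
    rw [← integral_const_mul, ← integral_add ((hχs.mul_right _).integrable (hcχ.mul hcb))
      (hiχ.const_mul m)]
    congr 1
    funext x
    ring
  have h4 : V / 8 ≤ ∫ x, χ x := by
    calc V / 8 = ∫ x in Metric.ball (0 : E3) (s / 2), (1 : ℝ) := by
          rw [setIntegral_const, volume_real_ball (by positivity), hV]
          simp
          ring
      _ = ∫ x in Metric.ball (0 : E3) (s / 2), χ x := by
          refine setIntegral_congr_fun measurableSet_ball fun x hx => ?_
          have hx' : ‖x‖ < s / 2 := by simpa using hx
          exact (hχr x hx'.le).symm
      _ ≤ _ := setIntegral_le_integral hiχ (Filter.Eventually.of_forall hχ0)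
  have h5 : |m| * (V / 8) ≤ (6 * C / s * M + β) * V ^ (5 / 6 : ℝ) := by
    have : |m * ∫ x, χ x| ≤ (6 * C / s * M + β) * V ^ (5 / 6 : ℝ) := by
      have e : m * ∫ x, χ x = (∫ x, χ x * b x) - ∫ x, χ x * (b x - m) := by rw [h3]; ring
      rw [e, add_mul]
      exact (abs_sub _ _).trans (add_le_add h1 h2)
    refine le_trans ?_ this
    rw [abs_mul]
    exact mul_le_mul_of_nonneg_left (h4.trans (le_abs_self _)) (abs_nonneg _)
  have h6 : |m| * V ^ (1 / 6 : ℝ) ≤ 8 * (6 * C / s * M + β) := by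
    have hp : 0 < V ^ (5 / 6 : ℝ) := by positivity
    refine le_of_mul_le_mul_right ?_ hp
    have e : V ^ (1 / 6 : ℝ) * V ^ (5 / 6 : ℝ) = V := by
      rw [← Real.rpow_add hV0]
      norm_num
    rw [mul_assoc, e]
    linarith
  have h7 : nrm 6 (fun _ => m) s = |m| * V ^ (1 / 6 : ℝ) := by
    have := nrm_const_mul (q := 6) (by norm_num) (fun _ => (1 : ℝ)) s m
    simp only [mul_one] at this
    rw [this]
    simp [nrm, volume_real_ball hs.le, hV]
  have h8 := nrm_add_le (q := 6) (by norm_num) hcb (continuous_const (y := m)) s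
  simp only [sub_add_cancel] at h8
  rw [h7] at h8
  have e : 6 * C / s * M = 6 * C * (M / s) := by ring
  rw [e] at h6
  have hMs : 0 ≤ M / s := by positivity
  nlinarith [mul_nonneg hC.le hβ0]

/-- Integrable functions with vanishing integral. -/
def ZeroInt (f : E3 → ℝ) : Prop := Integrable f ∧ ∫ x, f x = 0

theorem ZeroInt.add {f g : E3 → ℝ} (hf : ZeroInt f) (hg : ZeroInt g) :
    ZeroInt fun x => f x + g x :=
  ⟨hf.1.add hg.1, by rw [integral_add hf.1 hg.1, hf.2, hg.2, add_zero]⟩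

theorem ZeroInt.sub {f g : E3 → ℝ} (hf : ZeroInt f) (hg : ZeroInt g) :
    ZeroInt fun x => f x - g x :=
  ⟨hf.1.sub hg.1, by rw [integral_sub hf.1 hg.1, hf.2, hg.2, sub_zero]⟩

theorem ZeroInt.const_mul {f : E3 → ℝ} (hf : ZeroInt f) (c : ℝ) : ZeroInt fun x => c * f x :=
  ⟨hf.1.const_mul c, by rw [integral_const_mul, hf.2, mul_zero]⟩

theorem ZeroInt.sum {ι : Type*} {t : Finset ι} {f : ι → E3 → ℝ} (hf : ∀ i, ZeroInt (f i)) :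
    ZeroInt fun x => ∑ i ∈ t, f i x :=
  ⟨integrable_finsetSum _ fun i _ => (hf i).1, by
    rw [integral_finsetSum _ fun i _ => (hf i).1]
    exact Finset.sum_eq_zero fun i _ => (hf i).2⟩

theorem zeroInt_pd {f : E3 → ℝ} (hf : ContDiff ℝ 1 f) {s : ℝ} (hs : SuppIn f s) (i : Fin 3) :
    ZeroInt (pd f i) :=
  ⟨(hs.pd i).integrable (continuous_pd hf i), integral_pd_eq_zero hf hs i⟩

theorem differentiableAt_of_top {f : E3 → ℝ} (hf : ContDiff ℝ (⊤ : ℕ∞) f) (x : E3) :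
    DifferentiableAt ℝ f x := differentiableAt_of_contDiff_one (contDiff_one_of_top hf) x

theorem zeroInt_lap {φ : E3 → ℝ} (hφ : ContDiff ℝ (⊤ : ℕ∞) φ) {s : ℝ} (hs : SuppIn φ s)
    {u : E3 → ℝ} (hu : ContDiff ℝ (⊤ : ℕ∞) u) :
    ZeroInt fun x => φ x * u x * lap u x + φ x * ∑ i, pd u i x ^ 2
      + u x * ∑ i, pd φ i x * pd u i x := by
  have h : ∀ i, ZeroInt (pd (fun x => φ x * (u x * pd u i x)) i) := fun i =>
    zeroInt_pd (contDiff_one_of_top (hφ.mul (hu.mul (contDiff_pd hu i)))) (hs.mul_right _) i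
  convert ZeroInt.sum (t := Finset.univ) h using 1
  funext x
  have e : ∀ i, pd (fun x => φ x * (u x * pd u i x)) i x = pd φ i x * (u x * pd u i x)
      + φ x * (pd u i x * pd u i x + u x * pd (pd u i) i x) := fun i => by
    rw [pd_mul (differentiableAt_of_top hφ x) (differentiableAt_of_top (hu.mul (contDiff_pd hu i)) x),
      pd_mul (differentiableAt_of_top hu x) (differentiableAt_of_top (contDiff_pd hu i) x)]
  simp only [e, lap, Fin.sum_univ_three]
  ring

theorem zeroInt_transport {φ : E3 → ℝ} (hφ : ContDiff ℝ (⊤ : ℕ∞) φ) {s : ℝ} (hs : SuppIn φ s)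
    {w : Fin 3 → E3 → ℝ} (hw : ∀ i, ContDiff ℝ (⊤ : ℕ∞) (w i))
    (hdiv : ∀ x, ∑ i, pd (w i) i x = 0) {q : E3 → ℝ} (hq : ContDiff ℝ (⊤ : ℕ∞) q) :
    ZeroInt fun x => φ x * ∑ i, w i x * pd q i x + q x * ∑ i, pd φ i x * w i x := by
  have h : ∀ i, ZeroInt (pd (fun x => φ x * (w i x * q x)) i) := fun i =>
    zeroInt_pd (contDiff_one_of_top (hφ.mul ((hw i).mul hq))) (hs.mul_right _) i
  convert ZeroInt.sum (t := Finset.univ) h using 1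
  funext x
  have e : ∀ i, pd (fun x => φ x * (w i x * q x)) i x = pd φ i x * (w i x * q x)
      + φ x * (pd (w i) i x * q x + w i x * pd q i x) := fun i => by
    rw [pd_mul (differentiableAt_of_top hφ x) (differentiableAt_of_top ((hw i).mul hq) x),
      pd_mul (differentiableAt_of_top (hw i) x) (differentiableAt_of_top hq x)]
  have hd := hdiv x
  simp only [e, Fin.sum_univ_three] at hd ⊢
  linear_combination -(φ x * q x) * hd

theorem zeroInt_curl {φ : E3 → ℝ} (hφ : ContDiff ℝ (⊤ : ℕ∞) φ) {s : ℝ} (hs : SuppIn φ s)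
    {B : E3 → Fin 3 → ℝ} (hB : ∀ i, ContDiff ℝ (⊤ : ℕ∞) fun x => B x i)
    {Y : E3 → Fin 3 → ℝ} (hY : ∀ i, ContDiff ℝ (⊤ : ℕ∞) fun x => Y x i) :
    ZeroInt fun x => φ x * ∑ j, B x j * curl3 Y x j
      - ∑ j, (φ x * curl3 B x j + cross3 (fun i => pd φ i x) (B x) j) * Y x j := by
  have h : ∀ i j k, ZeroInt (pd (fun x => φ x * (B x j * Y x k)) i) := fun i j k =>
    zeroInt_pd (contDiff_one_of_top (hφ.mul ((hB j).mul (hY k)))) (hs.mul_right _) i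
  have H := (((((h 1 0 2).sub (h 2 0 1)).add (h 2 1 0)).sub (h 0 1 2)).add (h 0 2 1)).sub (h 1 2 0)
  convert H using 1
  funext x
  have e : ∀ i j k, pd (fun x => φ x * (B x j * Y x k)) i x = pd φ i x * (B x j * Y x k)
      + φ x * (pd (fun x => B x j) i x * Y x k + B x j * pd (fun x => Y x k) i x) := fun i j k => by
    rw [pd_mul (differentiableAt_of_top hφ x) (differentiableAt_of_top ((hB j).mul (hY k)) x),
      pd_mul (differentiableAt_of_top (hB j) x) (differentiableAt_of_top (hY k) x)]
  simp only [e, Fin.sum_univ_three, curl3, cross3, Matrix.cons_val_zero, Matrix.cons_val_one,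
    Matrix.cons_val]
  ring

/-- Smooth solutions of the stationary Hall-MHD system, in components. -/
structure IsHallMHD (v B : Fin 3 → E3 → ℝ) (p : E3 → ℝ) : Prop where
  smooth_v : ∀ j, ContDiff ℝ (⊤ : ℕ∞) (v j)
  smooth_B : ∀ j, ContDiff ℝ (⊤ : ℕ∞) (B j)
  smooth_p : ContDiff ℝ (⊤ : ℕ∞) p
  momentum : ∀ x j, -lap (v j) x + ∑ i, v i x * pd (v j) i x
    = -pd p j x + ∑ i, B i x * pd (B j) i x
  induction : ∀ x j, -lap (B j) x + ∑ i, v i x * pd (B j) i x - ∑ i, B i x * pd (v j) i x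
    = curl3 (fun y => cross3 (curl3 (fun y i => B i y) y) fun i => B i y) x j
  div_v : ∀ x, ∑ i, pd (v i) i x = 0
  div_B : ∀ x, ∑ i, pd (B i) i x = 0

theorem contDiff_curl3 {B : Fin 3 → E3 → ℝ} (hB : ∀ i, ContDiff ℝ (⊤ : ℕ∞) (B i)) (j : Fin 3) :
    ContDiff ℝ (⊤ : ℕ∞) fun x => curl3 (fun y i => B i y) x j := by
  have h : ∀ i k, ContDiff ℝ (⊤ : ℕ∞) (pd (B i) k) := fun i k => contDiff_pd (hB i) k
  fin_cases j
  · exact (h 2 1).sub (h 1 2)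
  · exact (h 0 2).sub (h 2 0)
  · exact (h 1 0).sub (h 0 1)

theorem contDiff_cross3 {a b : E3 → Fin 3 → ℝ} (ha : ∀ i, ContDiff ℝ (⊤ : ℕ∞) fun x => a x i)
    (hb : ∀ i, ContDiff ℝ (⊤ : ℕ∞) fun x => b x i) (j : Fin 3) :
    ContDiff ℝ (⊤ : ℕ∞) fun x => cross3 (a x) (b x) j := by
  fin_cases j
  · exact ((ha 1).mul (hb 2)).sub ((ha 2).mul (hb 1))
  · exact ((ha 2).mul (hb 0)).sub ((ha 0).mul (hb 2))
  · exact ((ha 0).mul (hb 1)).sub ((ha 1).mul (hb 0))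

theorem pd_sq {f : E3 → ℝ} {x : E3} (hf : DifferentiableAt ℝ f x) (i : Fin 3) :
    pd (fun y => f y ^ 2) i x = 2 * f x * pd f i x := by
  have := pd_mul hf hf i
  simp only [sq]
  rw [this]
  ring

/-- The local energy balance. -/
theorem IsHallMHD.energy {v B : Fin 3 → E3 → ℝ} {p : E3 → ℝ} (H : IsHallMHD v B p)
    {φ : E3 → ℝ} (hφ : ContDiff ℝ (⊤ : ℕ∞) φ) {s : ℝ} (hs : SuppIn φ s) :
    ZeroInt fun x => φ x * (∑ j, ∑ i, (pd (v j) i x ^ 2 + pd (B j) i x ^ 2))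
      + (∑ j, ∑ i, pd φ i x * (v j x * pd (v j) i x + B j x * pd (B j) i x))
      - (∑ j, (v j x ^ 2 + B j x ^ 2)) / 2 * (∑ i, pd φ i x * v i x)
      + (∑ j, v j x * B j x) * (∑ i, pd φ i x * B i x)
      - (∑ j, cross3 (fun i => pd φ i x) (fun i => B i x) j *
          cross3 (curl3 (fun y i => B i y) x) (fun i => B i x) j)
      - p x * (∑ i, pd φ i x * v i x) := by
  have sv := H.smooth_v
  have sB := H.smooth_B
  set Y : E3 → Fin 3 → ℝ := fun y => cross3 (curl3 (fun y i => B i y) y) fun i => B i y with hY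
  have sY : ∀ j, ContDiff ℝ (⊤ : ℕ∞) fun x => Y x j := fun j =>
    contDiff_cross3 (contDiff_curl3 sB) sB j
  have sq1 : ContDiff ℝ (⊤ : ℕ∞) fun x => ∑ j, (v j x ^ 2 + B j x ^ 2) :=
    ContDiff.sum fun j _ => ((sv j).pow 2).add ((sB j).pow 2)
  have sq2 : ContDiff ℝ (⊤ : ℕ∞) fun x => ∑ j, v j x * B j x :=
    ContDiff.sum fun j _ => (sv j).mul (sB j)
  have dq1 : ∀ i x, pd (fun x => ∑ j, (v j x ^ 2 + B j x ^ 2)) i x =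
      ∑ j, (2 * v j x * pd (v j) i x + 2 * B j x * pd (B j) i x) := fun i x => by
    rw [pd_sum fun j _ => differentiableAt_of_top (((sv j).pow 2).add ((sB j).pow 2)) x]
    refine Finset.sum_congr rfl fun j _ => ?_
    rw [pd_add (differentiableAt_of_top ((sv j).pow 2) x) (differentiableAt_of_top ((sB j).pow 2) x),
      pd_sq (differentiableAt_of_top (sv j) x), pd_sq (differentiableAt_of_top (sB j) x)]
  have dq2 : ∀ i x, pd (fun x => ∑ j, v j x * B j x) i x =
      ∑ j, (pd (v j) i x * B j x + v j x * pd (B j) i x) := fun i x => by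
    rw [pd_sum fun j _ => differentiableAt_of_top ((sv j).mul (sB j)) x]
    refine Finset.sum_congr rfl fun j _ => ?_
    rw [pd_mul (differentiableAt_of_top (sv j) x) (differentiableAt_of_top (sB j) x)]
  have Zv := fun j => zeroInt_lap hφ hs (sv j)
  have ZB := fun j => zeroInt_lap hφ hs (sB j)
  have Zq := zeroInt_transport hφ hs sv H.div_v sq1
  have Zp := zeroInt_transport hφ hs sv H.div_v H.smooth_p
  have Zc := zeroInt_transport hφ hs sB H.div_B sq2
  have Zh := zeroInt_curl hφ hs (B := fun y i => B i y) sB sY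
  have Zall := ((((ZeroInt.sum (t := Finset.univ) fun j => (Zv j).add (ZB j)).sub Zp).sub
    (Zq.const_mul (1 / 2))).add Zc).add Zh
  convert Zall using 1
  funext x
  have hJY : ∑ j, curl3 (fun y i => B i y) x j * Y x j = 0 := by
    simp only [hY, cross3, Fin.sum_univ_three, Matrix.cons_val_zero, Matrix.cons_val_one,
      Matrix.cons_val]
    ring
  have hYx : cross3 (curl3 (fun y i => B i y) x) (fun i => B i x) = Y x := rfl
  have m := H.momentum x
  have n : ∀ j, -lap (B j) x + ∑ i, v i x * pd (B j) i x - ∑ i, B i x * pd (v j) i x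
    = curl3 Y x j := H.induction x
  have m0 := m 0
  have m1 := m 1
  have m2 := m 2
  have n0 := n 0
  have n1 := n 1
  have n2 := n 2
  rw [hYx]
  simp only [dq1, dq2]
  simp only [Fin.sum_univ_three] at hJY m0 m1 m2 n0 n1 n2 ⊢
  linear_combination φ x * (v 0 x * m0 + v 1 x * m1 + v 2 x * m2 + B 0 x * n0 + B 1 x * n1
    + B 2 x * n2 + hJY)

/-- The sum of the absolute values of the components of a field. -/
noncomputable def amp (v : Fin 3 → E3 → ℝ) (x : E3) : ℝ := ∑ j, |v j x|

/-- The sum of the absolute values of the first derivatives of a field. -/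
noncomputable def gradAmp (v : Fin 3 → E3 → ℝ) (x : E3) : ℝ := ∑ j, ∑ i, |pd (v j) i x|

/-- The joint amplitude of two fields. -/
noncomputable def amp₂ (v B : Fin 3 → E3 → ℝ) (x : E3) : ℝ := amp v x + amp B x

/-- The joint amplitude of the gradients of two fields. -/
noncomputable def gradAmp₂ (v B : Fin 3 → E3 → ℝ) (x : E3) : ℝ := gradAmp v x + gradAmp B x

theorem amp_nonneg (v : Fin 3 → E3 → ℝ) (x : E3) : 0 ≤ amp v x :=
  Finset.sum_nonneg fun _ _ => abs_nonneg _

theorem gradAmp_nonneg (v : Fin 3 → E3 → ℝ) (x : E3) : 0 ≤ gradAmp v x :=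
  Finset.sum_nonneg fun _ _ => Finset.sum_nonneg fun _ _ => abs_nonneg _

theorem abs_le_amp (v : Fin 3 → E3 → ℝ) (j : Fin 3) (x : E3) : |v j x| ≤ amp v x :=
  Finset.single_le_sum (f := fun j => |v j x|) (fun _ _ => abs_nonneg _) (Finset.mem_univ j)

theorem abs_pd_le_gradAmp (v : Fin 3 → E3 → ℝ) (j i : Fin 3) (x : E3) :
    |pd (v j) i x| ≤ gradAmp v x :=
  (Finset.single_le_sum (f := fun i => |pd (v j) i x|) (fun _ _ => abs_nonneg _)
    (Finset.mem_univ i)).trans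
    (Finset.single_le_sum (f := fun j => ∑ i, |pd (v j) i x|)
      (fun _ _ => Finset.sum_nonneg fun _ _ => abs_nonneg _) (Finset.mem_univ j))

theorem amp_le_left (v B : Fin 3 → E3 → ℝ) (x : E3) : amp v x ≤ amp₂ v B x :=
  le_add_of_nonneg_right (amp_nonneg B x)

theorem amp_le_right (v B : Fin 3 → E3 → ℝ) (x : E3) : amp B x ≤ amp₂ v B x :=
  le_add_of_nonneg_left (amp_nonneg v x)

theorem amp₂_nonneg (v B : Fin 3 → E3 → ℝ) (x : E3) : 0 ≤ amp₂ v B x :=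
  (amp_nonneg v x).trans (amp_le_left v B x)

theorem gradAmp_le_left (v B : Fin 3 → E3 → ℝ) (x : E3) : gradAmp v x ≤ gradAmp₂ v B x :=
  le_add_of_nonneg_right (gradAmp_nonneg B x)

theorem gradAmp_le_right (v B : Fin 3 → E3 → ℝ) (x : E3) : gradAmp B x ≤ gradAmp₂ v B x :=
  le_add_of_nonneg_left (gradAmp_nonneg v x)

theorem gradAmp₂_nonneg (v B : Fin 3 → E3 → ℝ) (x : E3) : 0 ≤ gradAmp₂ v B x :=
  (gradAmp_nonneg v x).trans (gradAmp_le_left v B x)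

theorem continuous_amp {v : Fin 3 → E3 → ℝ} (hv : ∀ j, ContDiff ℝ (⊤ : ℕ∞) (v j)) :
    Continuous (amp v) :=
  continuous_finsetSum _ fun j _ => (hv j).continuous.abs

theorem continuous_gradAmp {v : Fin 3 → E3 → ℝ} (hv : ∀ j, ContDiff ℝ (⊤ : ℕ∞) (v j)) :
    Continuous (gradAmp v) :=
  continuous_finsetSum _ fun j _ => continuous_finsetSum _ fun i _ =>
    (contDiff_pd (hv j) i).continuous.abs

section
variable {v B : Fin 3 → E3 → ℝ} {p : E3 → ℝ}

theorem IsHallMHD.continuous_amp₂ (H : IsHallMHD v B p) : Continuous (amp₂ v B) :=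
  (continuous_amp H.smooth_v).add (continuous_amp H.smooth_B)

theorem IsHallMHD.continuous_gradAmp₂ (H : IsHallMHD v B p) : Continuous (gradAmp₂ v B) :=
  (continuous_gradAmp H.smooth_v).add (continuous_gradAmp H.smooth_B)

end

theorem sum_mul_abs_le {a b : Fin 3 → ℝ} {K : ℝ} (ha : ∀ i, |a i| ≤ K) :
    |∑ i, a i * b i| ≤ K * ∑ i, |b i| := by
  rw [Finset.mul_sum]
  refine (Finset.abs_sum_le_sum_abs _ _).trans (Finset.sum_le_sum fun i _ => ?_)
  rw [abs_mul]
  exact mul_le_mul_of_nonneg_right (ha i) (abs_nonneg _)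

theorem sum_sq_le_sq_sum_abs (a : Fin 3 → ℝ) : ∑ i, a i ^ 2 ≤ (∑ i, |a i|) ^ 2 := by
  simp only [Fin.sum_univ_three, ← sq_abs (a _)]
  nlinarith [abs_nonneg (a 0), abs_nonneg (a 1), abs_nonneg (a 2),
    mul_nonneg (abs_nonneg (a 0)) (abs_nonneg (a 1)),
    mul_nonneg (abs_nonneg (a 0)) (abs_nonneg (a 2)),
    mul_nonneg (abs_nonneg (a 1)) (abs_nonneg (a 2))]

theorem abs_cross3_le {a b : Fin 3 → ℝ} {K : ℝ} (ha : ∀ i, |a i| ≤ K) (j : Fin 3) :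
    |cross3 a b j| ≤ K * ∑ i, |b i| := by
  have h : ∀ i k : Fin 3, i ≠ k → ∀ l m, |a l * b i - a m * b k| ≤ K * ∑ i, |b i| := by
    intro i k hik l m
    calc _ ≤ |a l| * |b i| + |a m| * |b k| := by
          rw [← abs_mul, ← abs_mul]
          exact abs_sub _ _
      _ ≤ K * |b i| + K * |b k| := by gcongr <;> apply ha
      _ = K * ∑ n ∈ {i, k}, |b n| := by rw [Finset.sum_pair hik]; ring
      _ ≤ _ := by
        have hK : 0 ≤ K := (abs_nonneg _).trans (ha 0)
        gcongr
        exact Finset.subset_univ _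
  fin_cases j
  · exact h 2 1 (by decide) _ _
  · exact h 0 2 (by decide) _ _
  · exact h 1 0 (by decide) _ _

theorem abs_curl3_le (B : Fin 3 → E3 → ℝ) (x : E3) (j : Fin 3) :
    |curl3 (fun y i => B i y) x j| ≤ gradAmp B x := by
  have h : ∀ i k l m : Fin 3, i ≠ k → |pd (B i) l x - pd (B k) m x| ≤ gradAmp B x := by
    intro i k l m hik
    have e : ∀ i l : Fin 3, |pd (B i) l x| ≤ ∑ l, |pd (B i) l x| := fun i l =>
      Finset.single_le_sum (f := fun l => |pd (B i) l x|) (fun _ _ => abs_nonneg _)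
        (Finset.mem_univ l)
    calc _ ≤ |pd (B i) l x| + |pd (B k) m x| := abs_sub _ _
      _ ≤ (∑ l, |pd (B i) l x|) + ∑ l, |pd (B k) l x| := add_le_add (e i l) (e k m)
      _ = ∑ n ∈ {i, k}, ∑ l, |pd (B n) l x| := by rw [Finset.sum_pair hik]
      _ ≤ _ := by
        rw [gradAmp]
        exact Finset.sum_le_sum_of_subset_of_nonneg (Finset.subset_univ _)
          fun _ _ _ => Finset.sum_nonneg fun _ _ => abs_nonneg _
  fin_cases j
  · exact h 2 1 _ _ (by decide)
  · exact h 0 2 _ _ (by decide)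
  · exact h 1 0 _ _ (by decide)

theorem gradAmp₂_sq_le (v B : Fin 3 → E3 → ℝ) (x : E3) :
    gradAmp₂ v B x ^ 2 ≤ 18 * ∑ j, ∑ i, (pd (v j) i x ^ 2 + pd (B j) i x ^ 2) := by
  have h : ∀ w : Fin 3 → E3 → ℝ, gradAmp w x ^ 2 ≤ 9 * ∑ j, ∑ i, pd (w j) i x ^ 2 := by
    intro w
    calc gradAmp w x ^ 2 ≤ 3 * ∑ j, (∑ i, |pd (w j) i x|) ^ 2 := by
          have := sq_sum_le_card_mul_sum_sq (s := Finset.univ)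
            (f := fun j : Fin 3 => ∑ i, |pd (w j) i x|)
          simpa [gradAmp] using this
      _ ≤ 3 * ∑ j, 3 * ∑ i, |pd (w j) i x| ^ 2 := by
          gcongr with j _
          have := sq_sum_le_card_mul_sum_sq (s := Finset.univ)
            (f := fun i : Fin 3 => |pd (w j) i x|)
          simpa using this
      _ = _ := by simp only [sq_abs, ← Finset.mul_sum]; ring
  have e : ∑ j, ∑ i, (pd (v j) i x ^ 2 + pd (B j) i x ^ 2)
      = (∑ j, ∑ i, pd (v j) i x ^ 2) + ∑ j, ∑ i, pd (B j) i x ^ 2 := by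
    simp only [Finset.sum_add_distrib]
  rw [e, gradAmp₂]
  nlinarith [h v, h B, sq_nonneg (gradAmp v x - gradAmp B x)]

/-- The local energy inequality. -/
theorem IsHallMHD.energy_le {v B : Fin 3 → E3 → ℝ} {p : E3 → ℝ} (H : IsHallMHD v B p)
    {φ : E3 → ℝ} (hφ : ContDiff ℝ (⊤ : ℕ∞) φ) {r s' s K : ℝ} (hs : SuppIn φ s') (hs' : s' < s)
    (hφ0 : ∀ x, 0 ≤ φ x) (hφr : ∀ x, ‖x‖ ≤ r → φ x = 1) (hK : ∀ i x, |pd φ i x| ≤ K) :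
    nrm 2 (gradAmp₂ v B) r ^ 2 ≤ 18 * (K * (nrm 2 (amp₂ v B) s * nrm 2 (gradAmp₂ v B) s
      + 2 * nrm 3 (amp₂ v B) s ^ 3
      + 3 * (nrm 3 (amp₂ v B) s * nrm 6 (amp B) s * nrm 2 (gradAmp₂ v B) s))
      + ∫ x, p x * ∑ i, pd φ i x * v i x) := by
  set S := amp₂ v B with hS
  set G := gradAmp₂ v B with hG
  have hcS : Continuous S := H.continuous_amp₂
  have hcG : Continuous G := H.continuous_gradAmp₂
  have hcb : Continuous (amp B) := continuous_amp H.smooth_B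
  have hcv := fun j => (H.smooth_v j).continuous
  have hcB := fun j => (H.smooth_B j).continuous
  have hcdv := fun j i => (contDiff_pd (H.smooth_v j) i).continuous
  have hcdB := fun j i => (contDiff_pd (H.smooth_B j) i).continuous
  have hcφ := hφ.continuous
  have hcdφ := fun i => (contDiff_pd hφ i).continuous
  have hK0 : 0 ≤ K := (abs_nonneg _).trans (hK 0 0)
  set T : E3 → ℝ := fun x => φ x * (∑ j, ∑ i, (pd (v j) i x ^ 2 + pd (B j) i x ^ 2)) with hT
  set P : E3 → ℝ := fun x => p x * ∑ i, pd φ i x * v i x with hP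
  have hTs : SuppIn T s' := hs.mul_right _
  have hPs : SuppIn P s' := fun x hx => by simp [hP, hs.pd _ x hx]
  have hcT : Continuous T := by fun_prop
  have hcp := H.smooth_p.continuous
  have hcP : Continuous P := by fun_prop
  have hZ := H.energy hφ hs
  have hbound : ∀ x, T x - P x ≤ K * (S x * G x + 2 * S x ^ 3 + 3 * (S x * amp B x * G x)) +
      ((φ x * (∑ j, ∑ i, (pd (v j) i x ^ 2 + pd (B j) i x ^ 2))
      + (∑ j, ∑ i, pd φ i x * (v j x * pd (v j) i x + B j x * pd (B j) i x))
      - (∑ j, (v j x ^ 2 + B j x ^ 2)) / 2 * (∑ i, pd φ i x * v i x)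
      + (∑ j, v j x * B j x) * (∑ i, pd φ i x * B i x)
      - (∑ j, cross3 (fun i => pd φ i x) (fun i => B i x) j *
          cross3 (curl3 (fun y i => B i y) x) (fun i => B i x) j)
      - p x * (∑ i, pd φ i x * v i x))) := by
    intro x
    have hS0 : 0 ≤ S x := amp₂_nonneg v B x
    have hG0 : 0 ≤ G x := gradAmp₂_nonneg v B x
    have hb0 : 0 ≤ amp B x := amp_nonneg B x
    have hbS : amp B x ≤ S x := amp_le_right v B x
    have hvS : amp v x ≤ S x := amp_le_left v B x
    have h1 : |∑ j, ∑ i, pd φ i x * (v j x * pd (v j) i x + B j x * pd (B j) i x)| ≤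
        K * (S x * G x) := by
      calc _ ≤ ∑ j, ∑ i, |pd φ i x * (v j x * pd (v j) i x + B j x * pd (B j) i x)| :=
            (Finset.abs_sum_le_sum_abs _ _).trans
              (Finset.sum_le_sum fun j _ => Finset.abs_sum_le_sum_abs _ _)
        _ ≤ ∑ j, ∑ i, K * (S x * |pd (v j) i x| + S x * |pd (B j) i x|) := by
            refine Finset.sum_le_sum fun j _ => Finset.sum_le_sum fun i _ => ?_
            rw [abs_mul]
            refine mul_le_mul (hK i x) ((abs_add_le _ _).trans ?_) (abs_nonneg _) hK0
            rw [abs_mul, abs_mul]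
            have := (abs_le_amp v j x).trans hvS
            have := (abs_le_amp B j x).trans hbS
            gcongr
        _ = _ := by
            rw [hG, gradAmp₂, gradAmp, gradAmp]
            simp only [Fin.sum_univ_three]
            ring
    have h2 : |∑ i, pd φ i x * v i x| ≤ K * S x :=
      (sum_mul_abs_le fun i => hK i x).trans (mul_le_mul_of_nonneg_left hvS hK0)
    have h3 : |∑ i, pd φ i x * B i x| ≤ K * S x :=
      (sum_mul_abs_le fun i => hK i x).trans (mul_le_mul_of_nonneg_left hbS hK0)
    have h4 : |(∑ j, (v j x ^ 2 + B j x ^ 2)) / 2| ≤ S x ^ 2 := by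
      rw [abs_of_nonneg (by positivity), Finset.sum_add_distrib]
      have e1 := sum_sq_le_sq_sum_abs fun j => v j x
      have e2 := sum_sq_le_sq_sum_abs fun j => B j x
      have e3 : (∑ j, |v j x|) ^ 2 ≤ S x ^ 2 := pow_le_pow_left₀ (amp_nonneg v x) hvS 2
      have e4 : (∑ j, |B j x|) ^ 2 ≤ S x ^ 2 := pow_le_pow_left₀ (amp_nonneg B x) hbS 2
      linarith
    have h5 : |∑ j, v j x * B j x| ≤ S x ^ 2 := by
      rw [sq]
      exact (sum_mul_abs_le fun j => (abs_le_amp v j x).trans hvS).trans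
        (mul_le_mul_of_nonneg_left hbS hS0)
    have h6 : |∑ j, cross3 (fun i => pd φ i x) (fun i => B i x) j *
          cross3 (curl3 (fun y i => B i y) x) (fun i => B i x) j| ≤
          K * (3 * (S x * amp B x * G x)) := by
      refine (sum_mul_abs_le fun j => abs_cross3_le (fun i => hK i x) j).trans ?_
      have e : ∀ j, |cross3 (curl3 (fun y i => B i y) x) (fun i => B i x) j| ≤ G x * amp B x :=
        fun j => abs_cross3_le (fun i => (abs_curl3_le B x i).trans (gradAmp_le_right v B x)) j
      calc _ ≤ K * amp B x * ∑ _j : Fin 3, G x * amp B x := by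
            refine mul_le_mul_of_nonneg_left (Finset.sum_le_sum fun j _ => e j) ?_
            exact mul_nonneg hK0 hb0
        _ = K * (3 * (amp B x * amp B x * G x)) := by simp; ring
        _ ≤ _ := by gcongr
    have h7 := mul_le_mul h4 h2 (abs_nonneg _) (by positivity)
    have h8 := mul_le_mul h5 h3 (abs_nonneg _) (by positivity)
    rw [← abs_mul] at h7 h8
    have g1 := neg_abs_le (∑ j, ∑ i, pd φ i x * (v j x * pd (v j) i x + B j x * pd (B j) i x))
    have g7 := le_abs_self ((∑ j, (v j x ^ 2 + B j x ^ 2)) / 2 * (∑ i, pd φ i x * v i x))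
    have g8 := neg_abs_le ((∑ j, v j x * B j x) * (∑ i, pd φ i x * B i x))
    have g6 := le_abs_self (∑ j, cross3 (fun i => pd φ i x) (fun i => B i x) j *
          cross3 (curl3 (fun y i => B i y) x) (fun i => B i x) j)
    simp only [hT, hP]
    have e7 : S x ^ 2 * (K * S x) = K * S x ^ 3 := by ring
    rw [e7] at h7 h8
    linarith
  set Z : E3 → ℝ := fun x => (φ x * (∑ j, ∑ i, (pd (v j) i x ^ 2 + pd (B j) i x ^ 2))
      + (∑ j, ∑ i, pd φ i x * (v j x * pd (v j) i x + B j x * pd (B j) i x))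
      - (∑ j, (v j x ^ 2 + B j x ^ 2)) / 2 * (∑ i, pd φ i x * v i x)
      + (∑ j, v j x * B j x) * (∑ i, pd φ i x * B i x)
      - (∑ j, cross3 (fun i => pd φ i x) (fun i => B i x) j *
          cross3 (curl3 (fun y i => B i y) x) (fun i => B i x) j)
      - p x * (∑ i, pd φ i x * v i x)) with hZdef
  have hZs : SuppIn Z s' := fun x hx => by simp [hZdef, hs.pd _ x hx, hs x hx, cross3, Fin.sum_univ_three]
  have hZb : ∫ x in Metric.ball (0 : E3) s, Z x = 0 := by rw [hZs.setIntegral_eq hs']; exact hZ.2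
  have i1 : IntegrableOn (fun x => S x * G x) (Metric.ball 0 s) :=
    continuous_integrableOn_ball (by fun_prop) s
  have i2 : IntegrableOn (fun x => 2 * S x ^ 3) (Metric.ball 0 s) :=
    continuous_integrableOn_ball (by fun_prop) s
  have i3 : IntegrableOn (fun x => 3 * (S x * amp B x * G x)) (Metric.ball 0 s) :=
    continuous_integrableOn_ball (by fun_prop) s
  have i12 : IntegrableOn (fun x => S x * G x + 2 * S x ^ 3) (Metric.ball 0 s) :=
    continuous_integrableOn_ball (by fun_prop) s
  have i0 : IntegrableOn (fun x => K * (S x * G x + 2 * S x ^ 3 + 3 * (S x * amp B x * G x)))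
      (Metric.ball 0 s) := continuous_integrableOn_ball (by fun_prop) s
  have hmain : ∫ x, T x ≤ K * (nrm 2 S s * nrm 2 G s + 2 * nrm 3 S s ^ 3
      + 3 * (nrm 3 S s * nrm 6 (amp B) s * nrm 2 G s)) + ∫ x, P x := by
    have e : ∫ x in Metric.ball (0 : E3) s, (T x - P x) = (∫ x, T x) - ∫ x, P x := by
      rw [integral_sub (continuous_integrableOn_ball hcT s) (continuous_integrableOn_ball hcP s),
        hTs.setIntegral_eq hs', hPs.setIntegral_eq hs']
    have e2 : ∫ x in Metric.ball (0 : E3) s, (T x - P x) ≤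
        ∫ x in Metric.ball (0 : E3) s,
          (K * (S x * G x + 2 * S x ^ 3 + 3 * (S x * amp B x * G x)) + Z x) := by
      refine integral_mono (continuous_integrableOn_ball (hcT.sub hcP) s) ?_ hbound
      exact i0.add hZ.1.integrableOn
    rw [integral_add i0 hZ.1.integrableOn, hZb, add_zero, integral_const_mul,
      integral_add i12 i3, integral_add i1 i2, integral_const_mul, integral_const_mul] at e2
    have a1 : ∫ x in Metric.ball (0 : E3) s, S x * G x ≤ nrm 2 S s * nrm 2 G s := by
      have := integral_abs_mul_le (p := 2) (q := 2) (by norm_num) (by norm_num) (by norm_num) hcS hcG s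
      refine le_trans (le_of_eq ?_) this
      congr 1
      funext x
      rw [abs_of_nonneg (amp₂_nonneg v B x), abs_of_nonneg (gradAmp₂_nonneg v B x)]
    have a2 : ∫ x in Metric.ball (0 : E3) s, S x ^ 3 = nrm 3 S s ^ 3 := by
      rw [nrm_pow_three]
      congr 1
      funext x
      rw [abs_of_nonneg (amp₂_nonneg v B x)]
    have a3 : ∫ x in Metric.ball (0 : E3) s, S x * amp B x * G x ≤
        nrm 3 S s * nrm 6 (amp B) s * nrm 2 G s := by
      have := integral_abs_mul_mul_le (p := 3) (q := 6) (s := 2) (by norm_num) (by norm_num)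
        (by norm_num) (by norm_num) hcS hcb hcG s
      refine le_trans (le_of_eq ?_) this
      congr 1
      funext x
      rw [abs_of_nonneg (amp₂_nonneg v B x), abs_of_nonneg (gradAmp₂_nonneg v B x),
        abs_of_nonneg (amp_nonneg B x)]
    rw [a2] at e2
    have := mul_le_mul_of_nonneg_left (add_le_add (add_le_add a1 (le_refl (2 * nrm 3 S s ^ 3)))
      (mul_le_mul_of_nonneg_left a3 (by norm_num : (0 : ℝ) ≤ 3))) hK0
    linarith
  have hlow : nrm 2 G r ^ 2 ≤ 18 * ∫ x, T x := by
    have hT0 : ∀ x, 0 ≤ T x := fun x => mul_nonneg (hφ0 x) (Finset.sum_nonneg fun _ _ =>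
      Finset.sum_nonneg fun _ _ => add_nonneg (sq_nonneg _) (sq_nonneg _))
    have hTi : Integrable T := hTs.integrable hcT
    rw [nrm_two_sq, ← integral_const_mul]
    calc _ ≤ ∫ x in Metric.ball (0 : E3) r, 18 * T x := by
          refine setIntegral_mono_on (continuous_integrableOn_ball (hcG.pow 2) r)
            (hTi.const_mul 18).integrableOn measurableSet_ball fun x hx => ?_
          have hx' : ‖x‖ < r := by simpa using hx
          simp only [hT, hφr x hx'.le, one_mul]
          exact gradAmp₂_sq_le v B x
      _ ≤ _ := setIntegral_le_integral (hTi.const_mul 18)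
          (Filter.Eventually.of_forall fun x => mul_nonneg (by norm_num) (hT0 x))
  linarith

theorem ofReal_nrm_rpow {q : ℝ} (hq : 0 < q) {f : E3 → ℝ} (hf : Continuous f) (r : ℝ) :
    ENNReal.ofReal (nrm q f r ^ q) = ∫⁻ x in Metric.ball (0 : E3) r, ENNReal.ofReal (|f x| ^ q) := by
  rw [nrm_rpow hq, ofReal_integral_eq_lintegral_ofReal
    (continuous_integrableOn_ball (continuous_abs_rpow hq hf) r)
    (Filter.Eventually.of_forall fun _ => by positivity)]

/-- Jensen's inequality for the convex power `b ↦ b ^ p` with respect to the weight `a`. -/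
theorem lintegral_mul_rpow_le {α : Type*} [MeasurableSpace α] {μ : Measure α} {p : ℝ} (hp : 1 < p)
    {a b : α → ENNReal} (ha : AEMeasurable a μ) (hb : AEMeasurable b μ) :
    (∫⁻ x, a x * b x ∂μ) ^ p ≤ (∫⁻ x, a x ∂μ) ^ (p - 1) * ∫⁻ x, a x * b x ^ p ∂μ := by
  have hpq : p.HolderConjugate (Real.conjExponent p) := .conjExponent hp
  have h := ENNReal.lintegral_mul_le_Lp_mul_Lq μ hpq (f := fun x => a x ^ (1 / p) * b x)
    (g := fun x => a x ^ (1 / Real.conjExponent p)) (by fun_prop) (by fun_prop)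
  have hp0 : 0 < p := by linarith
  have hq0 := hpq.symm.pos
  have e1 : ∀ x, a x ^ (1 / p) * b x * a x ^ (1 / Real.conjExponent p) = a x * b x := by
    intro x
    rw [mul_right_comm, ← ENNReal.rpow_add_of_nonneg _ _ (by positivity) (by positivity)]
    have := hpq.inv_add_inv_eq_one
    rw [one_div, one_div, this, ENNReal.rpow_one]
  have e2 : ∀ x, (a x ^ (1 / p) * b x) ^ p = a x * b x ^ p := by
    intro x
    rw [ENNReal.mul_rpow_of_nonneg _ _ hp0.le, ← ENNReal.rpow_mul, one_div_mul_cancel hp0.ne',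
      ENNReal.rpow_one]
  have e3 : ∀ x, (a x ^ (1 / Real.conjExponent p)) ^ Real.conjExponent p = a x := by
    intro x
    rw [← ENNReal.rpow_mul, one_div_mul_cancel hq0.ne', ENNReal.rpow_one]
  simp only [Pi.mul_apply, e1, e2, e3] at h
  refine (ENNReal.rpow_le_rpow h hp0.le).trans_eq ?_
  rw [ENNReal.mul_rpow_of_nonneg _ _ hp0.le, ← ENNReal.rpow_mul, ← ENNReal.rpow_mul,
    one_div_mul_cancel hp0.ne', ENNReal.rpow_one, mul_comm]
  congr 2
  rw [Real.conjExponent]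
  have : p - 1 ≠ 0 := by linarith
  field_simp

/-- Convolution of scalar functions on `ℝ³`. -/
noncomputable def conv (k h : E3 → ℝ) (x : E3) : ℝ := ∫ y, k y * h (x - y)

theorem nrm_conv_le {p : ℝ} (hp : 1 < p) {k h w : E3 → ℝ} (hk : Continuous k) (hh : Continuous h)
    (hw : Continuous w) (hwk : ∀ x, w x = conv k h x)
    {ε m s : ℝ} (hs : SuppIn k ε) (hms : m + ε ≤ s) :
    nrm p w m ≤ (∫ y, |k y|) * nrm p h s := by
  have hp0 : 0 < p := by linarith
  have hki : Integrable (fun y => |k y|) := (hs.integrable hk).abs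
  have hK : 0 ≤ ∫ y, |k y| := integral_nonneg fun _ => abs_nonneg _
  have hKe : ∫⁻ y, ENNReal.ofReal |k y| = ENNReal.ofReal (∫ y, |k y|) :=
    (ofReal_integral_eq_lintegral_ofReal hki (Filter.Eventually.of_forall fun _ => abs_nonneg _)).symm
  have hpt : ∀ x, ENNReal.ofReal (|w x| ^ p) ≤ ENNReal.ofReal (∫ y, |k y|) ^ (p - 1) *
      ∫⁻ y, ENNReal.ofReal |k y| * ENNReal.ofReal (|h (x - y)| ^ p) := by
    intro x
    have h1 : ENNReal.ofReal |w x| ≤ ∫⁻ y, ENNReal.ofReal |k y| * ENNReal.ofReal |h (x - y)| := by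
      rw [hwk]
      have hc : Continuous fun y => k y * h (x - y) := by fun_prop
      have hsi : SuppIn (fun y => k y * h (x - y)) ε := fun y hy => by simp [hs y hy]
      refine (ENNReal.ofReal_le_ofReal (abs_integral_le_integral_abs)).trans_eq ?_
      rw [ofReal_integral_eq_lintegral_ofReal (hsi.integrable hc).abs
        (Filter.Eventually.of_forall fun _ => abs_nonneg _)]
      refine lintegral_congr fun y => ?_
      rw [abs_mul, ENNReal.ofReal_mul (abs_nonneg _)]
    have h2 := lintegral_mul_rpow_le (μ := (volume : Measure E3)) hp
      (a := fun y => ENNReal.ofReal |k y|) (b := fun y => ENNReal.ofReal |h (x - y)|)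
      (by fun_prop) (by fun_prop)
    rw [← ENNReal.ofReal_rpow_of_nonneg (abs_nonneg _) hp0.le, ← hKe]
    simp only [← ENNReal.ofReal_rpow_of_nonneg (abs_nonneg _) hp0.le]
    exact (ENNReal.rpow_le_rpow h1 hp0.le).trans h2
  have hin : ∀ y, ENNReal.ofReal |k y| *
      ∫⁻ x in Metric.ball (0 : E3) m, ENNReal.ofReal (|h (x - y)| ^ p) ≤
      ENNReal.ofReal |k y| * ENNReal.ofReal (nrm p h s ^ p) := by
    intro y
    by_cases hy : ε < ‖y‖
    · simp [hs y hy]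
    · have hc : Continuous fun x => h (x - y) := by fun_prop
      rw [← ofReal_nrm_rpow hp0 hc m]
      have := nrm_translate_le hp0 hh (k := y) (r := m) (s := s) (by linarith)
      exact mul_le_mul_right (ENNReal.ofReal_le_ofReal
        (Real.rpow_le_rpow (nrm_nonneg _ _ _) this hp0.le)) _
  have hfin : ENNReal.ofReal (nrm p w m ^ p) ≤
      ENNReal.ofReal (((∫ y, |k y|) * nrm p h s) ^ p) := by
    rw [ofReal_nrm_rpow hp0 hw]
    have hcp : Continuous fun z : ℝ => |z| ^ p := continuous_abs.rpow_const fun _ => Or.inr hp0.le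
    calc _ ≤ ∫⁻ x in Metric.ball (0 : E3) m, ENNReal.ofReal (∫ y, |k y|) ^ (p - 1) *
          ∫⁻ y, ENNReal.ofReal |k y| * ENNReal.ofReal (|h (x - y)| ^ p) := lintegral_mono hpt
      _ = ENNReal.ofReal (∫ y, |k y|) ^ (p - 1) * ∫⁻ x in Metric.ball (0 : E3) m,
          ∫⁻ y, ENNReal.ofReal |k y| * ENNReal.ofReal (|h (x - y)| ^ p) :=
          lintegral_const_mul' _ _ (ENNReal.rpow_ne_top_of_nonneg (by linarith) ENNReal.ofReal_ne_top)
      _ = ENNReal.ofReal (∫ y, |k y|) ^ (p - 1) * ∫⁻ y, ∫⁻ x in Metric.ball (0 : E3) m,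
          ENNReal.ofReal |k y| * ENNReal.ofReal (|h (x - y)| ^ p) := by
          rw [lintegral_lintegral_swap]
          refine Measurable.aemeasurable (Continuous.measurable ?_)
          have : Continuous fun z : E3 × E3 => |h (z.1 - z.2)| ^ p := hcp.comp (by fun_prop)
          simp only [Function.uncurry_def, ← ENNReal.ofReal_mul (abs_nonneg _)]
          exact ENNReal.continuous_ofReal.comp (by fun_prop)
      _ = ENNReal.ofReal (∫ y, |k y|) ^ (p - 1) * ∫⁻ y, ENNReal.ofReal |k y| *
          ∫⁻ x in Metric.ball (0 : E3) m, ENNReal.ofReal (|h (x - y)| ^ p) := by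
          congr 2
          funext y
          exact lintegral_const_mul' _ _ ENNReal.ofReal_ne_top
      _ ≤ ENNReal.ofReal (∫ y, |k y|) ^ (p - 1) * ∫⁻ y, ENNReal.ofReal |k y| *
          ENNReal.ofReal (nrm p h s ^ p) := by
          exact mul_le_mul_right (lintegral_mono hin) _
      _ = ENNReal.ofReal (∫ y, |k y|) ^ (p - 1) * (ENNReal.ofReal (∫ y, |k y|) *
          ENNReal.ofReal (nrm p h s ^ p)) := by
          rw [lintegral_mul_const' _ _ ENNReal.ofReal_ne_top, hKe]
      _ = _ := by
          rw [Real.mul_rpow hK (nrm_nonneg _ _ _), ENNReal.ofReal_mul (by positivity), ← mul_assoc,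
            ENNReal.ofReal_rpow_of_nonneg hK (by linarith), ← ENNReal.ofReal_mul (by positivity)]
          congr 2
          rw [← Real.rpow_add_one' hK (by linarith), sub_add_cancel]
  have h0 : 0 ≤ (∫ y, |k y|) * nrm p h s := mul_nonneg hK (nrm_nonneg _ _ _)
  rw [ENNReal.ofReal_le_ofReal_iff (by positivity)] at hfin
  exact (Real.rpow_le_rpow_iff (nrm_nonneg _ _ _) h0 hp0).1 hfin

theorem conv_eq_convolution (k h : E3 → ℝ) :
    conv k h = convolution h k (ContinuousLinearMap.lsmul ℝ ℝ) volume := by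
  funext x
  rw [convolution_lsmul_swap]
  simp [conv, mul_comm]

theorem contDiff_conv {k h : E3 → ℝ} (hk : ContDiff ℝ 1 k) (hh : Continuous h) {ε : ℝ}
    (hs : SuppIn k ε) : ContDiff ℝ 1 (conv k h) := by
  rw [conv_eq_convolution]
  exact hs.hasCompactSupport.contDiff_convolution_right _ hh.locallyIntegrable hk

theorem pd_conv {k h : E3 → ℝ} (hk : ContDiff ℝ 1 k) (hh : Continuous h) {ε : ℝ}
    (hs : SuppIn k ε) (i : Fin 3) (x : E3) : pd (conv k h) i x = conv (pd k i) h x := by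
  have h1 := (hs.hasCompactSupport.hasFDerivAt_convolution_right (μ := volume)
    (ContinuousLinearMap.lsmul ℝ ℝ) hh.locallyIntegrable hk x).fderiv
  rw [conv_eq_convolution, conv_eq_convolution, pd, h1]
  exact convolution_precompR_apply _ hh.locallyIntegrable (hs.hasCompactSupport.fderiv ℝ)
    (hk.continuous_fderiv (by norm_num)) _ _

theorem pd_sub_arg {h : E3 → ℝ} (hh : ContDiff ℝ 1 h) (x : E3) (i : Fin 3) (y : E3) :
    pd (fun y => h (x - y)) i y = -pd h i (x - y) := by
  have h1 : HasFDerivAt (fun y : E3 => x - y) (-ContinuousLinearMap.id ℝ E3) y :=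
    (hasFDerivAt_id y).const_sub x
  have := (differentiableAt_of_contDiff_one hh (x - y)).hasFDerivAt.comp y h1
  rw [pd]
  erw [this.fderiv]
  simp [pd]

theorem conv_pd {k h : E3 → ℝ} (hk : ContDiff ℝ 1 k) (hh : ContDiff ℝ 1 h) {ε : ℝ}
    (hs : SuppIn k ε) (i : Fin 3) (x : E3) : conv (pd k i) h x = conv k (pd h i) x := by
  have hc : ContDiff ℝ 1 fun y => h (x - y) := hh.comp (contDiff_const.sub contDiff_id)
  have := integral_mul_pd hk hc hs i
  simp only [pd_sub_arg hh, mul_neg, integral_neg, neg_inj] at this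
  exact this.symm

theorem lintegral_ball_contract_le {F : E3 → ENNReal} (hF : Measurable F) {R t : ℝ}
    (ht0 : 0 ≤ t) (ht : t ≤ 1 / 2) {y : E3} (hy : y ∈ Metric.ball (0 : E3) R) :
    ∫⁻ x in Metric.ball (0 : E3) R, F (x + t • (y - x)) ≤ 8 * ∫⁻ x in Metric.ball (0 : E3) R, F x := by
  set I := (Metric.ball (0 : E3) R).indicator F with hI
  have hIm : Measurable I := hF.indicator measurableSet_ball
  have h1 : ∀ x ∈ Metric.ball (0 : E3) R, F (x + t • (y - x)) = I ((1 - t) • x + t • y) := by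
    intro x hx
    have e : x + t • (y - x) = (1 - t) • x + t • y := by module
    rw [e, hI, Set.indicator_of_mem]
    exact convex_ball (0 : E3) R hx hy (by linarith) ht0 (by ring)
  have hne : (1 - t) ≠ 0 := by linarith
  calc ∫⁻ x in Metric.ball (0 : E3) R, F (x + t • (y - x))
      = ∫⁻ x in Metric.ball (0 : E3) R, I ((1 - t) • x + t • y) :=
        setLIntegral_congr_fun measurableSet_ball h1
    _ ≤ ∫⁻ x, I ((1 - t) • x + t • y) := setLIntegral_le_lintegral _ _
    _ = ∫⁻ x, I (x + t • y) ∂(Measure.map ((1 - t) • ·) volume) := by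
        rw [lintegral_map (by fun_prop) (by fun_prop)]
    _ = ENNReal.ofReal |((1 - t) ^ 3)⁻¹| * ∫⁻ x, I x := by
        rw [Measure.map_addHaar_smul _ hne, lintegral_smul_measure, lintegral_add_right_eq_self]
        simp
    _ ≤ 8 * ∫⁻ x, I x := by
        gcongr
        rw [show (8 : ENNReal) = ENNReal.ofReal 8 by simp]
        refine ENNReal.ofReal_le_ofReal ?_
        have : (1 / 2 : ℝ) ^ 3 ≤ (1 - t) ^ 3 := by gcongr; linarith
        rw [abs_of_nonneg (by positivity), inv_le_comm₀ (by nlinarith) (by norm_num)]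
        linarith
    _ = _ := by rw [hI, lintegral_indicator measurableSet_ball]

theorem abs_sub_midpoint_le {q : E3 → ℝ} (hq : ContDiff ℝ 1 q) {R : ℝ} {x y : E3}
    (hx : x ∈ Metric.ball (0 : E3) R) (hy : y ∈ Metric.ball (0 : E3) R) :
    |q x - q (x + (1 / 2 : ℝ) • (y - x))| ≤
      ∫ t in (0 : ℝ)..(1 / 2), 2 * R * ∑ i, |pd q i (x + t • (y - x))| := by
  have hd : ∀ t : ℝ, HasDerivAt (fun t : ℝ => q (x + t • (y - x)))
      (fderiv ℝ q (x + t • (y - x)) (y - x)) t := by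
    intro t
    have h1 : HasDerivAt (fun t : ℝ => x + t • (y - x)) (y - x) t := by
      simpa using ((hasDerivAt_id t).smul_const (y - x)).const_add x
    exact (differentiableAt_of_contDiff_one hq _).hasFDerivAt.comp_hasDerivAt t h1
  have hcd : Continuous (fderiv ℝ q) := hq.continuous_fderiv (by norm_num)
  have hcp : ∀ i, Continuous (pd q i) := fun i => continuous_pd hq i
  have hc : Continuous fun t : ℝ => fderiv ℝ q (x + t • (y - x)) (y - x) := by fun_prop
  have h2 := intervalIntegral.integral_eq_sub_of_hasDerivAt (a := (0 : ℝ)) (b := 1 / 2)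
    (fun t _ => hd t) (hc.intervalIntegrable _ _)
  simp only [zero_smul, add_zero] at h2
  rw [abs_sub_comm, ← h2]
  refine (intervalIntegral.abs_integral_le_integral_abs (by norm_num)).trans ?_
  refine intervalIntegral.integral_mono_on (by norm_num) (hc.abs.intervalIntegrable _ _)
    (Continuous.intervalIntegrable (by fun_prop) _ _) fun t _ => ?_
  refine ((fderiv ℝ q (x + t • (y - x))).le_opNorm (y - x)).trans ?_
  rw [mul_comm]
  refine mul_le_mul ?_ (norm_fderiv_le _ _) (norm_nonneg _) ?_
  · have h3 := norm_sub_le y x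
    simp at hx hy
    linarith
  · have := Metric.pos_of_mem_ball hx
    linarith

theorem lintegral_sub_midpoint_rpow_le {p : ℝ} (hp : 1 < p) {q : E3 → ℝ} (hq : ContDiff ℝ 1 q)
    (R : ℝ) :
    ∫⁻ y in Metric.ball (0 : E3) R, ∫⁻ x in Metric.ball (0 : E3) R,
        ENNReal.ofReal |q x - q (x + (1 / 2 : ℝ) • (y - x))| ^ p ≤
      volume (Metric.ball (0 : E3) R) * (4 * ∫⁻ x in Metric.ball (0 : E3) R,
        ENNReal.ofReal (2 * R * ∑ i, |pd q i x|) ^ p) := by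
  have hcp : ∀ i, Continuous (pd q i) := fun i => continuous_pd hq i
  set F : E3 → ENNReal := fun x => ENNReal.ofReal (2 * R * ∑ i, |pd q i x|) ^ p with hF
  have hFm : Measurable F := by
    refine Measurable.pow_const ?_ p
    exact (ENNReal.continuous_ofReal.comp (by fun_prop)).measurable
  have hpt : ∀ y ∈ Metric.ball (0 : E3) R, ∀ x ∈ Metric.ball (0 : E3) R,
      ENNReal.ofReal |q x - q (x + (1 / 2 : ℝ) • (y - x))| ^ p ≤
        ∫⁻ t in Set.Ioc (0 : ℝ) (1 / 2), F (x + t • (y - x)) := by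
    intro y hy x hx
    have hR : 0 < R := Metric.pos_of_mem_ball hx
    have hc : Continuous fun t : ℝ => 2 * R * ∑ i, |pd q i (x + t • (y - x))| := by fun_prop
    have h1 := ENNReal.ofReal_le_ofReal (abs_sub_midpoint_le hq hx hy)
    rw [intervalIntegral.integral_of_le (by norm_num), ofReal_integral_eq_lintegral_ofReal
      (hc.integrableOn_Ioc) (Filter.Eventually.of_forall fun _ => by positivity)] at h1
    have h2 := lintegral_mul_rpow_le (μ := volume.restrict (Set.Ioc (0 : ℝ) (1 / 2))) hp
      (a := fun _ => 1) (b := fun t => ENNReal.ofReal (2 * R * ∑ i, |pd q i (x + t • (y - x))|))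
      (by fun_prop) (ENNReal.continuous_ofReal.comp hc).measurable.aemeasurable
    simp only [one_mul] at h2
    refine ((ENNReal.rpow_le_rpow h1 (by linarith)).trans h2).trans ?_
    refine mul_le_of_le_one_left' ?_
    refine ENNReal.rpow_le_one ?_ (by linarith)
    simp
  have hin : ∀ y ∈ Metric.ball (0 : E3) R,
      ∫⁻ x in Metric.ball (0 : E3) R, ENNReal.ofReal |q x - q (x + (1 / 2 : ℝ) • (y - x))| ^ p ≤
        4 * ∫⁻ x in Metric.ball (0 : E3) R, F x := by
    intro y hy
    calc _ ≤ ∫⁻ x in Metric.ball (0 : E3) R, ∫⁻ t in Set.Ioc (0 : ℝ) (1 / 2), F (x + t • (y - x)) :=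
          setLIntegral_mono' measurableSet_ball (hpt y hy)
      _ = ∫⁻ t in Set.Ioc (0 : ℝ) (1 / 2), ∫⁻ x in Metric.ball (0 : E3) R, F (x + t • (y - x)) := by
          rw [lintegral_lintegral_swap]
          refine (hFm.comp ?_).aemeasurable
          fun_prop
      _ ≤ ∫⁻ t in Set.Ioc (0 : ℝ) (1 / 2), 8 * ∫⁻ x in Metric.ball (0 : E3) R, F x :=
          setLIntegral_mono' measurableSet_Ioc fun t ht =>
            lintegral_ball_contract_le hFm ht.1.le ht.2 hy
      _ = _ := by
          rw [setLIntegral_const, Real.volume_Ioc, mul_right_comm]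
          congr 1
          rw [show (8 : ENNReal) = ENNReal.ofReal 8 by simp, ← ENNReal.ofReal_mul (by norm_num)]
          norm_num
  calc _ ≤ ∫⁻ y in Metric.ball (0 : E3) R, 4 * ∫⁻ x in Metric.ball (0 : E3) R, F x :=
        setLIntegral_mono' measurableSet_ball hin
    _ = _ := by rw [setLIntegral_const, mul_comm]

/-- Poincaré's inequality on balls. -/
theorem exists_nrm_sub_const_le {p : ℝ} (hp : 1 < p) (hp2 : p ≤ 2) {q : E3 → ℝ}
    (hq : ContDiff ℝ 1 q) {R : ℝ} (hR : 0 < R) :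
    ∃ c, nrm p (fun x => q x - c) R ≤ 32 * R * ∑ i, nrm p (pd q i) R := by
  have hp0 : 0 < p := by linarith
  have hcp : ∀ i, Continuous (pd q i) := fun i => continuous_pd hq i
  have hcq := hq.continuous
  set F : E3 → ENNReal := fun x => ENNReal.ofReal (2 * R * ∑ i, |pd q i x|) ^ p with hF
  set b := Metric.ball (0 : E3) R with hb
  have hb0 : volume b ≠ 0 := (Metric.measure_ball_pos volume _ hR).ne'
  have hbt : volume b ≠ ⊤ := measure_ball_lt_top.ne
  have hm1 : ∀ f : E3 × E3 → ℝ, Continuous f → Measurable fun z => ENNReal.ofReal |f z| ^ p :=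
    fun f hf => Measurable.pow_const
      (ENNReal.continuous_ofReal.comp (continuous_abs.comp hf)).measurable p
  have hmid := lintegral_sub_midpoint_rpow_le hp hq R
  have hpt : ∀ y x : E3, ENNReal.ofReal |q x - q y| ^ p ≤
      2 * ENNReal.ofReal |q x - q (x + (1 / 2 : ℝ) • (y - x))| ^ p +
      2 * ENNReal.ofReal |q y - q (y + (1 / 2 : ℝ) • (x - y))| ^ p := by
    intro y x
    have e : y + (1 / 2 : ℝ) • (x - y) = x + (1 / 2 : ℝ) • (y - x) := by module
    rw [e, ← mul_add]
    set z := q (x + (1 / 2 : ℝ) • (y - x))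
    have h1 : |q x - q y| ≤ |q x - z| + |q y - z| := by
      rw [abs_sub_comm (q y) z]; exact abs_sub_le _ _ _
    have h2 := ENNReal.rpow_add_le_mul_rpow_add_rpow (ENNReal.ofReal |q x - z|)
      (ENNReal.ofReal |q y - z|) hp.le
    rw [← ENNReal.ofReal_add (abs_nonneg _) (abs_nonneg _)] at h2
    refine ((ENNReal.rpow_le_rpow (ENNReal.ofReal_le_ofReal h1) hp0.le).trans h2).trans ?_
    refine mul_le_mul_left ?_ _
    calc (2 : ENNReal) ^ (p - 1) ≤ 2 ^ (1 : ℝ) :=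
          ENNReal.rpow_le_rpow_of_exponent_le (by norm_num) (by linarith)
      _ = 2 := by simp
  have htot : ∫⁻ y in b, ∫⁻ x in b, ENNReal.ofReal |q x - q y| ^ p ≤
      volume b * (16 * ∫⁻ x in b, F x) := by
    calc _ ≤ ∫⁻ y in b, ∫⁻ x in b, (2 * ENNReal.ofReal |q x - q (x + (1 / 2 : ℝ) • (y - x))| ^ p +
          2 * ENNReal.ofReal |q y - q (y + (1 / 2 : ℝ) • (x - y))| ^ p) :=
          lintegral_mono fun y => lintegral_mono fun x => hpt y x
      _ = 2 * (∫⁻ y in b, ∫⁻ x in b, ENNReal.ofReal |q x - q (x + (1 / 2 : ℝ) • (y - x))| ^ p) +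
          2 * (∫⁻ y in b, ∫⁻ x in b, ENNReal.ofReal |q y - q (y + (1 / 2 : ℝ) • (x - y))| ^ p) := by
          have m1 : Measurable fun z : E3 × E3 =>
            ENNReal.ofReal |q z.2 - q (z.2 + (1 / 2 : ℝ) • (z.1 - z.2))| ^ p := hm1 _ (by fun_prop)
          have m2 : Measurable fun z : E3 × E3 =>
            ENNReal.ofReal |q z.1 - q (z.1 + (1 / 2 : ℝ) • (z.2 - z.1))| ^ p := hm1 _ (by fun_prop)
          rw [← lintegral_const_mul _ m1.lintegral_prod_right', ← lintegral_const_mul _ m2.lintegral_prod_right',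
            ← lintegral_add_left (m1.lintegral_prod_right'.const_mul 2)]
          refine lintegral_congr fun y => ?_
          have m1' : Measurable fun x => ENNReal.ofReal |q x - q (x + (1 / 2 : ℝ) • (y - x))| ^ p :=
            m1.comp (by fun_prop : Measurable fun x => (y, x))
          have m2' : Measurable fun x => ENNReal.ofReal |q y - q (y + (1 / 2 : ℝ) • (x - y))| ^ p :=
            m2.comp (by fun_prop : Measurable fun x => (y, x))
          rw [lintegral_add_left (m1'.const_mul 2), lintegral_const_mul _ m1',
            lintegral_const_mul _ m2']
      _ = 4 * (∫⁻ y in b, ∫⁻ x in b, ENNReal.ofReal |q x - q (x + (1 / 2 : ℝ) • (y - x))| ^ p) := by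
          have e : ∫⁻ y in b, ∫⁻ x in b, ENNReal.ofReal |q y - q (y + (1 / 2 : ℝ) • (x - y))| ^ p =
              ∫⁻ y in b, ∫⁻ x in b, ENNReal.ofReal |q x - q (x + (1 / 2 : ℝ) • (y - x))| ^ p := by
            rw [lintegral_lintegral_swap]
            exact (hm1 (fun z => q z.1 - q (z.1 + (1 / 2 : ℝ) • (z.2 - z.1)))
              (by fun_prop)).aemeasurable
          rw [e, ← add_mul]
          norm_num
      _ ≤ 4 * (volume b * (4 * ∫⁻ x in b, F x)) := mul_le_mul_right hmid _
      _ = _ := by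
          rw [mul_left_comm, ← mul_assoc 4 4]
          norm_num
  have m0 : Measurable fun z : E3 × E3 => ENNReal.ofReal |q z.2 - q z.1| ^ p := hm1 _ (by fun_prop)
  obtain ⟨y, -, hy⟩ := exists_le_setLAverage (μ := volume) hb0 hbt
    (f := fun y => ∫⁻ x in b, ENNReal.ofReal |q x - q y| ^ p)
    m0.lintegral_prod_right'.aemeasurable
  refine ⟨q y, ?_⟩
  have hc0 : Continuous fun x => q x - q y := by fun_prop
  have hc1 : Continuous fun x => 2 * R * ∑ i, |pd q i x| := by fun_prop
  set N := ∑ i, nrm p (pd q i) R with hN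
  have hN0 : 0 ≤ N := Finset.sum_nonneg fun _ _ => nrm_nonneg _ _ _
  have hFN : ∫⁻ x in b, F x ≤ ENNReal.ofReal ((2 * R * N) ^ p) := by
    have e : ∀ x, F x = ENNReal.ofReal (|2 * R * (∑ i, |pd q i x|)| ^ p) := by
      intro x
      rw [hF, ← ENNReal.ofReal_rpow_of_nonneg (abs_nonneg _) hp0.le, abs_of_nonneg (by positivity)]
    rw [lintegral_congr e, ← ofReal_nrm_rpow hp0 hc1, nrm_const_mul hp0, abs_of_nonneg (by positivity)]
    refine ENNReal.ofReal_le_ofReal (Real.rpow_le_rpow (mul_nonneg (by positivity) (nrm_nonneg _ _ _))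
      ?_ hp0.le)
    refine mul_le_mul_of_nonneg_left ?_ (by positivity)
    refine (nrm_sum_le Finset.univ hp.le (fun i => (hcp i).abs) R).trans_eq ?_
    simp only [nrm_abs, hN]
  have hfin : ENNReal.ofReal (nrm p (fun x => q x - q y) R ^ p) ≤
      ENNReal.ofReal ((32 * R * N) ^ p) := by
    rw [ofReal_nrm_rpow hp0 hc0]
    simp only [← ENNReal.ofReal_rpow_of_nonneg (abs_nonneg _) hp0.le]
    refine hy.trans ?_
    rw [setLAverage_eq]
    refine ENNReal.div_le_of_le_mul' (htot.trans ?_)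
    refine mul_le_mul_right ?_ _
    refine (mul_le_mul_right hFN _).trans ?_
    rw [show (16 : ENNReal) = ENNReal.ofReal 16 by simp, ← ENNReal.ofReal_mul (by norm_num)]
    refine ENNReal.ofReal_le_ofReal ?_
    rw [show 32 * R * N = 16 * (2 * R * N) by ring, Real.mul_rpow (x := 16) (by norm_num) (by positivity)]
    refine mul_le_mul_of_nonneg_right ?_ (by positivity)
    exact Real.self_le_rpow_of_one_le (by norm_num) hp.le
  rw [ENNReal.ofReal_le_ofReal_iff (by positivity)] at hfin
  exact (Real.rpow_le_rpow_iff (nrm_nonneg _ _ _) (by positivity) hp0).1 hfin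

theorem pd_translate {h : E3 → ℝ} (hh : ContDiff ℝ 1 h) (y : E3) (i : Fin 3) (x : E3) :
    pd (fun x => h (x - y)) i x = pd h i (x - y) := by
  have h1 : HasFDerivAt (fun x : E3 => x - y) (ContinuousLinearMap.id ℝ E3) x :=
    (hasFDerivAt_id x).sub_const y
  have := (differentiableAt_of_contDiff_one hh (x - y)).hasFDerivAt.comp x h1
  rw [pd]
  erw [this.fderiv]
  simp [pd]

theorem exists_mollifier : ∃ C : ℝ, 0 < C ∧ ∀ ε : ℝ, 0 < ε → ∃ ρ : E3 → ℝ,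
    ContDiff ℝ 1 ρ ∧ (∀ x, 0 ≤ ρ x) ∧ SuppIn ρ ε ∧ ∫ x, ρ x = 1 ∧
      ∀ k, ∫ x, |pd ρ k x| ≤ C / ε := by
  obtain ⟨C, hC, H⟩ := exists_cutoff_mid
  refine ⟨16 * C, by positivity, fun ε hε => ?_⟩
  obtain ⟨φ, hφ, h0, -, h1, hs, hd, -⟩ := H (ε / 2) ε (by positivity) (by linarith)
  have hφ1 := contDiff_one_of_top hφ
  have hs' : (ε / 2 + ε) / 2 < ε := by linarith
  set I := ∫ x, φ x with hI
  have hIl : ε ^ 3 / 8 * ballVol ≤ I := by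
    have e : (∫ x in Metric.ball (0 : E3) (ε / 2), (1 : ℝ)) = ε ^ 3 / 8 * ballVol := by
      rw [setIntegral_const, volume_real_ball (by positivity), smul_eq_mul]
      ring
    rw [← e]
    calc _ = ∫ x in Metric.ball (0 : E3) (ε / 2), φ x := by
          refine setIntegral_congr_fun measurableSet_ball fun x hx => ?_
          exact (h1 x (by simpa using (Metric.mem_ball.1 hx).le)).symm
      _ ≤ _ := setIntegral_le_integral (hs.integrable hφ.continuous) (Filter.Eventually.of_forall h0)
  have hI0 : 0 < I := lt_of_lt_of_le (mul_pos (by positivity) ballVol_pos) hIl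
  have hdφ : ∀ k, ∫ x, |pd φ k x| ≤ C / (ε / 2) * (ε ^ 3 * ballVol) := by
    intro k
    have hsk : SuppIn (fun x => |pd φ k x|) ((ε / 2 + ε) / 2) := fun x hx => by
      simp [hs.pd k x hx]
    have hck : Continuous fun x => |pd φ k x| := (continuous_pd hφ1 k).abs
    rw [← hsk.setIntegral_eq hs']
    calc _ ≤ ∫ x in Metric.ball (0 : E3) ε, C / (ε / 2) := by
          refine setIntegral_mono (continuous_integrableOn_ball hck ε)
            (continuous_integrableOn_ball continuous_const ε) fun x => ?_
          have := hd k x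
          rwa [show ε - ε / 2 = ε / 2 by ring] at this
      _ = _ := by
          rw [setIntegral_const, volume_real_ball hε.le, smul_eq_mul]
          ring
  refine ⟨fun x => I⁻¹ * φ x, contDiff_const.mul hφ1, fun x => by have := h0 x; positivity,
    fun x hx => by simp [hs x (hs'.trans hx)], ?_, fun k => ?_⟩
  · rw [integral_const_mul, inv_mul_cancel₀ hI0.ne']
  · have e : ∀ x, |pd (fun x => I⁻¹ * φ x) k x| = I⁻¹ * |pd φ k x| := fun x => by
      rw [pd_const_mul (differentiableAt_of_contDiff_one hφ1 x), abs_mul, abs_of_pos (inv_pos.2 hI0)]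
    simp only [e]
    rw [integral_const_mul, inv_mul_le_iff₀ hI0]
    refine (hdφ k).trans ?_
    calc C / (ε / 2) * (ε ^ 3 * ballVol) = 16 * C / ε * (ε ^ 3 / 8 * ballVol) := by
          field_simp; ring
      _ ≤ _ := by rw [mul_comm I]; gcongr

/-- `∂_i p = Δ v_i - F_i`. -/
structure IsStokes (v : Fin 3 → E3 → ℝ) (p : E3 → ℝ) (F : Fin 3 → E3 → ℝ) : Prop where
  smooth_v : ∀ j, ContDiff ℝ (⊤ : ℕ∞) (v j)
  smooth_p : ContDiff ℝ (⊤ : ℕ∞) p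
  continuous_F : ∀ j, Continuous (F j)
  eq : ∀ x j, pd p j x = (∑ k, pd (pd (v j) k) k x) - F j x
  div_v : ∀ x, ∑ i, pd (v i) i x = 0

section

variable {v F : Fin 3 → E3 → ℝ} {p : E3 → ℝ}

theorem IsStokes.integral_mul_pd_translate (H : IsStokes v p F) {f : E3 → ℝ}
    (hf : ContDiff ℝ 1 f) {s : ℝ} (hs : SuppIn f s) (i : Fin 3) (h : E3) :
    ∫ x, f x * pd p i (x - h) =
      -(∑ k, ∫ x, pd f k x * pd (v i) k (x - h)) - ∫ x, f x * F i (x - h) := by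
  have hF := H.continuous_F i
  have hfc := hf.continuous
  have hdv : ∀ k, ContDiff ℝ (⊤ : ℕ∞) (pd (v i) k) := fun k => contDiff_pd (H.smooth_v i) k
  have hdd : ∀ k, Continuous (pd (pd (v i) k) k) := fun k =>
    continuous_pd (contDiff_one_of_top (hdv k)) k
  have hprod : ∀ k, Integrable fun x => f x * pd (pd (v i) k) k (x - h) := fun k => by
    have := hdd k
    exact SuppIn.integrable (s := s) (fun x hx => by simp [hs x hx]) (by fun_prop)
  have hintF : Integrable fun x => f x * F i (x - h) :=
    SuppIn.integrable (s := s) (fun x hx => by simp [hs x hx]) (by fun_prop)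
  simp only [H.eq, mul_sub, Finset.mul_sum]
  rw [integral_sub (integrable_finsetSum _ fun k _ => hprod k) hintF,
    integral_finsetSum _ fun k _ => hprod k, ← Finset.sum_neg_distrib]
  congr 2
  funext k
  have hc : ContDiff ℝ 1 fun x => pd (v i) k (x - h) :=
    (contDiff_one_of_top (hdv k)).comp (contDiff_id.sub contDiff_const)
  rw [← integral_mul_pd hf hc hs k]
  simp only [pd_translate (contDiff_one_of_top (hdv k))]

theorem IsStokes.abs_integral_translate_sub_le (H : IsStokes v p F) {f : E3 → ℝ}
    (hf : ContDiff ℝ 1 f) {m' m s ε : ℝ} (hs : SuppIn f m') (hm : m' < m) (hms : m + ε ≤ s)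
    {D D1 N S6 : ℝ} (hD1 : 0 ≤ D1) (hN : 0 ≤ N)
    (hDv : ∀ i k, nrm 2 (pd (v i) k) s ≤ D) (hDf : ∀ k, nrm 2 (pd f k) m ≤ D1)
    (hNF : ∀ i, nrm (6 / 5) (F i) s ≤ N) (hSf : nrm 6 f m ≤ S6) {h : E3} (hh : ‖h‖ ≤ ε) :
    |(∫ x, f x * p (x - h)) - ∫ x, f x * p x| ≤ 3 * ε * (3 * (D * D1) + N * S6) := by
  have hD0 : 0 ≤ D := (nrm_nonneg _ _ _).trans (hDv 0 0)
  have hS0 : 0 ≤ S6 := (nrm_nonneg _ _ _).trans hSf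
  have hpc := H.smooth_p.continuous
  have hp' : Continuous fun w => p (-w) := by fun_prop
  set Ξ := conv f (fun w => p (-w)) with hΞ
  have hval : ∀ h, Ξ h = ∫ x, f x * p (x - h) := fun h => by simp [hΞ, conv]
  have hpd : ∀ i h, ‖h‖ ≤ ε → |pd Ξ i h| ≤ 3 * (D * D1) + N * S6 := by
    intro i h hh
    have e1 : pd Ξ i h = -∫ x, f x * pd p i (x - h) := by
      rw [hΞ, pd_conv hf hp' hs]
      have hc : ContDiff ℝ 1 fun x => p (x - h) :=
        (contDiff_one_of_top H.smooth_p).comp (contDiff_id.sub contDiff_const)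
      have := integral_mul_pd hf hc hs i
      simp only [pd_translate (contDiff_one_of_top H.smooth_p)] at this
      rw [this, neg_neg]
      simp [conv]
    rw [e1, H.integral_mul_pd_translate hf hs, abs_neg]
    have hb : ∀ {q q' : ℝ} {g k : E3 → ℝ}, 0 < q → 0 < q' → 1 / q + 1 / q' = 1 → Continuous g →
        Continuous k → SuppIn g m' → |∫ x, g x * k (x - h)| ≤ nrm q k s * nrm q' g m := by
      intro q q' g k hq hq' hqq hg hk hgs
      refine abs_integral_le_integral_abs.trans ?_
      refine le_trans (le_of_eq ?_) (integral_abs_translate_mul_le hq hq' hqq hk hg hgs hm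
        (k := h) (t := s) (by linarith))
      congr 1
      funext x
      rw [abs_mul, mul_comm]
    have b1 : ∀ k, |∫ x, pd f k x * pd (v i) k (x - h)| ≤ D * D1 := fun k =>
      (hb (q := 2) (q' := 2) (by norm_num) (by norm_num) (by norm_num) (continuous_pd hf k)
        (continuous_pd (contDiff_one_of_top (H.smooth_v i)) k) (hs.pd k)).trans
        (mul_le_mul (hDv i k) (hDf k) (nrm_nonneg _ _ _) hD0)
    have b2 : |∫ x, f x * F i (x - h)| ≤ N * S6 :=
      (hb (q := 6 / 5) (q' := 6) (by norm_num) (by norm_num) (by norm_num) hf.continuous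
        (H.continuous_F i) hs).trans (mul_le_mul (hNF i) hSf (nrm_nonneg _ _ _) hN)
    refine (abs_sub _ _).trans (add_le_add ?_ b2)
    rw [abs_neg]
    refine (Finset.abs_sum_le_sum_abs _ _).trans ((Finset.sum_le_sum fun k _ => b1 k).trans_eq ?_)
    simp
  have hΞ1 : ContDiff ℝ 1 Ξ := contDiff_conv hf hp' hs
  have hmv := (convex_closedBall (0 : E3) ε).norm_image_sub_le_of_norm_fderiv_le
    (f := Ξ) (𝕜 := ℝ) (C := 3 * (3 * (D * D1) + N * S6))
    (fun x _ => differentiableAt_of_contDiff_one hΞ1 x) (fun x hx => by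
      refine (norm_fderiv_le Ξ x).trans ((Finset.sum_le_sum fun i _ =>
        hpd i x (by simpa using hx)).trans_eq ?_)
      simp; ring) (x := 0) (y := h) (by simpa using (norm_nonneg h).trans hh) (by simpa using hh)
  rw [Real.norm_eq_abs, hval, hval] at hmv
  simp only [sub_zero] at hmv
  refine hmv.trans ?_
  have : 0 ≤ 3 * (3 * (D * D1) + N * S6) := by positivity
  calc _ ≤ 3 * (3 * (D * D1) + N * S6) * ε := mul_le_mul_of_nonneg_left hh this
    _ = _ := by ring

theorem IsStokes.abs_integral_sub_conv_le (H : IsStokes v p F) {f ρ : E3 → ℝ}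
    (hf : ContDiff ℝ 1 f) {m' m s ε : ℝ} (hs : SuppIn f m') (hm : m' < m) (hms : m + ε ≤ s)
    {D D1 N S6 : ℝ} (hD1 : 0 ≤ D1) (hN : 0 ≤ N)
    (hDv : ∀ i k, nrm 2 (pd (v i) k) s ≤ D) (hDf : ∀ k, nrm 2 (pd f k) m ≤ D1)
    (hNF : ∀ i, nrm (6 / 5) (F i) s ≤ N) (hSf : nrm 6 f m ≤ S6)
    (hρ : ContDiff ℝ 1 ρ) (hρ0 : ∀ x, 0 ≤ ρ x) (hρs : SuppIn ρ ε) (hρ1 : ∫ x, ρ x = 1) :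
    |(∫ x, f x * p x) - ∫ x, f x * conv ρ p x| ≤ 3 * ε * (3 * (D * D1) + N * S6) := by
  have hpc := H.smooth_p.continuous
  have hfc := hf.continuous
  have hρc := hρ.continuous
  have hp' : Continuous fun w => p (-w) := by fun_prop
  set Ξ := conv f (fun w => p (-w)) with hΞ
  have hΞc : Continuous Ξ := (contDiff_conv hf hp' hs).continuous
  have hval : ∀ h, Ξ h = ∫ x, f x * p (x - h) := fun h => by simp [hΞ, conv]
  have hsw : ∫ x, f x * conv ρ p x = ∫ y, ρ y * Ξ y := by
    simp only [hval, conv, ← integral_const_mul]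
    rw [integral_integral_swap_of_hasCompactSupport]
    · congr 1
      funext y
      congr 1
      funext x
      ring
    · rw [Function.uncurry_def]; fun_prop
    · refine HasCompactSupport.intro
        ((isCompact_closedBall (0 : E3) m').prod (isCompact_closedBall (0 : E3) ε)) fun z hz => ?_
      by_cases h1 : m' < ‖z.1‖
      · simp [Function.uncurry_def, hs _ h1]
      · by_cases h2 : ε < ‖z.2‖
        · simp [Function.uncurry_def, hρs _ h2]
        · exact absurd (Set.mem_prod.2 ⟨by simpa using h1, by simpa using h2⟩) hz
  have h0 : ∫ x, f x * p x = ∫ y, ρ y * (∫ x, f x * p x) := by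
    rw [integral_mul_const, hρ1, one_mul]
  have i1 : Integrable fun y => ρ y * (∫ x, f x * p x) := (hρs.integrable hρc).mul_const _
  have i2 : Integrable fun y => ρ y * Ξ y := (hρs.mul_right Ξ).integrable (hρc.mul hΞc)
  rw [hsw, h0, ← integral_sub i1 i2]
  set A := 3 * ε * (3 * (D * D1) + N * S6) with hA
  calc _ ≤ ∫ y, |ρ y * (∫ x, f x * p x) - ρ y * Ξ y| := abs_integral_le_integral_abs
    _ ≤ ∫ y, ρ y * A := by
        refine integral_mono (i1.sub i2).abs ((hρs.integrable hρc).mul_const _) fun y => ?_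
        simp only
        rw [← mul_sub, abs_mul, abs_of_nonneg (hρ0 y)]
        by_cases hy : ε < ‖y‖
        · simp [hρs y hy]
        · refine mul_le_mul_of_nonneg_left ?_ (hρ0 y)
          rw [abs_sub_comm, hval]
          exact H.abs_integral_translate_sub_le hf hs hm hms hD1 hN hDv hDf hNF hSf (not_lt.1 hy)
    _ = A := by rw [integral_mul_const, hρ1, one_mul]

end

theorem nrm_sub_le {q : ℝ} (hq : 1 ≤ q) {f g : E3 → ℝ} (hf : Continuous f) (hg : Continuous g)
    (r : ℝ) : nrm q (fun x => f x - g x) r ≤ nrm q f r + nrm q g r := by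
  have h := nrm_add_le hq hf (g := fun x => (-1) * g x) (by fun_prop) r
  rw [nrm_const_mul (by linarith)] at h
  simpa [sub_eq_add_neg] using h

theorem IsStokes.nrm_pd_conv_le {v F : Fin 3 → E3 → ℝ} {p : E3 → ℝ} (H : IsStokes v p F)
    {ρ : E3 → ℝ} {m s ε L M65 N : ℝ} (hms : m + ε ≤ s)
    (hρ : ContDiff ℝ 1 ρ) (hρ0 : ∀ x, 0 ≤ ρ x) (hρs : SuppIn ρ ε) (hρ1 : ∫ x, ρ x = 1)
    (hL0 : 0 ≤ L) (hL : ∀ k, ∫ x, |pd ρ k x| ≤ L)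
    (hDv : ∀ i k, nrm (6 / 5) (pd (v i) k) s ≤ M65) (hNF : ∀ i, nrm (6 / 5) (F i) s ≤ N)
    (i : Fin 3) : nrm (6 / 5) (pd (conv ρ p) i) m ≤ 3 * L * M65 + N := by
  have hdv : ∀ k, ContDiff ℝ 1 (pd (v i) k) := fun k =>
    contDiff_one_of_top (contDiff_pd (H.smooth_v i) k)
  have hdd : ∀ k, Continuous (pd (pd (v i) k) k) := fun k => continuous_pd (hdv k) k
  have hF := H.continuous_F i
  have hρc := hρ.continuous
  have e : pd (conv ρ p) i = fun x =>
      (∑ k, conv (pd ρ k) (pd (v i) k) x) - conv ρ (F i) x := by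
    funext x
    rw [pd_conv hρ H.smooth_p.continuous hρs, conv_pd hρ (contDiff_one_of_top H.smooth_p) hρs]
    simp only [conv_pd hρ (hdv _) hρs]
    simp only [conv, H.eq, mul_sub, Finset.mul_sum]
    rw [integral_sub, integral_finsetSum]
    · exact fun k _ => (hρs.mul_right _).integrable (by have := hdd k; fun_prop)
    · exact integrable_finsetSum _ fun k _ =>
        (hρs.mul_right _).integrable (by have := hdd k; fun_prop)
    · exact (hρs.mul_right _).integrable (by fun_prop)
  have hc1 : ∀ k, Continuous (conv (pd ρ k) (pd (v i) k)) := fun k => by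
    have := continuous_pd (contDiff_conv hρ (hdv k).continuous hρs) k
    rwa [show pd (conv ρ (pd (v i) k)) k = conv (pd ρ k) (pd (v i) k) from
      funext fun x => pd_conv hρ (hdv k).continuous hρs k x] at this
  have hc2 : Continuous (conv ρ (F i)) := (contDiff_conv hρ hF hρs).continuous
  rw [e]
  refine (nrm_sub_le (by norm_num) (continuous_finsetSum _ fun k _ => hc1 k) hc2 m).trans ?_
  refine add_le_add ((nrm_sum_le _ (by norm_num) hc1 m).trans ?_) ?_
  · calc _ ≤ ∑ _k : Fin 3, L * M65 := Finset.sum_le_sum fun k _ =>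
          (nrm_conv_le (by norm_num) (continuous_pd hρ k) (hdv k).continuous (hc1 k) (fun _ => rfl)
            (hρs.pd k) hms).trans (mul_le_mul (hL k) (hDv i k) (nrm_nonneg _ _ _) hL0)
      _ = _ := by simp; ring
  · have := nrm_conv_le (p := 6 / 5) (by norm_num) hρc hF hc2 (fun _ => rfl) hρs hms
    simp only [abs_of_nonneg (hρ0 _), hρ1, one_mul] at this
    exact this.trans (hNF i)

theorem integral_mul_transport_potential {v : Fin 3 → E3 → ℝ} {Φ : Fin 3 → Fin 3 → E3 → ℝ}
    {φ q : E3 → ℝ} (hv : ∀ j, ContDiff ℝ 1 (v j)) (hdiv : ∀ x, ∑ i, pd (v i) i x = 0)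
    (hΦ : ∀ i j, ContDiff ℝ 1 (Φ i j)) (hΦv : ∀ j x, v j x = ∑ i, pd (Φ i j) i x)
    (hφ : ContDiff ℝ (⊤ : ℕ∞) φ) {m' : ℝ} (hs : SuppIn φ m') (hq : ContDiff ℝ 1 q) (c : ℝ) :
    ∫ x, (∑ j, pd φ j x * v j x) * q x =
      -∑ j, ∑ i, ∫ x, (pd q i x * pd φ j x + (q x - c) * pd (pd φ j) i x) * Φ i j x := by
  have hφj : ∀ j, ContDiff ℝ 1 (pd φ j) := fun j => contDiff_one_of_top (contDiff_pd hφ j)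
  have hqc := hq.continuous
  have hφc := hφ.continuous
  have hcv := fun j => (hv j).continuous
  have hcφ := fun j => (hφj j).continuous
  have hcd : ∀ j i, Continuous (pd (Φ i j) i) := fun j i => continuous_pd (hΦ i j) i
  have hi1 : ∀ j, Integrable fun x => pd φ j x * v j x := fun j =>
    ((hs.pd j).mul_right _).integrable (by have := hcv j; have := hcφ j; fun_prop)
  have h0 : ∫ x, (∑ j, pd φ j x * v j x) = 0 := by
    rw [integral_finsetSum _ fun j _ => hi1 j]
    have e : ∀ j, ∫ x, pd φ j x * v j x = -∫ x, φ x * pd (v j) j x := fun j => by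
      rw [integral_mul_pd (contDiff_one_of_top hφ) (hv j) hs, neg_neg]
    simp only [e]
    rw [Finset.sum_neg_distrib, ← integral_finsetSum]
    · simp only [← Finset.mul_sum, hdiv]; simp
    · exact fun j _ => (hs.mul_right _).integrable
        (by have := continuous_pd (hv j) j; fun_prop)
  have i1 : Integrable fun x => (∑ j, pd φ j x * v j x) * (q x - c) :=
    SuppIn.integrable (s := m') (fun x hx => by simp [hs.pd _ x hx]) (by fun_prop)
  have i2 : Integrable fun x => (∑ j, pd φ j x * v j x) * c :=
    SuppIn.integrable (s := m') (fun x hx => by simp [hs.pd _ x hx]) (by fun_prop)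
  have h1 : ∫ x, (∑ j, pd φ j x * v j x) * q x = ∫ x, (∑ j, pd φ j x * v j x) * (q x - c) := by
    have e : ∀ x, (∑ j, pd φ j x * v j x) * q x =
        (∑ j, pd φ j x * v j x) * (q x - c) + (∑ j, pd φ j x * v j x) * c := fun x => by ring
    simp only [e]
    rw [integral_add i1 i2, integral_mul_const, h0, zero_mul, add_zero]
  have hg : ∀ j, ContDiff ℝ 1 fun x => (q x - c) * pd φ j x := fun j =>
    (hq.sub contDiff_const).mul (hφj j)
  have hgs : ∀ j, SuppIn (fun x => (q x - c) * pd φ j x) m' := fun j => (hs.pd j).mul_left _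
  rw [h1, ← Finset.sum_neg_distrib]
  have e2 : ∀ x, (∑ j, pd φ j x * v j x) * (q x - c) =
      ∑ j, ∑ i, (q x - c) * pd φ j x * pd (Φ i j) i x := fun x => by
    rw [Finset.sum_mul]
    refine Finset.sum_congr rfl fun j _ => ?_
    rw [← Finset.mul_sum, ← hΦv]
    ring
  have i3 : ∀ j i, Integrable fun x => (q x - c) * pd φ j x * pd (Φ i j) i x := fun j i =>
    ((hgs j).mul_right _).integrable ((hg j).continuous.mul (hcd j i))
  simp only [e2]
  rw [integral_finsetSum _ fun j _ => integrable_finsetSum _ fun i _ => i3 j i]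
  refine Finset.sum_congr rfl fun j _ => ?_
  rw [integral_finsetSum _ fun i _ => i3 j i, ← Finset.sum_neg_distrib]
  refine Finset.sum_congr rfl fun i _ => ?_
  rw [integral_mul_pd (hg j) (hΦ i j) (hgs j)]
  congr 2
  funext x
  rw [pd_mul ((differentiableAt_of_contDiff_one hq x).sub_const c)
    (differentiableAt_of_contDiff_one (hφj j) x), pd_sub_const]

theorem IsStokes.abs_integral_conv_le {v F : Fin 3 → E3 → ℝ} {p : E3 → ℝ} (H : IsStokes v p F)
    {Φ : Fin 3 → Fin 3 → E3 → ℝ} (hΦ : ∀ i j, ContDiff ℝ 1 (Φ i j))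
    (hΦv : ∀ j x, v j x = ∑ i, pd (Φ i j) i x)
    {φ ρ : E3 → ℝ} {m' m s ε L M M65 N K1 K2 : ℝ} (hφ : ContDiff ℝ (⊤ : ℕ∞) φ)
    (hs : SuppIn φ m') (hm' : m' < m) (hm : 0 < m) (hms : m + ε ≤ s)
    (hρ : ContDiff ℝ 1 ρ) (hρ0 : ∀ x, 0 ≤ ρ x) (hρs : SuppIn ρ ε) (hρ1 : ∫ x, ρ x = 1)
    (hL0 : 0 ≤ L) (hL : ∀ k, ∫ x, |pd ρ k x| ≤ L)
    (hDv : ∀ i k, nrm (6 / 5) (pd (v i) k) s ≤ M65) (hNF : ∀ i, nrm (6 / 5) (F i) s ≤ N)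
    (hK1 : ∀ i x, |pd φ i x| ≤ K1) (hK2 : ∀ i j x, |pd (pd φ i) j x| ≤ K2)
    (hM : ∀ i j, nrm 6 (Φ i j) m ≤ M) :
    |∫ x, (∑ j, pd φ j x * v j x) * conv ρ p x| ≤
      9 * ((K1 + 96 * m * K2) * (3 * L * M65 + N) * M) := by
  set q := conv ρ p with hq
  set Q := 3 * L * M65 + N with hQ
  have hq1 : ContDiff ℝ 1 q := contDiff_conv hρ H.smooth_p.continuous hρs
  have hqc := hq1.continuous
  have hQb : ∀ i, nrm (6 / 5) (pd q i) m ≤ Q :=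
    H.nrm_pd_conv_le hms hρ hρ0 hρs hρ1 hL0 hL hDv hNF
  obtain ⟨c, hc⟩ := exists_nrm_sub_const_le (p := 6 / 5) (by norm_num) (by norm_num) hq1 hm
  have hc' : nrm (6 / 5) (fun x => q x - c) m ≤ 96 * m * Q := by
    refine hc.trans ?_
    calc _ ≤ 32 * m * ∑ _i : Fin 3, Q := by gcongr with i; exact hQb i
      _ = _ := by simp; ring
  have hK10 : 0 ≤ K1 := (abs_nonneg _).trans (hK1 0 0)
  have hK20 : 0 ≤ K2 := (abs_nonneg _).trans (hK2 0 0 0)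
  have hQ0 : 0 ≤ Q := (nrm_nonneg _ _ _).trans (hQb 0)
  have hM0 : 0 ≤ M := (nrm_nonneg _ _ _).trans (hM 0 0)
  rw [integral_mul_transport_potential (fun j => contDiff_one_of_top (H.smooth_v j)) H.div_v hΦ hΦv
    hφ hs hq1 c, abs_neg]
  have hterm : ∀ j i, |∫ x, (pd q i x * pd φ j x + (q x - c) * pd (pd φ j) i x) * Φ i j x| ≤
      (K1 + 96 * m * K2) * Q * M := by
    intro j i
    have hcq := continuous_pd hq1 i
    have hcφ := continuous_pd (contDiff_one_of_top hφ) j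
    have hcφ2 := continuous_pd (contDiff_one_of_top (contDiff_pd hφ j)) i
    have hcΦ := (hΦ i j).continuous
    have hsup : SuppIn (fun x => (pd q i x * pd φ j x + (q x - c) * pd (pd φ j) i x) * Φ i j x) m' :=
      fun x hx => by simp [hs.pd j x hx, (hs.pd j).pd i x hx]
    rw [← hsup.setIntegral_eq hm']
    have i1 : IntegrableOn (fun x => K1 * (|pd q i x| * |Φ i j x|)) (Metric.ball 0 m) :=
      continuous_integrableOn_ball (by fun_prop) m
    have i2 : IntegrableOn (fun x => K2 * (|q x - c| * |Φ i j x|)) (Metric.ball 0 m) :=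
      continuous_integrableOn_ball (by fun_prop) m
    have b1 := integral_abs_mul_le (p := 6 / 5) (q := 6) (by norm_num) (by norm_num) (by norm_num)
      hcq hcΦ m
    have b2 := integral_abs_mul_le (p := 6 / 5) (q := 6) (by norm_num) (by norm_num) (by norm_num)
      (f := fun x => q x - c) (by fun_prop) hcΦ m
    have b1' := b1.trans (mul_le_mul (hQb i) (hM i j) (nrm_nonneg _ _ _) hQ0)
    have b2' := b2.trans (mul_le_mul hc' (hM i j) (nrm_nonneg _ _ _) (by positivity))
    calc _ ≤ ∫ x in Metric.ball (0 : E3) m,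
          |(pd q i x * pd φ j x + (q x - c) * pd (pd φ j) i x) * Φ i j x| :=
          abs_integral_le_integral_abs
      _ ≤ ∫ x in Metric.ball (0 : E3) m,
          (K1 * (|pd q i x| * |Φ i j x|) + K2 * (|q x - c| * |Φ i j x|)) := by
          refine setIntegral_mono (continuous_integrableOn_ball (by fun_prop) m) (i1.add i2)
            fun x => ?_
          rw [abs_mul]
          have := abs_add_le (pd q i x * pd φ j x) ((q x - c) * pd (pd φ j) i x)
          rw [abs_mul, abs_mul] at this
          have t1 := mul_le_mul_of_nonneg_left (hK1 j x) (abs_nonneg (pd q i x))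
          have t2 := mul_le_mul_of_nonneg_left (hK2 j i x) (abs_nonneg (q x - c))
          calc _ ≤ (|pd q i x| * K1 + |q x - c| * K2) * |Φ i j x| := by gcongr; linarith
            _ = _ := by ring
      _ = K1 * (∫ x in Metric.ball (0 : E3) m, |pd q i x| * |Φ i j x|) +
          K2 * ∫ x in Metric.ball (0 : E3) m, |q x - c| * |Φ i j x| := by
          rw [integral_add i1 i2, integral_const_mul, integral_const_mul]
      _ ≤ K1 * (Q * M) + K2 * (96 * m * Q * M) := by gcongr
      _ = _ := by ring
  refine (Finset.abs_sum_le_sum_abs _ _).trans ((Finset.sum_le_sum fun j _ =>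
    (Finset.abs_sum_le_sum_abs _ _).trans (Finset.sum_le_sum fun i _ => hterm j i)).trans_eq ?_)
  simp; ring

theorem IsHallMHD.isStokes {v B : Fin 3 → E3 → ℝ} {p : E3 → ℝ} (H : IsHallMHD v B p) :
    IsStokes v p fun j x => (∑ k, v k x * pd (v j) k x) - ∑ k, B k x * pd (B j) k x where
  smooth_v := H.smooth_v
  smooth_p := H.smooth_p
  continuous_F j := by
    have hv := fun k => (H.smooth_v k).continuous
    have hB := fun k => (H.smooth_B k).continuous
    have hv' := fun k => continuous_pd (contDiff_one_of_top (H.smooth_v j)) k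
    have hB' := fun k => continuous_pd (contDiff_one_of_top (H.smooth_B j)) k
    fun_prop
  eq x j := by
    have h := H.momentum x j
    have e : lap (v j) x = ∑ k, pd (pd (v j) k) k x := rfl
    linarith
  div_v := H.div_v

theorem IsHallMHD.abs_force_le {v B : Fin 3 → E3 → ℝ} (j : Fin 3) (x : E3) :
    |(∑ k, v k x * pd (v j) k x) - ∑ k, B k x * pd (B j) k x| ≤ amp₂ v B x * gradAmp₂ v B x := by
  have key : ∀ w : Fin 3 → E3 → ℝ, |∑ k, w k x * pd (w j) k x| ≤ amp w x * gradAmp w x := fun w =>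
    (sum_mul_abs_le fun i => abs_le_amp w i x).trans <|
      mul_le_mul_of_nonneg_left (Finset.single_le_sum (f := fun j => ∑ i, |pd (w j) i x|)
        (fun j _ => Finset.sum_nonneg fun i _ => abs_nonneg _) (Finset.mem_univ j)) (amp_nonneg w x)
  have h1 := abs_sub (∑ k, v k x * pd (v j) k x) (∑ k, B k x * pd (B j) k x)
  have e : amp₂ v B x * gradAmp₂ v B x = (amp v x + amp B x) * (gradAmp v x + gradAmp B x) := rfl
  have h2 := mul_nonneg (amp_nonneg v x) (gradAmp_nonneg B x)
  have h3 := mul_nonneg (amp_nonneg B x) (gradAmp_nonneg v x)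
  rw [e]
  linarith [key v, key B]

set_option maxHeartbeats 1000000 in
theorem IsHallMHD.exists_energy_le : ∃ C : ℝ, 0 < C ∧ ∀ (v B : Fin 3 → E3 → ℝ) (p : E3 → ℝ),
    IsHallMHD v B p → ∀ Φ : Fin 3 → Fin 3 → E3 → ℝ, (∀ i j, ContDiff ℝ 1 (Φ i j)) →
    (∀ j x, v j x = ∑ i, pd (Φ i j) i x) → ∀ r s ε M : ℝ, 0 < r → r < s → 0 < ε → 4 * ε ≤ s - r →
    (∀ i j, nrm 6 (Φ i j) s ≤ M) →
    nrm 2 (gradAmp₂ v B) r ^ 2 ≤ C * (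
      (nrm 2 (amp₂ v B) s * nrm 2 (gradAmp₂ v B) s + nrm 3 (amp₂ v B) s ^ 3
        + nrm 3 (amp₂ v B) s * nrm 6 (amp B) s * nrm 2 (gradAmp₂ v B) s) / (s - r)
      + ε * (nrm 2 (gradAmp₂ v B) s * (nrm 2 (amp₂ v B) s / (s - r) ^ 2
          + nrm 2 (gradAmp₂ v B) s / (s - r))
        + nrm (6 / 5) (fun x => amp₂ v B x * gradAmp₂ v B x) s * (nrm 6 (amp₂ v B) s / (s - r)))
      + (1 / (s - r) + s / (s - r) ^ 2) * (nrm (6 / 5) (gradAmp₂ v B) s / ε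
          + nrm (6 / 5) (fun x => amp₂ v B x * gradAmp₂ v B x) s) * M) := by
  obtain ⟨C1, hC1, HC⟩ := exists_cutoff_mid
  obtain ⟨C2, hC2, HM⟩ := exists_mollifier
  refine ⟨18 * (864 * C1 * (3 * C2 + 1)), by positivity, ?_⟩
  intro v B p H Φ hΦ hΦv r s ε M hr hrs hε hεd hM
  obtain ⟨φ, hφ, hφ0, -, hφr, hs, hK1, hK2⟩ := HC r s hr hrs
  obtain ⟨ρ, hρ, hρ0, hρs, hρ1, hL⟩ := HM ε hε
  set S := amp₂ v B with hS
  set G := gradAmp₂ v B with hG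
  have hcS : Continuous S := H.continuous_amp₂
  have hcG : Continuous G := H.continuous_gradAmp₂
  have hS0 : ∀ x, 0 ≤ S x := amp₂_nonneg v B
  have hG0 : ∀ x, 0 ≤ G x := gradAmp₂_nonneg v B
  set d := s - r with hd
  have hd0 : 0 < d := by simp only [hd]; linarith
  set m := (r + 3 * s) / 4 with hm
  have hm0 : 0 < m := by simp only [hm]; linarith
  have hm' : (r + s) / 2 < m := by simp only [hm]; linarith
  have hms : m + ε ≤ s := by simp only [hm]; linarith
  have hms' : m ≤ s := by linarith
  have hst := H.isStokes
  have hF : ∀ i, nrm (6 / 5) (fun x => (∑ k, v k x * pd (v i) k x) - ∑ k, B k x * pd (B i) k x) s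
      ≤ nrm (6 / 5) (fun x => S x * G x) s := fun i =>
    nrm_mono (by norm_num) (hst.continuous_F i) (by fun_prop) le_rfl fun x _ =>
      (IsHallMHD.abs_force_le i x).trans (le_abs_self _)
  have hcpv : ∀ i k, Continuous (pd (v i) k) := fun i k =>
    continuous_pd (contDiff_one_of_top (H.smooth_v i)) k
  have hpd : ∀ i k x, |pd (v i) k x| ≤ |G x| := fun i k x =>
    ((abs_pd_le_gradAmp v i k x).trans (gradAmp_le_left v B x)).trans (le_abs_self _)
  have hD : ∀ i k, nrm 2 (pd (v i) k) s ≤ nrm 2 G s := fun i k =>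
    nrm_mono (by norm_num) (hcpv i k) hcG le_rfl fun x _ => hpd i k x
  have hM65 : ∀ i k, nrm (6 / 5) (pd (v i) k) s ≤ nrm (6 / 5) G s := fun i k =>
    nrm_mono (by norm_num) (hcpv i k) hcG le_rfl fun x _ => hpd i k x
  set f : E3 → ℝ := fun x => ∑ j, pd φ j x * v j x with hf
  have hfd : ContDiff ℝ (⊤ : ℕ∞) f :=
    ContDiff.sum fun j _ => (contDiff_pd hφ j).mul (H.smooth_v j)
  have hf1 := contDiff_one_of_top hfd
  have hsf : SuppIn f ((r + s) / 2) := fun x hx => by simp [hf, hs.pd _ x hx]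
  have hK10 : 0 ≤ C1 / d := by positivity
  have hK20 : 0 ≤ C1 / d ^ 2 := by positivity
  have hsum : ∀ x, ∑ j, |v j x| ≤ S x := fun x => amp_le_left v B x
  have hfS : nrm 6 f m ≤ C1 / d * nrm 6 S s := by
    have e : nrm 6 f m ≤ nrm 6 (fun x => C1 / d * S x) s :=
      nrm_mono (by norm_num) hfd.continuous (by fun_prop) hms' fun x _ => by
        refine le_trans ?_ (le_abs_self _)
        exact (sum_mul_abs_le fun i => hK1 i x).trans
          (mul_le_mul_of_nonneg_left (hsum x) hK10)
    rwa [nrm_const_mul (by norm_num) S, abs_of_nonneg hK10] at e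
  have hDf : ∀ k, nrm 2 (pd f k) m ≤ C1 / d ^ 2 * nrm 2 S s + C1 / d * nrm 2 G s := fun k => by
    have e : nrm 2 (pd f k) m ≤ nrm 2 (fun x => C1 / d ^ 2 * S x + C1 / d * G x) s :=
      nrm_mono (by norm_num) (continuous_pd hf1 k) (by fun_prop) hms' fun x _ => by
        refine le_trans ?_ (le_abs_self _)
        have e1 : pd f k x = (∑ j, pd (pd φ j) k x * v j x) + ∑ j, pd φ j x * pd (v j) k x := by
          rw [hf, pd_sum (f := fun j x => pd φ j x * v j x) fun j _ =>
            ((differentiableAt_of_top (contDiff_pd hφ j) x).fun_mul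
            (differentiableAt_of_top (H.smooth_v j) x)), ← Finset.sum_add_distrib]
          exact Finset.sum_congr rfl fun j _ => pd_mul
            (differentiableAt_of_top (contDiff_pd hφ j) x) (differentiableAt_of_top (H.smooth_v j) x) k
        rw [e1]
        refine (abs_add_le _ _).trans (add_le_add ?_ ?_)
        · exact (sum_mul_abs_le fun i => hK2 i k x).trans (mul_le_mul_of_nonneg_left (hsum x) hK20)
        · refine (sum_mul_abs_le fun i => hK1 i x).trans (mul_le_mul_of_nonneg_left ?_ hK10)
          refine le_trans (Finset.sum_le_sum fun j _ => ?_) (gradAmp_le_left v B x)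
          exact Finset.single_le_sum (f := fun i => |pd (v j) i x|) (fun i _ => abs_nonneg _)
            (Finset.mem_univ k)
    refine e.trans ((nrm_add_le (by norm_num) (by fun_prop) (by fun_prop) s).trans_eq ?_)
    rw [nrm_const_mul (by norm_num) S, nrm_const_mul (by norm_num) G, abs_of_nonneg hK10,
      abs_of_nonneg hK20]
  have n1 := nrm_nonneg 2 S s
  have n2 := nrm_nonneg 2 G s
  have n3 := nrm_nonneg 3 S s
  have n4 := nrm_nonneg 6 (amp B) s
  have n5 := nrm_nonneg 6 S s
  have n6 := nrm_nonneg (6 / 5) (fun x => S x * G x) s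
  have n7 := nrm_nonneg (6 / 5) G s
  have hM0 : 0 ≤ M := (nrm_nonneg _ _ _).trans (hM 0 0)
  have A1 := H.energy_le hφ hs (by linarith : (r + s) / 2 < s) hφ0 hφr hK1
  have A2 := hst.abs_integral_sub_conv_le hf1 hsf hm' hms
    (by positivity) n6 hD hDf hF hfS hρ hρ0 hρs hρ1
  have A3 := hst.abs_integral_conv_le hΦ hΦv hφ hs hm' hm0 hms hρ hρ0 hρs hρ1 (by positivity) hL
    hM65 hF hK1 hK2 fun i j => (nrm_mono (by norm_num) (hΦ i j).continuous (hΦ i j).continuous hms'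
      fun _ _ => le_rfl).trans (hM i j)
  have e : ∫ x, p x * ∑ i, pd φ i x * v i x = ∫ x, f x * p x :=
    integral_congr_ae (Filter.Eventually.of_forall fun x => mul_comm _ _)
  rw [e] at A1
  refine A1.trans ?_
  rw [mul_assoc 18]
  refine mul_le_mul_of_nonneg_left ?_ (by norm_num)
  have B2 := (le_abs_self _).trans A2
  have B3 := (le_abs_self _).trans A3
  generalize nrm 2 S s = s2 at *
  generalize nrm 2 G s = g2 at *
  generalize nrm 3 S s = s3 at *
  generalize nrm 6 (amp B) s = b6 at *
  generalize nrm 6 S s = s6 at *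
  generalize nrm (6 / 5) (fun x => S x * G x) s = nN at *
  generalize nrm (6 / 5) G s = nM at *
  set K := 864 * C1 * (3 * C2 + 1) with hK
  have k1 : 9 * C1 ≤ K := by rw [hK]; nlinarith [mul_pos hC1 hC2]
  have T1 : C1 / d * (s2 * g2 + 2 * s3 ^ 3 + 3 * (s3 * b6 * g2)) ≤
      K * ((s2 * g2 + s3 ^ 3 + s3 * b6 * g2) / d) := by
    have t1 : 0 ≤ s2 * g2 := by positivity
    have t2 : 0 ≤ s3 ^ 3 := by positivity
    have t3 : 0 ≤ s3 * b6 * g2 := by positivity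
    calc _ ≤ C1 / d * (9 * (s2 * g2 + s3 ^ 3 + s3 * b6 * g2)) := by gcongr; linarith
      _ = 9 * C1 * ((s2 * g2 + s3 ^ 3 + s3 * b6 * g2) / d) := by ring
      _ ≤ _ := by gcongr
  have T2 : 3 * ε * (3 * (g2 * (C1 / d ^ 2 * s2 + C1 / d * g2)) + nN * (C1 / d * s6)) ≤
      K * (ε * (g2 * (s2 / d ^ 2 + g2 / d) + nN * (s6 / d))) := by
    have t : 0 ≤ nN * (s6 / d) := by positivity
    calc _ = 9 * C1 * (ε * (g2 * (s2 / d ^ 2 + g2 / d) + nN * (s6 / d)))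
          - 6 * C1 * ε * (nN * (s6 / d)) := by ring
      _ ≤ 9 * C1 * (ε * (g2 * (s2 / d ^ 2 + g2 / d) + nN * (s6 / d))) := by
        have : 0 ≤ 6 * C1 * ε * (nN * (s6 / d)) := by positivity
        linarith
      _ ≤ _ := by gcongr
  have T3 : 9 * ((C1 / d + 96 * m * (C1 / d ^ 2)) * (3 * (C2 / ε) * nM + nN) * M) ≤
      K * ((1 / d + s / d ^ 2) * (nM / ε + nN) * M) := by
    have hs0 : 0 < s := hr.trans hrs
    have a1 : C1 / d + 96 * m * (C1 / d ^ 2) ≤ 96 * C1 * (1 / d + s / d ^ 2) := by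
      have : m * (C1 / d ^ 2) ≤ s * (C1 / d ^ 2) := by gcongr
      have h : 0 ≤ C1 / d := hK10
      calc _ ≤ 96 * (C1 / d) + 96 * (s * (C1 / d ^ 2)) := by linarith
        _ = _ := by ring
    have a2 : 3 * (C2 / ε) * nM + nN ≤ (3 * C2 + 1) * (nM / ε + nN) := by
      have h1 : 0 ≤ nM / ε := by positivity
      have h2 : 0 ≤ C2 * nN := by positivity
      calc _ = 3 * C2 * (nM / ε) + nN := by ring
        _ ≤ _ := by nlinarith
    calc _ ≤ 9 * ((96 * C1 * (1 / d + s / d ^ 2)) * ((3 * C2 + 1) * (nM / ε + nN)) * M) := by gcongr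
      _ = _ := by rw [hK]; ring
  linarith

/-- The growth relations, over pairs of concentric balls, between the local norms of a solution:
`g` is the `L²` norm of the gradient, `s2`, `s3`, `s6` are the Lebesgue norms of the solution,
`n` and `m` are the `L^{6/5}` norms of the nonlinearity and of the gradient, and `b` is the
`L⁶` norm of the magnetic field. -/
structure GrowthSystem (C : ℝ) (g s2 s3 s6 n m b : ℝ → ℝ) : Prop where
  one_le : 1 ≤ C
  g_nonneg : ∀ r, 0 ≤ g r
  s2_nonneg : ∀ r, 0 ≤ s2 r
  s3_nonneg : ∀ r, 0 ≤ s3 r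
  s6_nonneg : ∀ r, 0 ≤ s6 r
  n_nonneg : ∀ r, 0 ≤ n r
  m_nonneg : ∀ r, 0 ≤ m r
  b_nonneg : ∀ r, 0 ≤ b r
  g_mono : Monotone g
  s2_mono : Monotone s2
  s3_mono : Monotone s3
  n_mono : Monotone n
  m_mono : Monotone m
  b_mono : Monotone b
  n_le : ∀ r, n r ≤ s3 r * g r
  b_le : ∀ r, b r ≤ s6 r
  s2_le : ∀ a r, 1 ≤ a → 0 < r → r ≤ 2 * a ^ 6 → s2 r ≤ C * a ^ 3 * s3 r
  m_le : ∀ a r, 1 ≤ a → 0 < r → r ≤ 2 * a ^ 6 → m r ≤ C * a ^ 6 * g r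
  s3_sq_le : ∀ a r s, 1 ≤ a → 0 < r → r < s → s ≤ 2 * a ^ 6 →
    s3 r ^ 2 ≤ C * (a ^ 4 * g s + (a ^ 7 / (s - r)) ^ 2)
  s3_cube_le : ∀ a r s, 1 ≤ a → 0 < r → r < s → s ≤ 2 * a ^ 6 →
    s3 r ^ 3 ≤ C * (a ^ 4 * n s + (a ^ 7 / (s - r)) ^ 3)
  s6_le : ∀ r s, 0 < r → r < s → s6 r ≤ C * (g s + s2 s / (s - r))
  energy : ∀ a r s ε, 1 ≤ a → 0 < r → r < s → s ≤ 2 * a ^ 6 → 0 < ε → 4 * ε ≤ s - r →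
    g r ^ 2 ≤ C * ((s2 s * g s + s3 s ^ 3 + s3 s * b s * g s) / (s - r)
      + ε * (g s * (s2 s / (s - r) ^ 2 + g s / (s - r)) + n s * (s6 s / (s - r)))
      + (1 / (s - r) + s / (s - r) ^ 2) * (m s / ε + n s) * a ^ 4)
  b_small : ∀ η, 0 < η → ∃ A, ∀ a, A ≤ a → b (2 * a ^ 6) ≤ η * a ^ 8
  n_tail : ∀ r s, 0 < r → 2 * r ≤ s → n s ≤ n (2 * r) + s3 s * √(g s ^ 2 - g r ^ 2)
  m_tail : ∀ a r s, 1 ≤ a → 0 < r → 2 * r ≤ s → s ≤ 2 * a ^ 6 →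
    m s ≤ m (2 * r) + C * a ^ 6 * √(g s ^ 2 - g r ^ 2)

namespace GrowthSystem

variable {C : ℝ} {g s2 s3 s6 n m b : ℝ → ℝ}

theorem norm_bounds (H : GrowthSystem C g s2 s3 s6 n m b) {a r θ e : ℝ} (ha : 1 ≤ a) (hr : 0 < r)
    (hθ : 1 ≤ θ) (he : 1 ≤ e) (hρ : r + 3 * (a ^ 6 / θ) ≤ 2 * a ^ 6)
    (hg : g (r + 3 * (a ^ 6 / θ)) ≤ e ^ 2) :
    s3 (r + 2 * (a ^ 6 / θ)) ≤ 2 * C * θ * a ^ 2 * e ∧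
    s2 (r + 2 * (a ^ 6 / θ)) ≤ 2 * C ^ 2 * θ * a ^ 5 * e ∧
    s6 (r + a ^ 6 / θ) ≤ 4 * C ^ 3 * θ ^ 2 * e ^ 2 := by
  have hC := H.one_le
  have hd : 0 < a ^ 6 / θ := by positivity
  set d := a ^ 6 / θ with hd'
  have hda : a ^ 7 / d = θ * a := by rw [hd']; field_simp
  have h3 : s3 (r + 2 * d) ≤ 2 * C * θ * a ^ 2 * e := by
    have h := H.s3_sq_le a (r + 2 * d) (r + 3 * d) ha (by linarith) (by linarith) hρ
    rw [show r + 3 * d - (r + 2 * d) = d by ring, hda] at h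
    refine le_of_sq_le_sq ?_ (by positivity)
    have h1 : a ^ 4 * g (r + 3 * d) ≤ θ ^ 2 * a ^ 4 * e ^ 2 := by
      calc _ ≤ 1 * a ^ 4 * e ^ 2 := by rw [one_mul]; gcongr
        _ ≤ _ := by gcongr; exact one_le_pow₀ hθ
    have h2 : (θ * a) ^ 2 ≤ θ ^ 2 * a ^ 4 * e ^ 2 := by
      calc _ = θ ^ 2 * a ^ 2 * 1 := by ring
        _ ≤ _ := by gcongr <;> first | exact one_le_pow₀ he | exact ha | norm_num
    calc _ ≤ C * (θ ^ 2 * a ^ 4 * e ^ 2 + θ ^ 2 * a ^ 4 * e ^ 2) := h.trans (by gcongr)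
      _ = 2 * C * 1 * (θ ^ 2 * a ^ 4 * e ^ 2) := by ring
      _ ≤ 2 * C * (2 * C) * (θ ^ 2 * a ^ 4 * e ^ 2) := by gcongr; linarith
      _ = _ := by ring
  have h2 : s2 (r + 2 * d) ≤ 2 * C ^ 2 * θ * a ^ 5 * e := by
    refine (H.s2_le a _ ha (by linarith) (by linarith)).trans ?_
    calc _ ≤ C * a ^ 3 * (2 * C * θ * a ^ 2 * e) := by gcongr
      _ = _ := by ring
  refine ⟨h3, h2, ?_⟩
  have h := H.s6_le (r + d) (r + 2 * d) (by linarith) (by linarith)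
  rw [show r + 2 * d - (r + d) = d by ring] at h
  have hgm : g (r + 2 * d) ≤ e ^ 2 := (H.g_mono (by linarith)).trans hg
  have e1 : s2 (r + 2 * d) / d ≤ 2 * C ^ 2 * θ ^ 2 * e ^ 2 := by
    calc _ ≤ 2 * C ^ 2 * θ * a ^ 5 * e / d := by gcongr
      _ = 2 * C ^ 2 * θ ^ 2 * e * (1 / a) := by rw [hd']; field_simp
      _ ≤ 2 * C ^ 2 * θ ^ 2 * e * e := by
        gcongr; exact ((div_le_one (by positivity)).2 ha).trans he
      _ = _ := by ring
  have e2 : e ^ 2 ≤ 2 * C ^ 2 * θ ^ 2 * e ^ 2 := by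
    have h1 : 1 ≤ C ^ 2 := one_le_pow₀ hC
    have h2 : 1 ≤ θ ^ 2 := one_le_pow₀ hθ
    have h3 : 1 ≤ C ^ 2 * θ ^ 2 := one_le_mul_of_one_le_of_one_le h1 h2
    nlinarith [sq_nonneg e]
  calc _ ≤ C * (2 * C ^ 2 * θ ^ 2 * e ^ 2 + 2 * C ^ 2 * θ ^ 2 * e ^ 2) := by
        refine h.trans ?_; gcongr; exact hgm.trans e2
    _ = _ := by ring


theorem exists_caccioppoli (H : GrowthSystem C g s2 s3 s6 n m b) : ∃ K : ℝ, 1 ≤ K ∧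
    ∀ a r θ e L, 1 ≤ a → 0 < r → 1 ≤ θ → 1 ≤ e → 4 ≤ L → r + 3 * (a ^ 6 / θ) ≤ 2 * a ^ 6 →
    g (r + 3 * (a ^ 6 / θ)) ≤ e ^ 2 → ∃ β, 0 ≤ β ∧ β ≤ b (r + 3 * (a ^ 6 / θ)) ∧
      β ≤ K * θ ^ 2 * e ^ 2 ∧
      g r ^ 2 ≤ K * (e ^ 4 / L + L * θ ^ 8 * e ^ 3 + θ ^ 4 * e ^ 3 * β / a ^ 4) := by
  have hC := H.one_le
  set K := 4 * C ^ 3 with hK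
  have hCK : C ≤ K := by
    have : C ≤ C ^ 3 := le_self_pow₀ hC (by norm_num)
    have : 0 ≤ C ^ 3 := by positivity
    linarith
  have hK1 : 1 ≤ K := hC.trans hCK
  have hK3 : 1 ≤ K ^ 3 := one_le_pow₀ hK1
  have hCK3 : 1 ≤ C * K ^ 3 := one_le_mul_of_one_le_of_one_le hC hK3
  refine ⟨16 * (C * K ^ 3), by linarith, fun a r θ e L ha hr hθ he hL hρ hg => ?_⟩
  obtain ⟨h3, h2, h6⟩ := H.norm_bounds ha hr hθ he hρ hg
  have hd : 0 < a ^ 6 / θ := by positivity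
  set d := a ^ 6 / θ with hd'
  have ha4 : (1 : ℝ) ≤ a ^ 4 := one_le_pow₀ ha
  have hθ4 : (1 : ℝ) ≤ θ ^ 4 := one_le_pow₀ hθ
  have hC2 : 2 * C ≤ K := by
    have : C ≤ C ^ 3 := le_self_pow₀ hC (by norm_num)
    linarith [show 0 ≤ C ^ 3 by positivity]
  have hC22 : 2 * C ^ 2 ≤ K := by
    have : C ^ 2 ≤ C ^ 3 := pow_le_pow_right₀ hC (by norm_num)
    linarith [show 0 ≤ C ^ 3 by positivity]
  have b3 : s3 (r + d) ≤ K * θ * a ^ 2 * e :=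
    (H.s3_mono (by linarith)).trans (h3.trans (by gcongr))
  have b2 : s2 (r + d) ≤ K * θ * a ^ 5 * e :=
    (H.s2_mono (by linarith)).trans (h2.trans (by gcongr))
  have bg : g (r + d) ≤ e ^ 2 := (H.g_mono (by linarith)).trans hg
  have bm : m (r + d) ≤ K * a ^ 6 * e ^ 2 :=
    (H.m_le a _ ha (by linarith) (by linarith)).trans <|
      mul_le_mul (by gcongr) bg (H.g_nonneg _) (by positivity)
  have bn : n (r + d) ≤ K * θ * a ^ 2 * e ^ 3 :=
    (H.n_le _).trans (by
      calc _ ≤ (K * θ * a ^ 2 * e) * e ^ 2 :=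
            mul_le_mul b3 bg (H.g_nonneg _) (by positivity)
        _ = _ := by ring)
  set κ := L * θ ^ 4 * e with hκ
  have hL0 : 0 < L := by linarith
  have hκ0 : 0 < κ := by positivity
  have hε : 4 * (a ^ 4 / κ) ≤ r + d - r := by
    rw [show r + d - r = d by ring, hd', mul_div_assoc', div_le_div_iff₀ hκ0 (by positivity)]
    calc 4 * a ^ 4 * θ = a ^ 4 * (4 * θ * 1) := by ring
      _ ≤ a ^ 6 * (L * θ ^ 4 * e) := by
        gcongr
        · norm_num
        · exact le_self_pow₀ hθ (by norm_num)
  have h := H.energy a r (r + d) (a ^ 4 / κ) ha hr (by linarith) (by linarith) (by positivity) hε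
  rw [show r + d - r = d by ring] at h
  have hs2a : r + d ≤ 2 * a ^ 6 := by linarith
  have n1 := H.g_nonneg (r + d)
  have n2 := H.s2_nonneg (r + d)
  have n3 := H.s3_nonneg (r + d)
  have n4 := H.s6_nonneg (r + d)
  have n5 := H.n_nonneg (r + d)
  have n6 := H.m_nonneg (r + d)
  have n7 := H.b_nonneg (r + d)
  have hsr : 0 < r + d := by linarith
  refine ⟨b (r + d), n7, H.b_mono (by linarith), ((H.b_le _).trans h6).trans ?_, h.trans ?_⟩
  · have : C ^ 3 ≤ C * K ^ 3 := by
      have h1 : C ^ 3 ≤ K ^ 3 := by gcongr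
      have h2 : 0 ≤ K ^ 3 := by positivity
      nlinarith
    gcongr
    norm_num
  clear h
  have h6' : s6 (r + d) ≤ K * θ ^ 2 * e ^ 2 := h6
  clear h6 h2 h3
  generalize g (r + d) = g1 at *
  generalize s2 (r + d) = s2 at *
  generalize s3 (r + d) = s3 at *
  generalize s6 (r + d) = s6 at *
  generalize n (r + d) = n at *
  generalize m (r + d) = m at *
  generalize b (r + d) = b at *
  have T1 : (s2 * g1 + s3 ^ 3 + s3 * b * g1) / d ≤
      K ^ 3 * (2 * (L * θ ^ 8 * e ^ 3) + θ ^ 4 * e ^ 3 * b / a ^ 4) := by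
    calc _ ≤ ((K * θ * a ^ 5 * e) * e ^ 2 + (K * θ * a ^ 2 * e) ^ 3
          + (K * θ * a ^ 2 * e) * b * e ^ 2) / d := by gcongr
      _ = K * (1 * θ ^ 2 * e ^ 3) * (1 / a) + K ^ 3 * (1 * θ ^ 4 * e ^ 3)
          + K * (θ ^ 2 * e ^ 3 * b / a ^ 4) := by rw [hd']; field_simp
      _ ≤ K ^ 3 * (L * θ ^ 8 * e ^ 3) * 1 + K ^ 3 * (L * θ ^ 8 * e ^ 3)
          + K ^ 3 * (θ ^ 4 * e ^ 3 * b / a ^ 4) := by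
        gcongr
        · exact le_self_pow₀ hK1 (by norm_num)
        · linarith
        · norm_num
        · exact (div_le_one (by positivity)).2 ha
        · linarith
        · norm_num
        · exact le_self_pow₀ hK1 (by norm_num)
        · norm_num
      _ = _ := by ring
  have T2 : a ^ 4 / κ * (g1 * (s2 / d ^ 2 + g1 / d) + n * (s6 / d)) ≤
      K ^ 3 * (3 * (e ^ 4 / L)) := by
    calc _ ≤ a ^ 4 / κ * (e ^ 2 * (K * θ * a ^ 5 * e / d ^ 2 + e ^ 2 / d)
          + K * θ * a ^ 2 * e ^ 3 * (K * θ ^ 2 * e ^ 2 / d)) := by gcongr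
      _ = (K * (e ^ 2 * θ ^ 3) * (1 / a ^ 3) + (1 * (e ^ 3 * θ) * (1 / a ^ 2))
          + K ^ 2 * (e ^ 4 * θ ^ 4)) / (L * θ ^ 4) := by
          rw [hd', hκ]; field_simp
      _ ≤ (K ^ 3 * (e ^ 4 * θ ^ 4) * 1 + (K ^ 3 * (e ^ 4 * θ ^ 4) * 1)
          + K ^ 3 * (e ^ 4 * θ ^ 4)) / (L * θ ^ 4) := by
          gcongr <;> first
            | exact le_self_pow₀ hK1 (by norm_num)
            | exact hK3
            | (norm_num; done)
            | exact (div_le_one (by positivity)).2 (one_le_pow₀ ha)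
            | exact he
            | exact hθ
            | exact le_self_pow₀ hθ (by norm_num)
      _ = _ := by field_simp; ring
  have T3 : (1 / d + (r + d) / d ^ 2) * (m / (a ^ 4 / κ) + n) * a ^ 4 ≤
      K ^ 3 * (6 * (L * θ ^ 8 * e ^ 3)) := by
    calc _ ≤ (1 / d + 2 * a ^ 6 / d ^ 2) * (K * a ^ 6 * e ^ 2 / (a ^ 4 / κ)
            + K * θ * a ^ 2 * e ^ 3) * a ^ 4 := by gcongr
      _ = (1 * θ + 2 * θ ^ 2) * (K * (L * θ ^ 4 * e ^ 3) + K * (1 * θ * e ^ 3)) := by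
          rw [hd', hκ]; field_simp
      _ ≤ (1 * θ ^ 4 + 2 * θ ^ 4) * (K ^ 3 * (L * θ ^ 4 * e ^ 3)
          + K ^ 3 * (L * θ ^ 4 * e ^ 3)) := by
          gcongr <;> first
            | exact le_self_pow₀ hK1 (by norm_num)
            | exact le_self_pow₀ hθ (by norm_num)
            | exact hθ
            | (norm_num; done)
            | linarith
      _ = _ := by ring
  have p1 : 0 ≤ e ^ 4 / L := by positivity
  have p2 : 0 ≤ θ ^ 4 * e ^ 3 * b / a ^ 4 := by positivity
  have p3 : 0 ≤ L * θ ^ 8 * e ^ 3 := by positivity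
  have hCK0 : 0 ≤ C * K ^ 3 := by positivity
  calc _ ≤ C * (K ^ 3 * (2 * (L * θ ^ 8 * e ^ 3) + θ ^ 4 * e ^ 3 * b / a ^ 4)
        + K ^ 3 * (3 * (e ^ 4 / L)) + K ^ 3 * (6 * (L * θ ^ 8 * e ^ 3))) := by gcongr
    _ = C * K ^ 3 * (3 * (e ^ 4 / L) + 8 * (L * θ ^ 8 * e ^ 3) + θ ^ 4 * e ^ 3 * b / a ^ 4) := by
      ring
    _ ≤ C * K ^ 3 * (16 * (e ^ 4 / L + L * θ ^ 8 * e ^ 3 + θ ^ 4 * e ^ 3 * b / a ^ 4)) := by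
      gcongr; linarith
    _ = _ := by ring

end GrowthSystem

theorem le_of_geometric_iteration {f : ℕ → ℝ} {δ K Q M P : ℝ} (hδ : 0 ≤ δ) (hK : 0 ≤ K)
    (hQ : 0 ≤ Q) (hM : 0 ≤ M) (hP : 0 ≤ P) (hf : ∀ i, f i ≤ δ * f (i + 1) + K * Q ^ i)
    (hfM : ∀ i, f i ≤ M * P ^ i) (hδQ : δ * Q ≤ 1 / 2) (hδP : δ * P ≤ 1 / 2) : f 0 ≤ 2 * K := by
  have h1 : ∀ N, f 0 ≤ δ ^ N * f N + K * (2 - 2 * (1 / 2) ^ N) := fun N => by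
    induction N with
    | zero => simp
    | succ N ih =>
      have a1 : (δ * Q) ^ N ≤ (1 / 2) ^ N := pow_le_pow_left₀ (by positivity) hδQ N
      have a2 : δ ^ N * f N ≤ δ ^ N * (δ * f (N + 1) + K * Q ^ N) := by gcongr; exact hf N
      have a3 : K * (δ * Q) ^ N ≤ K * (1 / 2) ^ N := by gcongr
      rw [mul_pow] at a3
      rw [pow_succ, pow_succ]
      linarith
  have h2 : ∀ N, f 0 ≤ M * (1 / 2) ^ N + 2 * K := fun N => by
    have a1 : (δ * P) ^ N ≤ (1 / 2) ^ N := pow_le_pow_left₀ (by positivity) hδP N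
    have a2 : δ ^ N * f N ≤ δ ^ N * (M * P ^ N) := by gcongr; exact hfM N
    have a3 : M * (δ * P) ^ N ≤ M * (1 / 2) ^ N := by gcongr
    have a4 : 0 ≤ K * (1 / 2) ^ N := by positivity
    rw [mul_pow] at a3
    linarith [h1 N]
  have h3 : Filter.Tendsto (fun N : ℕ => M * (1 / 2 : ℝ) ^ N + 2 * K) Filter.atTop
      (nhds (M * 0 + 2 * K)) :=
    ((tendsto_pow_atTop_nhds_zero_of_lt_one (by norm_num) (by norm_num)).const_mul M).add_const _
  simpa using ge_of_tendsto' h3 h2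

theorem mul_cube_le {X δ e : ℝ} (hX : 0 ≤ X) (hδ : 0 < δ) (he : 0 ≤ e) :
    X * e ^ 3 ≤ δ * e ^ 4 + X ^ 4 / δ ^ 3 := by
  rcases le_total X (δ * e) with h | h
  · have : X * e ^ 3 ≤ δ * e * e ^ 3 := by gcongr
    have : 0 ≤ X ^ 4 / δ ^ 3 := by positivity
    nlinarith
  · have h1 : e ≤ X / δ := by rw [le_div_iff₀ hδ]; linarith
    have h2 : X * e ^ 3 ≤ X * (X / δ) ^ 3 := by gcongr
    have h3 : X * (X / δ) ^ 3 = X ^ 4 / δ ^ 3 := by field_simp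
    have : 0 ≤ δ * e ^ 4 := by positivity
    linarith

theorem exists_fourth_root (y : ℝ) : ∃ e : ℝ, 1 ≤ e ∧ y ≤ e ^ 2 ∧ e ^ 4 = 1 + y ^ 2 := by
  have h2 : √(√(1 + y ^ 2)) ^ 2 = √(1 + y ^ 2) := Real.sq_sqrt (Real.sqrt_nonneg _)
  refine ⟨√(√(1 + y ^ 2)), ?_, ?_, ?_⟩
  · refine Real.one_le_sqrt.2 (Real.one_le_sqrt.2 ?_)
    nlinarith [sq_nonneg y]
  · rw [h2]
    exact Real.le_sqrt_of_sq_le (by linarith)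
  · rw [show 4 = 2 * 2 by norm_num, pow_mul, h2, Real.sq_sqrt (by positivity)]

theorem exists_sixth_root {t : ℝ} (ht : 1 ≤ t) : ∃ a : ℝ, 1 ≤ a ∧ a ^ 6 = t := by
  refine ⟨t ^ (1 / 6 : ℝ), Real.one_le_rpow ht (by norm_num), ?_⟩
  rw [← Real.rpow_natCast, ← Real.rpow_mul (by linarith)]
  norm_num

namespace GrowthSystem

variable {C : ℝ} {g s2 s3 s6 n m b : ℝ → ℝ}

theorem exists_gradient_growth (H : GrowthSystem C g s2 s3 s6 n m b) :
    ∃ K : ℝ, 0 ≤ K ∧ ∀ a, 1 ≤ a → g (a ^ 6) ^ 2 ≤ K * a ^ 16 := by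
  obtain ⟨K, hK, HK⟩ := H.exists_caccioppoli
  obtain ⟨Kb, hKb, Hb⟩ : ∃ Kb, 0 ≤ Kb ∧ ∀ a, 1 ≤ a → b (2 * a ^ 6) ≤ Kb * a ^ 8 := by
    obtain ⟨A, hA⟩ := H.b_small 1 one_pos
    have hb := H.b_nonneg (2 * A ^ 6)
    refine ⟨1 + b (2 * A ^ 6), by linarith, fun a ha => ?_⟩
    have ha8 : 1 ≤ a ^ 8 := one_le_pow₀ ha
    rcases le_total A a with h | h
    · nlinarith [hA a h]
    · have : b (2 * a ^ 6) ≤ b (2 * A ^ 6) := H.b_mono (by gcongr)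
      nlinarith
  set δ : ℝ := 1 / 2 ^ 34 with hδ
  have hδ0 : 0 < δ := by positivity
  set L := K / δ with hL
  have hL4 : 4 ≤ L := by
    rw [hL, le_div_iff₀ hδ0]
    have : 4 * δ ≤ 1 := by rw [hδ]; norm_num
    linarith
  set X := (K * (L + Kb)) ^ 4 / δ ^ 3 with hX
  have hX0 : 0 ≤ X := by positivity
  have step : ∀ a r θ, 1 ≤ a → 0 < r → 1 ≤ θ → r + 3 * (a ^ 6 / θ) ≤ 2 * a ^ 6 →
      g r ^ 2 ≤ 2 * δ * g (r + 3 * (a ^ 6 / θ)) ^ 2 + (2 * δ + X) * (θ ^ 32 * a ^ 16) := by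
    intro a r θ ha hr hθ hρ
    obtain ⟨e, he1, he2, he4⟩ := exists_fourth_root (g (r + 3 * (a ^ 6 / θ)))
    obtain ⟨β, hβ0, hβb, -, hβ⟩ := HK a r θ e L ha hr hθ he1 hL4 hρ he2
    have hβ' : β ≤ Kb * a ^ 8 := hβb.trans ((H.b_mono hρ).trans (Hb a ha))
    have t1 : K * (e ^ 4 / L) = δ * e ^ 4 := by
      rw [hL]; field_simp
    have t2 : L * θ ^ 8 * e ^ 3 ≤ L * θ ^ 8 * a ^ 4 * e ^ 3 := by
      calc _ = L * θ ^ 8 * 1 * e ^ 3 := by ring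
        _ ≤ _ := by gcongr; exact one_le_pow₀ ha
    have t3 : θ ^ 4 * e ^ 3 * β / a ^ 4 ≤ Kb * θ ^ 8 * a ^ 4 * e ^ 3 := by
      calc _ ≤ θ ^ 8 * e ^ 3 * (Kb * a ^ 8) / a ^ 4 := by gcongr; norm_num
        _ = _ := by field_simp
    have t4 := mul_cube_le (X := K * (L + Kb) * θ ^ 8 * a ^ 4) (by positivity) hδ0
      (by linarith : 0 ≤ e)
    have t5 : (K * (L + Kb) * θ ^ 8 * a ^ 4) ^ 4 / δ ^ 3 = X * (θ ^ 32 * a ^ 16) := by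
      rw [hX]; ring
    have t6 : 1 ≤ θ ^ 32 * a ^ 16 :=
      one_le_mul_of_one_le_of_one_le (one_le_pow₀ hθ) (one_le_pow₀ ha)
    have t7 : K * (e ^ 4 / L + L * θ ^ 8 * e ^ 3 + θ ^ 4 * e ^ 3 * β / a ^ 4) ≤
        K * (e ^ 4 / L + L * θ ^ 8 * a ^ 4 * e ^ 3 + Kb * θ ^ 8 * a ^ 4 * e ^ 3) := by gcongr
    have t8 : 2 * δ * 1 ≤ 2 * δ * (θ ^ 32 * a ^ 16) := by gcongr
    rw [t5] at t4
    have t9 : K * (e ^ 4 / L + L * θ ^ 8 * a ^ 4 * e ^ 3 + Kb * θ ^ 8 * a ^ 4 * e ^ 3)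
        = δ * e ^ 4 + K * (L + Kb) * θ ^ 8 * a ^ 4 * e ^ 3 := by rw [← t1]; ring
    rw [t9] at t7
    replace t7 := hβ.trans t7
    rw [he4] at t4 t7
    generalize g (r + 3 * (a ^ 6 / θ)) ^ 2 = G at *
    generalize θ ^ 32 * a ^ 16 = Y at *
    linarith
  refine ⟨2 * ((2 * δ + X) * 6 ^ 32), by positivity, fun a ha => ?_⟩
  have ha6 : 0 < a ^ 6 := by positivity
  have h2i : ∀ i : ℕ, (1 : ℝ) ≤ 2 ^ i := fun i => one_le_pow₀ (by norm_num)
  have hri : ∀ i : ℕ, a ^ 6 / 2 ^ i ≤ a ^ 6 := fun i => div_le_self ha6.le (h2i i)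
  have key := le_of_geometric_iteration (f := fun i => g (2 * a ^ 6 - a ^ 6 / 2 ^ i) ^ 2)
    (δ := 2 * δ) (K := (2 * δ + X) * 6 ^ 32 * a ^ 16) (Q := 2 ^ 32) (M := g (2 * a ^ 6) ^ 2)
    (P := 1) (by positivity) (by positivity) (by positivity) (by positivity) (by norm_num)
    (fun i => by
      have h := step a (2 * a ^ 6 - a ^ 6 / 2 ^ i) (6 * 2 ^ i) ha (by linarith [hri i])
        (by linarith [h2i i])
      have e1 : 2 * a ^ 6 - a ^ 6 / 2 ^ i + 3 * (a ^ 6 / (6 * 2 ^ i)) =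
          2 * a ^ 6 - a ^ 6 / 2 ^ (i + 1) := by
        field_simp; ring
      rw [e1] at h
      have h' := h (by have : 0 ≤ a ^ 6 / 2 ^ (i + 1) := by positivity
                       linarith)
      refine h'.trans_eq ?_
      rw [mul_pow, ← pow_mul, ← pow_mul, mul_comm i 32]
      ring)
    (fun i => by
      rw [one_pow, mul_one]
      refine pow_le_pow_left₀ (H.g_nonneg _) (H.g_mono ?_) 2
      have : 0 ≤ a ^ 6 / 2 ^ i := by positivity
      linarith)
    (by rw [hδ]; norm_num) (by rw [hδ]; norm_num)
  have e2 : 2 * a ^ 6 - a ^ 6 / 2 ^ 0 = a ^ 6 := by rw [pow_zero, div_one]; ring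
  simp only [e2] at key
  linarith

theorem exists_gradient_bound (H : GrowthSystem C g s2 s3 s6 n m b) :
    ∃ M : ℝ, 0 ≤ M ∧ ∀ r, g r ^ 2 ≤ M := by
  obtain ⟨K1, hK1, HK1⟩ := H.exists_gradient_growth
  obtain ⟨K, hK, HK⟩ := H.exists_caccioppoli
  have hpoly : ∀ t, 1 ≤ t → g t ^ 2 ≤ K1 * t ^ 3 := fun t ht => by
    obtain ⟨a, ha, rfl⟩ := exists_sixth_root ht
    refine (HK1 a ha).trans ?_
    rw [← pow_mul]
    gcongr
    norm_num
  set δ : ℝ := 1 / 48 with hδ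
  have hδ0 : 0 < δ := by norm_num [hδ]
  set L := K / δ with hL
  have hL4 : 4 ≤ L := by
    rw [hL, le_div_iff₀ hδ0, hδ]; linarith
  set σ := δ / (81 * K) with hσ
  have hσ0 : 0 < σ := by positivity
  obtain ⟨A, hA⟩ := H.b_small (σ ^ 2 / (9 * K)) (by positivity)
  set X := (K * L * 3 ^ 8) ^ 4 / δ ^ 3 with hX
  have hX0 : 0 ≤ X := by positivity
  have step : ∀ a, 1 ≤ a → A ≤ a → g (a ^ 6) ^ 2 ≤ 1 / 16 * g (2 * a ^ 6) ^ 2 + (1 / 16 + X) := by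
    intro a ha haA
    have e1 : a ^ 6 + 3 * (a ^ 6 / 3) = 2 * a ^ 6 := by ring
    obtain ⟨e, he1, he2, he4⟩ := exists_fourth_root (g (2 * a ^ 6))
    have he0 : 0 ≤ e := by linarith
    obtain ⟨β, hβ0, hβb, hβe, hβ⟩ := HK a (a ^ 6) 3 e L ha (by positivity) (by norm_num) he1 hL4
      e1.le (by rwa [e1])
    rw [e1] at hβb
    have hβ1 := hβb.trans (hA a haA)
    have hβσ : β ≤ σ * a ^ 4 * e := by
      refine le_of_sq_le_sq ?_ (by positivity)
      calc β ^ 2 = β * β := sq β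
        _ ≤ (σ ^ 2 / (9 * K) * a ^ 8) * (K * 3 ^ 2 * e ^ 2) :=
          mul_le_mul hβ1 hβe hβ0 (by positivity)
        _ = _ := by field_simp; ring
    have t1 : K * (e ^ 4 / L) = δ * e ^ 4 := by
      rw [hL]; field_simp
    have t2 : K * (3 ^ 4 * e ^ 3 * β / a ^ 4) ≤ δ * e ^ 4 := by
      calc _ ≤ K * (3 ^ 4 * e ^ 3 * (σ * a ^ 4 * e) / a ^ 4) := by gcongr
        _ = _ := by rw [hσ]; field_simp; ring
    have t4 := mul_cube_le (X := K * L * 3 ^ 8) (by positivity) hδ0 he0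
    have h3 : 3 * δ = 1 / 16 := by rw [hδ]; norm_num
    have h4 : 3 * δ * e ^ 4 = 1 / 16 * (1 + g (2 * a ^ 6) ^ 2) := by rw [he4, h3]
    rw [← hX] at t4
    have t5 : K * (e ^ 4 / L + L * 3 ^ 8 * e ^ 3 + 3 ^ 4 * e ^ 3 * β / a ^ 4) =
        K * (e ^ 4 / L) + K * L * 3 ^ 8 * e ^ 3 + K * (3 ^ 4 * e ^ 3 * β / a ^ 4) := by ring
    rw [t5, t1] at hβ
    calc _ ≤ δ * e ^ 4 + (δ * e ^ 4 + X) + δ * e ^ 4 := hβ.trans (add_le_add (add_le_add le_rfl t4) t2)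
      _ = 3 * δ * e ^ 4 + X := by ring
      _ = _ := by rw [h4]; ring
  set T := (max 1 A) ^ 6 with hT
  have hT1 : 1 ≤ T := one_le_pow₀ (le_max_left _ _)
  have stepT : ∀ t, T ≤ t → g t ^ 2 ≤ 1 / 16 * g (2 * t) ^ 2 + (1 / 16 + X) := fun t ht => by
    obtain ⟨a, ha, rfl⟩ := exists_sixth_root (hT1.trans ht)
    refine step a ha ((le_max_right 1 A).trans ?_)
    exact (pow_le_pow_iff_left₀ (by positivity) (by positivity) (by norm_num)).1 ht
  have bound : ∀ t, T ≤ t → g t ^ 2 ≤ 2 * (1 / 16 + X) := fun t ht => by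
    have ht0 : 0 < t := by linarith
    have h2i : ∀ i : ℕ, t ≤ 2 ^ i * t := fun i =>
      le_mul_of_one_le_left ht0.le (one_le_pow₀ (by norm_num))
    have key := le_of_geometric_iteration (f := fun i => g (2 ^ i * t) ^ 2)
      (δ := 1 / 16) (K := 1 / 16 + X) (Q := 1) (M := K1 * t ^ 3) (P := 8) (by norm_num)
      (by positivity) (by norm_num) (by positivity) (by norm_num)
      (fun i => by
        have h := stepT (2 ^ i * t) (ht.trans (h2i i))
        simp only [one_pow, mul_one]
        rwa [← mul_assoc, ← pow_succ'] at h)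
      (fun i => by
        refine (hpoly _ (hT1.trans (ht.trans (h2i i)))).trans_eq ?_
        rw [mul_pow, ← pow_mul, mul_comm i 3, pow_mul]
        norm_num
        ring)
      (by norm_num) (by norm_num)
    simpa using key
  refine ⟨2 * (1 / 16 + X), by positivity, fun r => ?_⟩
  exact (pow_le_pow_left₀ (H.g_nonneg _) (H.g_mono (le_max_left r T)) 2).trans
    (bound _ (le_max_right _ _))

end GrowthSystem

namespace GrowthSystem

variable {C : ℝ} {g s2 s3 s6 n m b : ℝ → ℝ}

theorem gradient_sq_le_of_small (H : GrowthSystem C g s2 s3 s6 n m b) {a s W δ : ℝ} (ha : 1 ≤ a)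
    (hs : s = 4 / 3 * a ^ 6) (hW : 1 ≤ W) (hδ : δ ≤ 1) (haδ : 1 ≤ δ * a)
    (h2 : s2 s ≤ W * δ * a ^ 5) (h3 : s3 s ≤ W * δ * a ^ 2) (h6 : s6 s ≤ W) (hg : g s ≤ W)
    (hn : n s ≤ W * δ * a ^ 2) (hm : m s ≤ W * δ * a ^ 6) :
    g (a ^ 6) ^ 2 ≤ 300 * C * W ^ 3 * δ := by
  have hC := H.one_le
  have ha0 : 0 < a := by linarith
  have hδ0 : 0 < δ := pos_of_mul_pos_left (by linarith) ha0.le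
  have ha6 : (1 : ℝ) ≤ a ^ 6 := one_le_pow₀ ha
  have ha4 : a ^ 4 ≤ a ^ 6 := pow_le_pow_right₀ ha (by norm_num)
  have hd : s - a ^ 6 = a ^ 6 / 3 := by rw [hs]; ring
  have h := H.energy a (a ^ 6) s (a ^ 4 / 12) ha (by positivity) (by linarith) (by linarith)
    (by positivity) (by linarith)
  have hb := (H.b_le s).trans h6
  rw [hd] at h
  refine h.trans ?_
  clear h
  have n1 := H.g_nonneg s
  have n2 := H.s2_nonneg s
  have n3 := H.s3_nonneg s
  have n4 := H.s6_nonneg s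
  have n5 := H.n_nonneg s
  have n6 := H.m_nonneg s
  have n7 := H.b_nonneg s
  generalize g s = g1 at *
  generalize s2 s = s2 at *
  generalize s3 s = s3 at *
  generalize s6 s = s6 at *
  generalize n s = n at *
  generalize m s = m at *
  generalize b s = b at *
  have hs0 : 0 < s := by rw [hs]; positivity
  have hWW : W ≤ W ^ 3 := le_self_pow₀ hW (by norm_num)
  have hW2 : W ^ 2 ≤ W ^ 3 := pow_le_pow_right₀ hW (by norm_num)
  have inv1 : 1 / a ≤ 1 := (div_le_one ha0).2 ha
  have invk : ∀ k : ℕ, 1 / a ^ k ≤ 1 := fun k => (div_le_one (by positivity)).2 (one_le_pow₀ ha)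
  have inv2 : 1 / a ^ 2 ≤ δ := by
    rw [div_le_iff₀ (by positivity)]
    nlinarith
  have T1 : (s2 * g1 + s3 ^ 3 + s3 * b * g1) / (a ^ 6 / 3) ≤ 9 * (W ^ 3 * δ) := by
    calc _ ≤ ((W * δ * a ^ 5) * W + (W * δ * a ^ 2) ^ 3 + (W * δ * a ^ 2) * W * W) / (a ^ 6 / 3) := by
          gcongr
      _ = 3 * (W ^ 2 * δ * (1 / a ^ 1) + W ^ 3 * δ * δ ^ 2 + W ^ 3 * δ * (1 / a ^ 4)) := by field_simp
      _ ≤ 3 * (W ^ 3 * δ * 1 + W ^ 3 * δ * 1 + W ^ 3 * δ * 1) := by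
          gcongr <;> first | exact invk _ | exact pow_le_one₀ hδ0.le hδ
      _ = _ := by ring
  have T2 : a ^ 4 / 12 * (g1 * (s2 / (a ^ 6 / 3) ^ 2 + g1 / (a ^ 6 / 3)) + n * (s6 / (a ^ 6 / 3))) ≤
      9 * (W ^ 3 * δ) := by
    calc _ ≤ a ^ 4 / 12 * (W * (W * δ * a ^ 5 / (a ^ 6 / 3) ^ 2 + W / (a ^ 6 / 3))
          + W * δ * a ^ 2 * (W / (a ^ 6 / 3))) := by gcongr
      _ = 1 / 12 * (9 * (W ^ 2 * δ * (1 / a ^ 3)) + 3 * (W ^ 2 * (1 / a ^ 2)) + 3 * (W ^ 2 * δ)) := by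
          field_simp
          ring
      _ ≤ 1 / 12 * (9 * (W ^ 3 * δ * 1) + 3 * (W ^ 3 * δ) + 3 * (W ^ 3 * δ)) := by
          gcongr
          exact invk _
      _ ≤ _ := by
        have : 0 ≤ W ^ 3 * δ := by positivity
        linarith
  have T3 : (1 / (a ^ 6 / 3) + s / (a ^ 6 / 3) ^ 2) * (m / (a ^ 4 / 12) + n) * a ^ 4 ≤
      195 * (W ^ 3 * δ) := by
    calc _ ≤ (1 / (a ^ 6 / 3) + s / (a ^ 6 / 3) ^ 2) * (W * δ * a ^ 6 / (a ^ 4 / 12)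
          + W * δ * a ^ 2) * a ^ 4 := by gcongr
      _ = 195 * (W * δ) := by rw [hs]; field_simp; ring
      _ ≤ _ := by gcongr
  calc _ ≤ C * (9 * (W ^ 3 * δ) + 9 * (W ^ 3 * δ) + 195 * (W ^ 3 * δ)) := by gcongr
    _ = C * (W ^ 3 * δ) * 213 := by ring
    _ ≤ C * (W ^ 3 * δ) * 300 := by gcongr; norm_num
    _ = _ := by ring

theorem exists_norm_growth (H : GrowthSystem C g s2 s3 s6 n m b) :
    ∃ W : ℝ, 1 ≤ W ∧ (∀ r, g r ≤ W) ∧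
      ∀ a, 1 ≤ a → s3 (2 * a ^ 6) ≤ W * a ^ 2 ∧ s6 (4 / 3 * a ^ 6) ≤ W := by
  have hC := H.one_le
  obtain ⟨M, hM, hgM⟩ := H.exists_gradient_bound
  obtain ⟨e, he1, he2, -⟩ := exists_fourth_root (1 + M)
  have hg : ∀ r, g r ≤ e ^ 2 := fun r => by nlinarith [hgM r]
  have hCe : 1 ≤ C ^ 3 * e ^ 2 := one_le_mul_of_one_le_of_one_le (one_le_pow₀ hC) (one_le_pow₀ he1)
  have b1 : e ^ 2 ≤ C ^ 3 * e ^ 2 := le_mul_of_one_le_left (by positivity) (one_le_pow₀ hC)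
  have b2 : C * e ≤ C ^ 3 * e ^ 2 := by
    gcongr
    · exact le_self_pow₀ hC (by norm_num)
    · exact le_self_pow₀ he1 (by norm_num)
  refine ⟨36 * (C ^ 3 * e ^ 2), by linarith, fun r => (hg r).trans (by linarith),
    fun a ha => ⟨?_, ?_⟩⟩
  · have h := (H.norm_bounds (a := 2 * a) (r := a ^ 6) (θ := 3) (by linarith) (by positivity)
      (by norm_num) he1 (by ring_nf; nlinarith [show 0 < a ^ 6 by positivity]) (hg _)).1
    refine (H.s3_mono ?_).trans (h.trans ?_)
    · ring_nf
      nlinarith [show 0 < a ^ 6 by positivity]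
    · calc 2 * C * 3 * (2 * a) ^ 2 * e = 24 * (C * e) * a ^ 2 := by ring
        _ ≤ _ := by gcongr; norm_num
  · have h := (H.norm_bounds (a := a) (r := a ^ 6) (θ := 3) ha (by positivity)
      (by norm_num) he1 (by linarith) (hg _)).2.2
    rw [show a ^ 6 + a ^ 6 / 3 = 4 / 3 * a ^ 6 by ring] at h
    linarith

theorem exists_decay (H : GrowthSystem C g s2 s3 s6 n m b) :
    ∃ Z : ℝ, ∀ δ, 0 < δ → δ ≤ 1 → ∃ A, ∀ a, A ≤ a → g (a ^ 6) ^ 2 ≤ Z * δ := by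
  have hC := H.one_le
  obtain ⟨W, hW, hgW, hWa⟩ := H.exists_norm_growth
  have hW2 : 1 ≤ C * W := one_le_mul_of_one_le_of_one_le hC hW
  set V := 28 * C ^ 2 * W with hV
  have hV1 : C * W ≤ V := by
    rw [hV]; nlinarith
  have hV2 : W ≤ V := by nlinarith
  have hV3 : 1 ≤ V := by linarith
  refine ⟨300 * C * (C * V) ^ 3, fun δ hδ hδ1 => ?_⟩
  obtain ⟨R, hR1, hR⟩ : ∃ R, 1 ≤ R ∧ ∀ s, g s ^ 2 - g R ^ 2 ≤ (δ ^ 3) ^ 2 := by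
    have hbdd : BddAbove (Set.range fun r => g r ^ 2) :=
      ⟨W ^ 2, by rintro _ ⟨r, rfl⟩; exact pow_le_pow_left₀ (H.g_nonneg r) (hgW r) 2⟩
    have hpos : 0 < (δ ^ 3) ^ 2 := by positivity
    obtain ⟨r, hr⟩ := exists_lt_of_lt_ciSup (f := fun r => g r ^ 2)
      (b := (⨆ r, g r ^ 2) - (δ ^ 3) ^ 2) (by linarith)
    refine ⟨max r 1, le_max_right _ _, fun s => ?_⟩
    have h1 := le_ciSup hbdd s
    have h2 : g r ^ 2 ≤ g (max r 1) ^ 2 :=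
      pow_le_pow_left₀ (H.g_nonneg _) (H.g_mono (le_max_left _ _)) 2
    linarith
  have hsq : ∀ s, √(g s ^ 2 - g R ^ 2) ≤ δ ^ 3 := fun s =>
    Real.sqrt_le_iff.2 ⟨by positivity, hR s⟩
  have hn0 := H.n_nonneg (2 * R)
  have hm0 := H.m_nonneg (2 * R)
  refine ⟨R + (1 + n (2 * R) + m (2 * R)) / δ ^ 3, fun a hA => ?_⟩
  have hq0 : 0 ≤ (1 + n (2 * R) + m (2 * R)) / δ ^ 3 := by positivity
  have haR : R ≤ a := by linarith
  have ha : 1 ≤ a := by linarith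
  have ha0 : 0 < a := by linarith
  have hqa : 1 + n (2 * R) + m (2 * R) ≤ δ ^ 3 * a := by
    have : (1 + n (2 * R) + m (2 * R)) / δ ^ 3 ≤ a := by linarith
    rw [div_le_iff₀ (by positivity)] at this
    linarith
  have hδ3 : δ ^ 3 ≤ δ := pow_le_of_le_one hδ.le hδ1 (by norm_num)
  have hda : 1 ≤ δ ^ 3 * a := by linarith
  have haa : ∀ k : ℕ, k ≠ 0 → a ≤ a ^ k := fun k hk => le_self_pow₀ ha hk
  have hRa : 2 * R ≤ 2 * a ^ 6 := by linarith [haa 6 (by norm_num)]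
  have hn : n (2 * a ^ 6) ≤ 2 * W * δ ^ 3 * a ^ 2 := by
    have h := H.n_tail R (2 * a ^ 6) (by linarith) hRa
    have h1 : s3 (2 * a ^ 6) * √(g (2 * a ^ 6) ^ 2 - g R ^ 2) ≤ W * a ^ 2 * δ ^ 3 :=
      mul_le_mul (hWa a ha).1 (hsq _) (Real.sqrt_nonneg _) (by positivity)
    have h2 : δ ^ 3 * a ≤ δ ^ 3 * a ^ 2 := by gcongr; exact haa 2 (by norm_num)
    have h3 : 0 ≤ δ ^ 3 * a ^ 2 := by positivity
    nlinarith
  have hm : m (2 * a ^ 6) ≤ 2 * C * δ ^ 3 * a ^ 6 := by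
    have h := H.m_tail a R (2 * a ^ 6) ha (by linarith) hRa le_rfl
    have h1 : C * a ^ 6 * √(g (2 * a ^ 6) ^ 2 - g R ^ 2) ≤ C * a ^ 6 * δ ^ 3 := by
      gcongr; exact hsq _
    have h2 : δ ^ 3 * a ≤ δ ^ 3 * a ^ 6 := by gcongr; exact haa 6 (by norm_num)
    have h3 : 0 ≤ δ ^ 3 * a ^ 6 := by positivity
    nlinarith
  have ha6 : 0 < a ^ 6 := by positivity
  have hs4 : 4 / 3 * a ^ 6 ≤ 2 * a ^ 6 := by linarith
  have hs3 : s3 (4 / 3 * a ^ 6) ≤ V * δ * a ^ 2 := by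
    have h := H.s3_cube_le a (5 / 3 * a ^ 6) (2 * a ^ 6) ha (by positivity) (by linarith) le_rfl
    rw [show a ^ 7 / (2 * a ^ 6 - 5 / 3 * a ^ 6) = 3 * a by
      rw [show 2 * a ^ 6 - 5 / 3 * a ^ 6 = a ^ 6 / 3 by ring]; field_simp] at h
    have h0 : s3 (4 / 3 * a ^ 6) ≤ s3 (5 / 3 * a ^ 6) := H.s3_mono (by linarith)
    refine h0.trans ((pow_le_pow_iff_left₀ (H.s3_nonneg _) (by positivity)
      (by norm_num : (3 : ℕ) ≠ 0)).1 (h.trans ?_))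
    have h1 : (3 * a) ^ 3 ≤ 27 * W * (δ ^ 3 * a ^ 6) := by
      have : a ^ 3 * 1 ≤ a ^ 3 * (δ ^ 3 * a * a ^ 2) := by
        gcongr
        exact one_le_mul_of_one_le_of_one_le hda (one_le_pow₀ ha)
      calc (3 * a) ^ 3 = 27 * 1 * (a ^ 3 * 1) := by ring
        _ ≤ 27 * W * (a ^ 3 * (δ ^ 3 * a * a ^ 2)) := by gcongr
        _ = _ := by ring
    have hV4 : 29 * (C * W) ≤ V ^ 3 := by
      have e1 : V ≤ V ^ 2 := le_self_pow₀ hV3 (by norm_num)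
      have e2 : 28 * (C * W) ≤ V := by
        rw [hV]; nlinarith
      have e3 : 2 ≤ V := by linarith
      calc _ ≤ 2 * V := by linarith
        _ ≤ V * V ^ 2 := by gcongr
        _ = _ := by ring
    calc C * (a ^ 4 * n (2 * a ^ 6) + (3 * a) ^ 3)
        ≤ C * (a ^ 4 * (2 * W * δ ^ 3 * a ^ 2) + 27 * W * (δ ^ 3 * a ^ 6)) := by gcongr
      _ = 29 * (C * W) * (δ ^ 3 * a ^ 6) := by ring
      _ ≤ V ^ 3 * (δ ^ 3 * a ^ 6) := by gcongr
      _ = _ := by ring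
  have hVC : V ≤ C * V := le_mul_of_one_le_left (by linarith) hC
  refine H.gradient_sq_le_of_small (s := 4 / 3 * a ^ 6) ha rfl (hV3.trans hVC) hδ1 ?_ ?_
    (hs3.trans (by gcongr)) ((hWa a ha).2.trans (hV2.trans hVC)) ((hgW _).trans (hV2.trans hVC))
    ((H.n_mono hs4).trans (hn.trans ?_)) ((H.m_mono hs4).trans (hm.trans ?_))
  · nlinarith
  · refine (H.s2_le a _ ha (by positivity) hs4).trans ?_
    calc _ ≤ C * a ^ 3 * (V * δ * a ^ 2) := by gcongr
      _ = _ := by ring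
  · exact mul_le_mul_of_nonneg_right (mul_le_mul (by nlinarith) hδ3 (by positivity)
      (by positivity)) (by positivity)
  · exact mul_le_mul_of_nonneg_right (mul_le_mul (by nlinarith) hδ3 (by positivity)
      (by positivity)) (by positivity)

theorem gradient_eq_zero (H : GrowthSystem C g s2 s3 s6 n m b) (r : ℝ) : g r = 0 := by
  obtain ⟨Z, hZ⟩ := H.exists_decay
  have key : ∀ δ, 0 < δ → δ ≤ 1 → g r ^ 2 ≤ Z * δ := fun δ hδ hδ1 => by
    obtain ⟨A, hA⟩ := hZ δ hδ hδ1
    refine le_trans ?_ (hA (max A (max 1 r)) (le_max_left _ _))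
    refine pow_le_pow_left₀ (H.g_nonneg _) (H.g_mono ?_) 2
    have h1 : r ≤ max A (max 1 r) := (le_max_right 1 r).trans (le_max_right _ _)
    have h2 : 1 ≤ max A (max 1 r) := (le_max_left 1 r).trans (le_max_right _ _)
    exact h1.trans (le_self_pow₀ h2 (by norm_num))
  have h : g r ^ 2 ≤ 0 := by
    by_contra hpos
    push Not at hpos
    have hZ0 : 0 < Z := by nlinarith [key 1 one_pos le_rfl]
    have := key (min 1 (g r ^ 2 / (2 * Z))) (by positivity) (min_le_left _ _)
    have h2 : Z * min 1 (g r ^ 2 / (2 * Z)) ≤ Z * (g r ^ 2 / (2 * Z)) := by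
      gcongr; exact min_le_right _ _
    have h3 : Z * (g r ^ 2 / (2 * Z)) = g r ^ 2 / 2 := by field_simp
    linarith
  exact pow_eq_zero_iff (two_ne_zero) |>.1 (le_antisymm h (sq_nonneg _))

end GrowthSystem

theorem nrm_mono_radius {q : ℝ} (hq : 0 < q) {f : E3 → ℝ} (hf : Continuous f) :
    Monotone (nrm q f) := fun _ _ h => nrm_mono hq hf hf h fun _ _ => le_rfl

theorem rpow_volume_le {a r : ℝ} (ha : 1 ≤ a) (hr : 0 < r) (hra : r ≤ 2 * a ^ 6) {k t : ℕ}
    (ht : t ≠ 0) (hkt : k * t = 18) :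
    (r ^ 3 * ballVol) ^ (1 / (t : ℝ)) ≤ (8 * ballVol + 1) * a ^ k := by
  have hV := ballVol_pos
  have ha0 : 0 < a := by linarith
  have h : r ^ 3 * ballVol ≤ ((8 * ballVol + 1) * a ^ k) ^ t := by
    rw [mul_pow, ← pow_mul, hkt]
    calc r ^ 3 * ballVol ≤ (2 * a ^ 6) ^ 3 * ballVol := by gcongr
      _ = 8 * ballVol * a ^ 18 := by ring
      _ ≤ (8 * ballVol + 1) ^ t * a ^ 18 := by
        gcongr
        exact (le_add_of_nonneg_right zero_le_one).trans (le_self_pow₀ (by linarith) ht)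
  rw [one_div]
  calc _ ≤ (((8 * ballVol + 1) * a ^ k) ^ t) ^ ((t : ℝ)⁻¹) := by gcongr
    _ = _ := Real.pow_rpow_inv_natCast (by positivity) ht

/-- The norm over a large ball is controlled by the norm over a smaller one and the energy in
between. -/
theorem nrm_mul_tail_le {f h : E3 → ℝ} (hf : Continuous f) (hh : Continuous h) {r s : ℝ}
    (hr : 0 < r) (hrs : 2 * r ≤ s) :
    nrm (6 / 5) (fun x => f x * h x) s ≤ nrm (6 / 5) (fun x => f x * h x) (2 * r)
      + nrm 3 f s * √(nrm 2 h s ^ 2 - nrm 2 h r ^ 2) := by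
  obtain ⟨_, _, hcut⟩ := exists_cutoff_mid
  obtain ⟨χ, hχ, hχ0, hχ1, hχr, hχs, -, -⟩ := hcut r (2 * r) hr (by linarith)
  have hc := hχ.continuous
  have h1 : nrm (6 / 5) (fun x => f x * (χ x * h x)) s
      ≤ nrm (6 / 5) (fun x => f x * h x) (2 * r) := by
    refine le_trans (le_of_eq ?_) (nrm_mono (r := 2 * r) (f := fun x => f x * (χ x * h x))
      (by norm_num) (by fun_prop) (by fun_prop) le_rfl fun x _ => ?_)
    · have hsup : SuppIn (fun x => |f x * (χ x * h x)| ^ (6 / 5 : ℝ)) ((r + 2 * r) / 2) :=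
        fun x hx => by
          simp only [hχs x hx, zero_mul, mul_zero, abs_zero]
          exact Real.zero_rpow (by norm_num)
      rw [nrm, nrm, hsup.setIntegral_eq (by linarith), hsup.setIntegral_eq (by linarith)]
    · rw [abs_mul, abs_mul, abs_mul, abs_of_nonneg (hχ0 x)]
      gcongr
      exact mul_le_of_le_one_left (abs_nonneg _) (hχ1 x)
  have h2 : nrm 2 (fun x => (1 - χ x) * h x) s ≤ √(nrm 2 h s ^ 2 - nrm 2 h r ^ 2) := by
    refine Real.le_sqrt_of_sq_le ?_
    have key : ∫ x in Metric.ball (0 : E3) r, h x ^ 2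
        ≤ ∫ x in Metric.ball (0 : E3) s, (h x ^ 2 - ((1 - χ x) * h x) ^ 2) := by
      have hcont : Continuous fun x => h x ^ 2 - ((1 - χ x) * h x) ^ 2 := by fun_prop
      calc _ = ∫ x in Metric.ball (0 : E3) r, (h x ^ 2 - ((1 - χ x) * h x) ^ 2) := by
            refine setIntegral_congr_fun Metric.isOpen_ball.measurableSet fun x hx => ?_
            simp [hχr x (by simpa using (Metric.mem_ball.1 hx).le)]
        _ ≤ _ := setIntegral_mono_set (continuous_integrableOn_ball hcont s)
            (Filter.Eventually.of_forall fun x => by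
              have e0 := hχ0 x
              have e1 := hχ1 x
              have : 0 ≤ h x ^ 2 * (χ x * (2 - χ x)) :=
                mul_nonneg (sq_nonneg _) (mul_nonneg e0 (by linarith))
              simp only [Pi.zero_apply]
              linarith)
            (Metric.ball_subset_ball (by linarith)).eventuallyLE
    rw [integral_sub (continuous_integrableOn_ball (by fun_prop) s)
      (continuous_integrableOn_ball (by fun_prop) s)] at key
    rw [nrm_two_sq, nrm_two_sq, nrm_two_sq]
    linarith
  calc nrm (6 / 5) (fun x => f x * h x) s
      = nrm (6 / 5) (fun x => f x * (χ x * h x) + f x * ((1 - χ x) * h x)) s := by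
        congr 1; funext x; ring
    _ ≤ nrm (6 / 5) (fun x => f x * (χ x * h x)) s
        + nrm (6 / 5) (fun x => f x * ((1 - χ x) * h x)) s :=
        nrm_add_le (by norm_num) (by fun_prop) (by fun_prop) s
    _ ≤ nrm (6 / 5) (fun x => f x * (χ x * h x)) s
        + nrm 3 f s * nrm 2 (fun x => (1 - χ x) * h x) s := by
        gcongr
        exact nrm_mul_le (by norm_num) (by norm_num) (by norm_num) (by norm_num) hf
          (by fun_prop) s
    _ ≤ _ := add_le_add h1 (mul_le_mul_of_nonneg_left h2 (nrm_nonneg _ _ _))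

theorem nrm_amp_le {q : ℝ} (hq : 1 ≤ q) {v : Fin 3 → E3 → ℝ} (hv : ∀ j, Continuous (v j))
    (r : ℝ) : nrm q (amp v) r ≤ ∑ j, nrm q (v j) r :=
  (nrm_sum_le Finset.univ hq (f := fun j x => |v j x|) (fun j => (hv j).abs) r).trans
    (le_of_eq (Finset.sum_congr rfl fun j _ => nrm_abs q (v j) r))

theorem nrm_amp₂_le_of_forall_le {q : ℝ} (hq : 1 ≤ q) {v B : Fin 3 → E3 → ℝ}
    (hv : ∀ j, ContDiff ℝ (⊤ : ℕ∞) (v j)) (hB : ∀ j, ContDiff ℝ (⊤ : ℕ∞) (B j)) {r Y : ℝ}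
    (h1 : ∀ j, nrm q (v j) r ≤ Y) (h2 : ∀ j, nrm q (B j) r ≤ Y) :
    nrm q (amp₂ v B) r ≤ 6 * Y := by
  have e := nrm_add_le hq (continuous_amp hv) (continuous_amp hB) r
  have e1 := nrm_amp_le hq (fun j => (hv j).continuous) r
  have e2 := nrm_amp_le hq (fun j => (hB j).continuous) r
  rw [Fin.sum_univ_three] at e1 e2
  have : nrm q (amp₂ v B) r ≤ nrm q (amp v) r + nrm q (amp B) r := e
  linarith [h1 0, h1 1, h1 2, h2 0, h2 1, h2 2]

theorem nrm_amp₂_pow_le {q : ℝ} (hq : 1 ≤ q) {v B : Fin 3 → E3 → ℝ}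
    (hv : ∀ j, ContDiff ℝ (⊤ : ℕ∞) (v j)) (hB : ∀ j, ContDiff ℝ (⊤ : ℕ∞) (B j)) {r X : ℝ}
    {k : ℕ} (hk : k ≠ 0) (h1 : ∀ j, nrm q (v j) r ^ k ≤ X) (h2 : ∀ j, nrm q (B j) r ^ k ≤ X) :
    nrm q (amp₂ v B) r ^ k ≤ 6 ^ k * X := by
  have hX : 0 ≤ X := (pow_nonneg (nrm_nonneg _ _ _) k).trans (h1 0)
  have root : ∀ y, 0 ≤ y → y ^ k ≤ X → y ≤ X ^ ((k : ℝ)⁻¹) := fun y hy h => by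
    rw [← Real.pow_rpow_inv_natCast hy hk]
    gcongr
  have h := nrm_amp₂_le_of_forall_le hq hv hB (fun j => root _ (nrm_nonneg _ _ _) (h1 j))
    (fun j => root _ (nrm_nonneg _ _ _) (h2 j))
  calc _ ≤ (6 * X ^ ((k : ℝ)⁻¹)) ^ k := pow_le_pow_left₀ (nrm_nonneg _ _ _) h k
    _ = _ := by rw [mul_pow, Real.rpow_inv_natCast_pow hX hk]

/-- The field `v` is the divergence of matrix potentials whose norms grow at most at the rate
allowed in the Liouville theorem. -/
def HasSlowPotential (K : ℝ) (v : Fin 3 → E3 → ℝ) : Prop :=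
  ∀ a : ℝ, 1 ≤ a → ∃ Φ : Fin 3 → Fin 3 → E3 → ℝ, (∀ i j, ContDiff ℝ 1 (Φ i j)) ∧
    (∀ j x, v j x = ∑ i, pd (Φ i j) i x) ∧
    (∀ i j, nrm 6 (Φ i j) (2 * a ^ 6) ≤ K * a ^ 4) ∧
    ∀ i j, nrm 3 (Φ i j) (2 * a ^ 6) ≤ K * a ^ 7

theorem HasSlowPotential.exists_nrm_three_le {K : ℝ} (hK : 1 ≤ K) : ∃ C : ℝ, 0 < C ∧
    ∀ v : Fin 3 → E3 → ℝ, (∀ j, ContDiff ℝ (⊤ : ℕ∞) (v j)) → HasSlowPotential K v →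
    ∀ S G : E3 → ℝ, Continuous S → Continuous G → (∀ j x, |v j x| ≤ S x) →
    (∀ j i x, |pd (v j) i x| ≤ G x) → ∀ a r s : ℝ, 1 ≤ a → 0 < r → r < s → s ≤ 2 * a ^ 6 →
    ∀ j, nrm 3 (v j) r ^ 2 ≤ C * (a ^ 4 * nrm 2 G s + (a ^ 7 / (s - r)) ^ 2) ∧
      nrm 3 (v j) r ^ 3
        ≤ C * (a ^ 4 * nrm (6 / 5) (fun x => S x * G x) s + (a ^ 7 / (s - r)) ^ 3) := by
  obtain ⟨C, hC, H⟩ := _root_.exists_nrm_three_le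
  refine ⟨C * K ^ 3, by positivity, ?_⟩
  intro v hv hpot S G hS hG hvS hvG a r s ha hr hrs hsa j
  obtain ⟨Φ, hΦ, hdiv, h6, h3⟩ := hpot a ha
  have h := H (v j) (fun i => Φ i j) (contDiff_one_of_top (hv j)) (fun i => hΦ i j) (hdiv j)
    r s (K * a ^ 4) (K * a ^ 7) (nrm 2 G s) (nrm (6 / 5) (fun x => S x * G x) s) hr hrs
    (fun i => (nrm_mono_radius (by norm_num) (hΦ i j).continuous hsa).trans (h6 i j))
    (fun i => (nrm_mono_radius (by norm_num) (hΦ i j).continuous hsa).trans (h3 i j))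
    (fun i => nrm_mono (by norm_num) (contDiff_pd (hv j) i).continuous hG le_rfl
      fun x _ => (hvG j i x).trans (le_abs_self _))
    (fun i => nrm_mono (by norm_num) ((hv j).continuous.mul (contDiff_pd (hv j) i).continuous)
      (hS.mul hG) le_rfl fun x _ => by
        simp only [Pi.mul_apply, abs_mul]
        exact mul_le_mul ((hvS j x).trans (le_abs_self _)) ((hvG j i x).trans (le_abs_self _))
          (abs_nonneg _) (abs_nonneg _))
  have hd : 0 < s - r := by linarith
  have hg0 := nrm_nonneg 2 G s
  have hn0 := nrm_nonneg (6 / 5) (fun x => S x * G x) s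
  generalize nrm 2 G s = g at *
  generalize nrm (6 / 5) (fun x => S x * G x) s = n at *
  have k1 : K ≤ K ^ 3 := le_self_pow₀ hK (by norm_num)
  have k2 : K ^ 2 ≤ K ^ 3 := pow_le_pow_right₀ hK (by norm_num)
  constructor
  · refine h.1.trans ?_
    calc C * (K * a ^ 4 * g + (K * a ^ 7 / (s - r)) ^ 2)
        = C * (K * (a ^ 4 * g) + K ^ 2 * (a ^ 7 / (s - r)) ^ 2) := by ring
      _ ≤ C * (K ^ 3 * (a ^ 4 * g) + K ^ 3 * (a ^ 7 / (s - r)) ^ 2) := by gcongr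
      _ = _ := by ring
  · refine h.2.trans ?_
    calc C * (K * a ^ 4 * n + (K * a ^ 7 / (s - r)) ^ 3)
        = C * (K * (a ^ 4 * n) + K ^ 3 * (a ^ 7 / (s - r)) ^ 3) := by ring
      _ ≤ C * (K ^ 3 * (a ^ 4 * n) + K ^ 3 * (a ^ 7 / (s - r)) ^ 3) := by gcongr
      _ = _ := by ring

/-- The `L⁶` oscillation of the field over balls of radius `R` is `o(R^{4/3})`. -/
def HasSmallOscillation (B : Fin 3 → E3 → ℝ) : Prop :=
  ∀ η : ℝ, 0 < η → ∃ A : ℝ, ∀ a : ℝ, A ≤ a → ∀ j, ∃ m : ℝ,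
    nrm 6 (fun x => B j x - m) (2 * a ^ 6) ≤ η * a ^ 8

theorem HasSmallOscillation.nrm_amp_le {K : ℝ} (hK : 1 ≤ K) {B : Fin 3 → E3 → ℝ}
    (hB : ∀ j, ContDiff ℝ (⊤ : ℕ∞) (B j)) (hpot : HasSlowPotential K B)
    (hosc : HasSmallOscillation B) {η : ℝ} (hη : 0 < η) :
    ∃ A, ∀ a, A ≤ a → nrm 6 (amp B) (2 * a ^ 6) ≤ η * a ^ 8 := by
  obtain ⟨C, hC, H⟩ := exists_nrm_six_le_osc
  obtain ⟨A, hA⟩ := hosc (η / (6 * C)) (by positivity)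
  refine ⟨max A (max 1 (6 * C * K / η)), fun a ha => ?_⟩
  have haA : A ≤ a := (le_max_left _ _).trans ha
  have ha1 : 1 ≤ a := ((le_max_left _ _).trans (le_max_right _ _)).trans ha
  have haK : 6 * C * K / η ≤ a := ((le_max_right _ _).trans (le_max_right _ _)).trans ha
  have ha0 : 0 < a := by linarith
  rw [div_le_iff₀ hη] at haK
  obtain ⟨Φ, hΦ, hdiv, h6, -⟩ := hpot a ha1
  have key : ∀ j, nrm 6 (B j) (2 * a ^ 6) ≤ η / 3 * a ^ 8 := fun j => by
    obtain ⟨m, hm⟩ := hA a haA j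
    refine (H (B j) (fun i => Φ i j) (hB j).continuous (fun i => hΦ i j) (hdiv j) (2 * a ^ 6) m
      (K * a ^ 4) _ (by positivity) (fun i => h6 i j) hm).trans ?_
    have e1 : K * a ^ 4 / (2 * a ^ 6) ≤ K := by
      rw [div_le_iff₀ (by positivity)]
      have : a ^ 4 ≤ a ^ 6 := pow_le_pow_right₀ ha1 (by norm_num)
      have h6 : 0 < a ^ 6 := by positivity
      exact mul_le_mul_of_nonneg_left (by linarith) (by linarith)
    have e2 : a ≤ a ^ 8 := le_self_pow₀ ha1 (by norm_num)
    have e3 : a * η ≤ a ^ 8 * η := by gcongr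
    calc C * (K * a ^ 4 / (2 * a ^ 6) + η / (6 * C) * a ^ 8)
        ≤ C * (K + η / (6 * C) * a ^ 8) := by gcongr
      _ = C * K + η * a ^ 8 / 6 := by field_simp
      _ ≤ _ := by linarith
  have h := _root_.nrm_amp_le (q := 6) (by norm_num) (fun j => (hB j).continuous) (2 * a ^ 6)
  rw [Fin.sum_univ_three] at h
  linarith [key 0, key 1, key 2]

theorem exists_nrm_six_le_of_abs_le : ∃ C : ℝ, 0 < C ∧
    ∀ v : Fin 3 → E3 → ℝ, (∀ j, ContDiff ℝ (⊤ : ℕ∞) (v j)) →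
    ∀ S G : E3 → ℝ, Continuous S → Continuous G → (∀ j x, |v j x| ≤ S x) →
    (∀ j i x, |pd (v j) i x| ≤ G x) → ∀ r s : ℝ, 0 < r → r < s →
    ∀ j, nrm 6 (v j) r ≤ C * (nrm 2 G s + nrm 2 S s / (s - r)) := by
  obtain ⟨C, hC, H⟩ := exists_nrm_six_le
  refine ⟨3 * C, by positivity, ?_⟩
  intro v hv S G hS hG hvS hvG r s hr hrs j
  have hd : 0 < s - r := by linarith
  have h1 : ∑ i, nrm 2 (pd (v j) i) s ≤ 3 * nrm 2 G s := by
    have := Finset.sum_le_sum fun i (_ : i ∈ Finset.univ) =>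
      nrm_mono (r := s) (s := s) (q := 2) (by norm_num) (contDiff_pd (hv j) i).continuous hG le_rfl
        fun x _ => (hvG j i x).trans (le_abs_self _)
    simpa using this
  have h2 : nrm 2 (v j) s / (s - r) ≤ nrm 2 S s / (s - r) := by
    gcongr
    exact nrm_mono (by norm_num) (hv j).continuous hS le_rfl
      fun x _ => (hvS j x).trans (le_abs_self _)
  have h3 : 0 ≤ nrm 2 S s / (s - r) := div_nonneg (nrm_nonneg _ _ _) hd.le
  calc _ ≤ C * (∑ i, nrm 2 (pd (v j) i) s + nrm 2 (v j) s / (s - r)) :=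
        H (v j) (contDiff_one_of_top (hv j)) r s hr hrs
    _ ≤ C * (3 * nrm 2 G s + 3 * (nrm 2 S s / (s - r))) := by
        gcongr
        linarith
    _ = _ := by ring

theorem energy_bracket_le {C K x y z w m b n d s ε a : ℝ} (hC : 0 ≤ C) (hK : 1 ≤ K)
    (hx : 0 ≤ x) (hy : 0 ≤ y) (hz : 0 ≤ z) (hw : 0 ≤ w) (hm : 0 ≤ m) (hb : 0 ≤ b) (hn : 0 ≤ n)
    (hd : 0 < d) (hs : 0 < s) (hε : 0 < ε) (ha : 0 ≤ a) :
    0 ≤ (x * y + z ^ 3 + z * b * y) / d + ε * (y * (x / d ^ 2 + y / d) + n * (w / d))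
      + (1 / d + s / d ^ 2) * (m / ε + n) * a ∧
    C * ((x * y + z ^ 3 + z * b * y) / d + ε * (y * (x / d ^ 2 + y / d) + n * (w / d))
      + (1 / d + s / d ^ 2) * (m / ε + n) * (K * a)) ≤
    C * K * ((x * y + z ^ 3 + z * b * y) / d + ε * (y * (x / d ^ 2 + y / d) + n * (w / d))
      + (1 / d + s / d ^ 2) * (m / ε + n) * a) := by
  refine ⟨by positivity, ?_⟩
  have h : 0 ≤ (x * y + z ^ 3 + z * b * y) / d + ε * (y * (x / d ^ 2 + y / d) + n * (w / d)) := by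
    positivity
  generalize (x * y + z ^ 3 + z * b * y) / d + ε * (y * (x / d ^ 2 + y / d) + n * (w / d)) = X at *
  have h' : X ≤ K * X := le_mul_of_one_le_left h hK
  calc _ ≤ C * (K * X + (1 / d + s / d ^ 2) * (m / ε + n) * (K * a)) := by gcongr
    _ = _ := by ring

theorem IsHallMHD.exists_growthSystem {v B : Fin 3 → E3 → ℝ} {p : E3 → ℝ} (H : IsHallMHD v B p)
    {K : ℝ} (hK : 1 ≤ K) (hv : HasSlowPotential K v) (hB : HasSlowPotential K B)
    (hosc : HasSmallOscillation B) :
    ∃ C, GrowthSystem C (nrm 2 (gradAmp₂ v B)) (nrm 2 (amp₂ v B)) (nrm 3 (amp₂ v B))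
      (nrm 6 (amp₂ v B)) (nrm (6 / 5) fun x => amp₂ v B x * gradAmp₂ v B x)
      (nrm (6 / 5) (gradAmp₂ v B)) (nrm 6 (amp B)) := by
  obtain ⟨C3, hC3, H3⟩ := HasSlowPotential.exists_nrm_three_le hK
  obtain ⟨C6, hC6, H6⟩ := exists_nrm_six_le_of_abs_le
  obtain ⟨CE, hCE, HE⟩ := IsHallMHD.exists_energy_le
  have hS := H.continuous_amp₂
  have hG := H.continuous_gradAmp₂
  have hvol := ballVol_pos
  have hvS : ∀ j x, |v j x| ≤ amp₂ v B x := fun j x =>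
    (abs_le_amp v j x).trans (amp_le_left v B x)
  have hBS : ∀ j x, |B j x| ≤ amp₂ v B x := fun j x =>
    (abs_le_amp B j x).trans (amp_le_right v B x)
  have hvG : ∀ j i x, |pd (v j) i x| ≤ gradAmp₂ v B x := fun j i x =>
    (abs_pd_le_gradAmp v j i x).trans (gradAmp_le_left v B x)
  have hBG : ∀ j i x, |pd (B j) i x| ≤ gradAmp₂ v B x := fun j i x =>
    (abs_pd_le_gradAmp B j i x).trans (gradAmp_le_right v B x)
  have hcube : ∀ a r, 1 ≤ a → 0 < r → r ≤ 2 * a ^ 6 →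
      (r ^ 3 * ballVol) ^ (1 / 3 : ℝ) ≤ (8 * ballVol + 1) * a ^ 6 := fun a r ha hr hra => by
    exact_mod_cast rpow_volume_le ha hr hra (k := 6) (t := 3) (by norm_num) (by norm_num)
  have hsixth : ∀ a r, 1 ≤ a → 0 < r → r ≤ 2 * a ^ 6 →
      (r ^ 3 * ballVol) ^ (1 / 6 : ℝ) ≤ (8 * ballVol + 1) * a ^ 3 := fun a r ha hr hra => by
    exact_mod_cast rpow_volume_le ha hr hra (k := 3) (t := 6) (by norm_num) (by norm_num)
  obtain ⟨C, hC1, hCV, hC3', hC6', hCE'⟩ : ∃ C : ℝ, 1 ≤ C ∧ 8 * ballVol + 1 ≤ C ∧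
      216 * C3 ≤ C ∧ 6 * C6 ≤ C ∧ CE * K ≤ C := by
    have : 0 < CE * K := by positivity
    exact ⟨1 + 8 * ballVol + 216 * C3 + 6 * C6 + CE * K, by linarith, by linarith, by linarith,
      by linarith, by linarith⟩
  refine ⟨C, hC1, nrm_nonneg _ _, nrm_nonneg _ _, nrm_nonneg _ _, nrm_nonneg _ _, nrm_nonneg _ _,
    nrm_nonneg _ _, nrm_nonneg _ _, nrm_mono_radius (by norm_num) hG,
    nrm_mono_radius (by norm_num) hS, nrm_mono_radius (by norm_num) hS,
    nrm_mono_radius (by norm_num) (hS.mul hG), nrm_mono_radius (by norm_num) hG,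
    nrm_mono_radius (by norm_num) (continuous_amp H.smooth_B), ?_, ?_, ?_, ?_, ?_, ?_, ?_, ?_,
    fun η hη => hosc.nrm_amp_le hK H.smooth_B hB hη, ?_, ?_⟩
  · exact nrm_mul_le (by norm_num) (by norm_num) (by norm_num) (by norm_num) hS hG
  · exact fun r => nrm_mono (by norm_num) (continuous_amp H.smooth_B) hS le_rfl fun x _ => by
      rw [abs_of_nonneg (amp_nonneg B x), abs_of_nonneg (amp₂_nonneg v B x)]
      exact amp_le_right v B x
  · intro a r ha hr hra
    refine (nrm_le_nrm (p := 3) (t := 6) (by norm_num) (by norm_num) (by norm_num) (by norm_num)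
      hS hr.le).trans ?_
    rw [mul_comm]
    exact mul_le_mul_of_nonneg_right ((hsixth a r ha hr hra).trans (by gcongr)) (nrm_nonneg _ _ _)
  · intro a r ha hr hra
    refine (nrm_le_nrm (p := 2) (t := 3) (by norm_num) (by norm_num) (by norm_num) (by norm_num)
      hG hr.le).trans ?_
    rw [mul_comm]
    exact mul_le_mul_of_nonneg_right ((hcube a r ha hr hra).trans (by gcongr)) (nrm_nonneg _ _ _)
  · intro a r s ha hr hrs hsa
    have h := nrm_amp₂_pow_le (q := 3) (by norm_num) H.smooth_v H.smooth_B two_ne_zero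
      (fun j => (H3 v H.smooth_v hv _ _ hS hG hvS hvG a r s ha hr hrs hsa j).1)
      (fun j => (H3 B H.smooth_B hB _ _ hS hG hBS hBG a r s ha hr hrs hsa j).1)
    refine h.trans ?_
    rw [← mul_assoc]
    exact mul_le_mul_of_nonneg_right (by linarith)
      (add_nonneg (mul_nonneg (by positivity) (nrm_nonneg _ _ _)) (sq_nonneg _))
  · intro a r s ha hr hrs hsa
    have h := nrm_amp₂_pow_le (q := 3) (by norm_num) H.smooth_v H.smooth_B three_ne_zero
      (fun j => (H3 v H.smooth_v hv _ _ hS hG hvS hvG a r s ha hr hrs hsa j).2)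
      (fun j => (H3 B H.smooth_B hB _ _ hS hG hBS hBG a r s ha hr hrs hsa j).2)
    refine h.trans ?_
    have hd : 0 < s - r := by linarith
    rw [← mul_assoc]
    exact mul_le_mul_of_nonneg_right (by linarith)
      (add_nonneg (mul_nonneg (by positivity) (nrm_nonneg _ _ _)) (by positivity))
  · intro r s hr hrs
    have h := nrm_amp₂_le_of_forall_le (q := 6) (by norm_num) H.smooth_v H.smooth_B
      (fun j => H6 v H.smooth_v _ _ hS hG hvS hvG r s hr hrs j)
      (fun j => H6 B H.smooth_B _ _ hS hG hBS hBG r s hr hrs j)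
    refine h.trans ?_
    rw [← mul_assoc]
    exact mul_le_mul_of_nonneg_right (by linarith)
      (add_nonneg (nrm_nonneg _ _ _) (div_nonneg (nrm_nonneg _ _ _) (by linarith)))
  · intro a r s ε ha hr hrs hsa hε hεd
    obtain ⟨Φ, hΦ, hdiv, h6, -⟩ := hv a ha
    have h := HE v B p H Φ hΦ hdiv r s ε (K * a ^ 4) hr hrs hε hεd fun i j =>
      (nrm_mono_radius (by norm_num) (hΦ i j).continuous hsa).trans (h6 i j)
    have e := energy_bracket_le (C := CE) (K := K) (x := nrm 2 (amp₂ v B) s)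
      (y := nrm 2 (gradAmp₂ v B) s) (z := nrm 3 (amp₂ v B) s) (w := nrm 6 (amp₂ v B) s)
      (m := nrm (6 / 5) (gradAmp₂ v B) s) (b := nrm 6 (amp B) s)
      (n := nrm (6 / 5) (fun x => amp₂ v B x * gradAmp₂ v B x) s) (d := s - r) (s := s) (ε := ε)
      (a := a ^ 4) hCE.le hK (nrm_nonneg _ _ _) (nrm_nonneg _ _ _) (nrm_nonneg _ _ _)
      (nrm_nonneg _ _ _) (nrm_nonneg _ _ _) (nrm_nonneg _ _ _) (nrm_nonneg _ _ _) (by linarith)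
      (by linarith) hε (by positivity)
    exact (h.trans e.2).trans (mul_le_mul_of_nonneg_right hCE' e.1)
  · exact fun r s hr hrs => nrm_mul_tail_le hS hG hr hrs
  · intro a r s ha hr hrs hsa
    have hs : 0 < s := by linarith
    have h := nrm_mul_tail_le (continuous_const (y := (1 : ℝ))) hG hr hrs
    simp only [one_mul] at h
    refine h.trans (add_le_add_right (mul_le_mul_of_nonneg_right ?_ (Real.sqrt_nonneg _)) _)
    have e : nrm 3 (fun _ => 1) s = (s ^ 3 * ballVol) ^ (1 / 3 : ℝ) := by
      simp [nrm, volume_real_ball hs.le]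
    rw [e]
    exact (hcube a s ha hs hsa).trans (by gcongr)

theorem nrm_six_le_iff (f : E3 → ℝ) (r : ℝ) {y : ℝ} (hy : 0 ≤ y) :
    nrm 6 f r ≤ y ↔ ∫ x in Metric.ball (0 : E3) r, |f x| ^ 6 ≤ y ^ 6 := by
  have h := nrm_rpow (q := 6) (by norm_num) f r
  norm_cast at h
  rw [← h, pow_le_pow_iff_left₀ (nrm_nonneg _ _ _) hy (by norm_num)]

theorem setAverage_ball_nonneg {f : E3 → ℝ} (hf : ∀ x, 0 ≤ f x) (r : ℝ) :
    0 ≤ ⨍ x in Metric.ball (0 : E3) r, f x := by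
  rw [setAverage_eq]
  exact smul_nonneg (inv_nonneg.2 measureReal_nonneg) (integral_nonneg hf)

/-- Matrix potentials of slow mean oscillation can be normalised on each ball. -/
theorem exists_hasSlowPotential (C : ℝ) : ∃ K, 1 ≤ K ∧
    ∀ (v : E3 → Fin 3 → ℝ) (Φ : E3 → Fin 3 → Fin 3 → ℝ), ContDiff ℝ (⊤ : ℕ∞) Φ →
    (∀ x j, matDiv Φ x j = v x j) →
    (∀ r : ℝ, 1 < r → (⨍ x in Metric.ball (0 : E3) r,
        ‖(fun (i j : Fin 3) => Φ x i j - ⨍ y in Metric.ball (0 : E3) r, Φ y i j)‖ ^ 6) ≤ C * r) →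
    HasSlowPotential K fun j x => v x j := by
  have hvol := ballVol_pos
  set L := 16 * ballVol * |C| + 1 with hL
  have hL1 : 1 ≤ L := le_add_of_nonneg_left (by positivity)
  have hQ1 : 1 ≤ 8 * ballVol + 1 := le_add_of_nonneg_left (by positivity)
  refine ⟨L * (8 * ballVol + 1), one_le_mul_of_one_le_of_one_le hL1 hQ1, ?_⟩
  intro v Φ hΦ hdiv hosc a ha
  have ha0 : 0 < a := by linarith
  have ha6 : 1 ≤ a ^ 6 := one_le_pow₀ ha
  have hR : 1 < 2 * a ^ 6 := by linarith
  have hΦs : ∀ i j, ContDiff ℝ (⊤ : ℕ∞) fun x => Φ x i j := fun i j =>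
    contDiff_pi.1 (contDiff_pi.1 hΦ i) j
  have hcont := fun i j => (hΦs i j).continuous
  have h6 : ∀ i j, nrm 6 (fun x => Φ x i j - ⨍ y in Metric.ball (0 : E3) (2 * a ^ 6), Φ y i j)
      (2 * a ^ 6) ≤ L * a ^ 4 := fun i j => by
    rw [nrm_six_le_iff _ _ (by positivity)]
    have h := hosc _ hR
    rw [setAverage_eq, smul_eq_mul, volume_real_ball (by positivity),
      inv_mul_le_iff₀ (by positivity)] at h
    have hm : Continuous fun x =>
        ‖(fun (i j : Fin 3) => Φ x i j - ⨍ y in Metric.ball (0 : E3) (2 * a ^ 6), Φ y i j)‖ ^ 6 :=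
      (continuous_pi fun i => continuous_pi fun j =>
        (hcont i j).sub continuous_const).norm.pow 6
    calc _ ≤ ∫ x in Metric.ball (0 : E3) (2 * a ^ 6), ‖(fun (i j : Fin 3) =>
            Φ x i j - ⨍ y in Metric.ball (0 : E3) (2 * a ^ 6), Φ y i j)‖ ^ 6 := by
          refine setIntegral_mono (continuous_integrableOn_ball
            (((hcont i j).sub continuous_const).abs.pow 6) _)
            (continuous_integrableOn_ball hm _) fun x => ?_
          refine pow_le_pow_left₀ (abs_nonneg _) ?_ 6
          exact (norm_le_pi_norm (fun j : Fin 3 =>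
            Φ x i j - ⨍ y in Metric.ball (0 : E3) (2 * a ^ 6), Φ y i j) j).trans
            (norm_le_pi_norm (fun (i j : Fin 3) =>
              Φ x i j - ⨍ y in Metric.ball (0 : E3) (2 * a ^ 6), Φ y i j) i)
      _ ≤ (2 * a ^ 6) ^ 3 * ballVol * (C * (2 * a ^ 6)) := h
      _ ≤ (2 * a ^ 6) ^ 3 * ballVol * (|C| * (2 * a ^ 6)) := by gcongr; exact le_abs_self C
      _ = (16 * ballVol * |C|) * a ^ 24 := by ring
      _ ≤ L ^ 6 * a ^ 24 := by
          gcongr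
          exact (le_add_of_nonneg_right zero_le_one).trans (le_self_pow₀ hL1 (by norm_num))
      _ = _ := by ring
  refine ⟨fun i j x => Φ x i j - ⨍ y in Metric.ball (0 : E3) (2 * a ^ 6), Φ y i j,
    fun i j => contDiff_one_of_top ((hΦs i j).sub contDiff_const), fun j x => ?_, fun i j => ?_,
    fun i j => ?_⟩
  · simp only [pd_sub_const]
    exact (hdiv x j).symm
  · refine (h6 i j).trans ?_
    gcongr
    exact le_mul_of_one_le_right (by linarith) hQ1
  · have h := rpow_volume_le ha (r := 2 * a ^ 6) (k := 3) (t := 6) (by positivity) le_rfl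
      (by norm_num) (by norm_num)
    refine (nrm_le_nrm (p := 6) (t := (6 : ℕ)) (by norm_num) (by norm_num) (by norm_num)
      (by norm_num) ((hcont i j).sub continuous_const) (by positivity)).trans ?_
    calc _ ≤ (L * a ^ 4) * ((8 * ballVol + 1) * a ^ 3) :=
          mul_le_mul (h6 i j) h (Real.rpow_nonneg (by positivity) _) (by positivity)
      _ = _ := by ring

theorem hasSmallOscillation_of_tendsto {B : E3 → Fin 3 → ℝ} (hB : ContDiff ℝ (⊤ : ℕ∞) B)
    (hBosc : Filter.Tendsto (fun r : ℝ =>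
        r ^ (-(8 : ℝ)) * ∫ x in Metric.ball (0 : E3) r,
          ‖(fun i : Fin 3 => B x i - ⨍ y in Metric.ball (0 : E3) r, B y i)‖ ^ 6)
      Filter.atTop (nhds 0)) :
    HasSmallOscillation fun j x => B x j := by
  intro η hη
  have hcont : ∀ j, Continuous fun x => B x j := fun j => (contDiff_pi.1 hB j).continuous
  obtain ⟨A, hA⟩ := Filter.eventually_atTop.1
    (hBosc.eventually (gt_mem_nhds (show (0 : ℝ) < η ^ 6 / 256 by positivity)))
  refine ⟨max 1 A, fun a ha j => ⟨⨍ y in Metric.ball (0 : E3) (2 * a ^ 6), B y j, ?_⟩⟩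
  have ha1 : 1 ≤ a := (le_max_left _ _).trans ha
  have ha0 : 0 < a := by linarith
  have h1 : a ≤ a ^ 6 := le_self_pow₀ ha1 (by norm_num)
  have h := (hA (2 * a ^ 6) (by linarith [(le_max_right 1 A).trans ha])).le
  rw [nrm_six_le_iff _ _ (by positivity)]
  have e : (2 * a ^ 6) ^ (-(8 : ℝ)) = ((2 * a ^ 6) ^ 8)⁻¹ := by
    rw [Real.rpow_neg (by positivity)]
    norm_cast
  rw [e, inv_mul_le_iff₀ (by positivity)] at h
  refine le_trans (setIntegral_mono (continuous_integrableOn_ball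
    (((hcont j).sub continuous_const).abs.pow 6) _) (continuous_integrableOn_ball
    ((continuous_pi fun i => (hcont i).sub continuous_const).norm.pow 6) _) fun x => ?_)
    (h.trans (le_of_eq (by ring)))
  exact pow_le_pow_left₀ (abs_nonneg _) (norm_le_pi_norm (fun i : Fin 3 =>
    B x i - ⨍ y in Metric.ball (0 : E3) (2 * a ^ 6), B y i) j) 6

theorem eq_zero_of_forall_nrm_two_eq_zero {f : E3 → ℝ} (hf : Continuous f)
    (h : ∀ r, nrm 2 f r = 0) (x : E3) : f x = 0 := by
  have h0 : ∫ y in Metric.ball (0 : E3) (‖x‖ + 1), f y ^ 2 = 0 := by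
    rw [← nrm_two_sq, h, zero_pow two_ne_zero]
  have hc : Continuous fun y => f y ^ 2 := hf.pow 2
  have h1 := (setIntegral_eq_zero_iff_of_nonneg_ae
    (Filter.Eventually.of_forall fun y => sq_nonneg (f y))
    (continuous_integrableOn_ball hc (‖x‖ + 1))).1 h0
  have h2 := Measure.eqOn_open_of_ae_eq h1 Metric.isOpen_ball hc.continuousOn continuousOn_const
    (show x ∈ Metric.ball (0 : E3) (‖x‖ + 1) by simp)
  exact pow_eq_zero_iff two_ne_zero |>.1 h2

/-- A field with vanishing gradient whose `L³` norms grow slower than those of constants is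
zero. -/
theorem eq_zero_of_pd_eq_zero {u : E3 → ℝ} (hu : ContDiff ℝ 1 u) (h : ∀ i x, pd u i x = 0)
    {W : ℝ} (hW : ∀ a, 1 ≤ a → nrm 3 u (2 * a ^ 6) ≤ W * a ^ 2) (x : E3) : u x = 0 := by
  have hconst : ∀ y, u y = u 0 := fun y =>
    is_const_of_fderiv_eq_zero (𝕜 := ℝ) (hu.differentiable one_ne_zero)
      (fun z => by ext w; simp [fderiv_eq_sum_pd, h]) y 0
  have hvol := ballVol_pos
  rw [hconst x]
  by_contra hne
  have hc : 0 < |u 0| := abs_pos.2 hne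
  have hW0 : 0 ≤ W := by simpa using (nrm_nonneg _ _ _).trans (hW 1 le_rfl)
  have hk : 0 < 8 * ballVol * |u 0| ^ 3 := by positivity
  set k := 8 * ballVol * |u 0| ^ 3 with hk'
  have ha : 1 ≤ 1 + W ^ 3 / k := le_add_of_nonneg_right (by positivity)
  have hWa : W ^ 3 < k * (1 + W ^ 3 / k) := by
    rw [mul_add, mul_div_cancel₀ _ hk.ne']
    linarith
  set a := 1 + W ^ 3 / k
  have ha0 : 0 < a := by linarith
  have h3 := pow_le_pow_left₀ (nrm_nonneg _ _ _) (hW a ha) 3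
  rw [nrm_pow_three] at h3
  simp only [hconst] at h3
  rw [setIntegral_const, volume_real_ball (by positivity), smul_eq_mul] at h3
  have h4 : (k * a ^ 12) * a ^ 6 ≤ W ^ 3 * a ^ 6 := by
    calc _ = (2 * a ^ 6) ^ 3 * ballVol * |u 0| ^ 3 := by rw [hk']; ring
      _ ≤ _ := h3
      _ = _ := by ring
  have h5 := le_of_mul_le_mul_right h4 (by positivity)
  have h6 : k * a ≤ k * a ^ 12 := by
    gcongr
    exact le_self_pow₀ ha (by norm_num)
  linarith

theorem IsHallMHD.eq_zero {v B : Fin 3 → E3 → ℝ} {p : E3 → ℝ} (H : IsHallMHD v B p) {K : ℝ}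
    (hK : 1 ≤ K) (hv : HasSlowPotential K v) (hB : HasSlowPotential K B)
    (hosc : HasSmallOscillation B) : (∀ j x, v j x = 0) ∧ ∀ j x, B j x = 0 := by
  obtain ⟨C, S⟩ := H.exists_growthSystem hK hv hB hosc
  have hG := eq_zero_of_forall_nrm_two_eq_zero H.continuous_gradAmp₂ S.gradient_eq_zero
  obtain ⟨W, -, -, hW⟩ := S.exists_norm_growth
  have key : ∀ u : E3 → ℝ, ContDiff ℝ (⊤ : ℕ∞) u → (∀ x, |u x| ≤ amp₂ v B x) →
      (∀ i x, |pd u i x| ≤ gradAmp₂ v B x) → ∀ x, u x = 0 := fun u hu hS hd =>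
    eq_zero_of_pd_eq_zero (contDiff_one_of_top hu)
      (fun i x => abs_nonpos_iff.1 ((hd i x).trans (hG x).le))
      (fun a ha => (nrm_mono (by norm_num) hu.continuous H.continuous_amp₂ le_rfl
        fun x _ => (hS x).trans (le_abs_self _)).trans (hW a ha).1)
  exact ⟨fun j => key _ (H.smooth_v j) (fun x => (abs_le_amp v j x).trans (amp_le_left v B x))
      fun i x => (abs_pd_le_gradAmp v j i x).trans (gradAmp_le_left v B x),
    fun j => key _ (H.smooth_B j) (fun x => (abs_le_amp B j x).trans (amp_le_right v B x))
      fun i x => (abs_pd_le_gradAmp B j i x).trans (gradAmp_le_right v B x)⟩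

/-- **Liouville theorem for stationary Hall-MHD (Theorem 1.3).**  If `(v, B, p)` is a smooth
solution of `-Δv + (v·∇)v = -∇p + (B·∇)B`,
`-ΔB + (v·∇)B - (B·∇)v = ∇×((∇×B)×B)`, `∇·v = ∇·B = 0` in `ℝ³`, such that
`r⁻⁸ ∫_{B(r)} |B - B_{B(r)}|⁶ → 0` as `r → ∞`, and there exist smooth matrix potentials
`Φ, Ψ` with `∇·Φ = v`, `∇·Ψ = B` and
`⨍_{B(r)} |Φ-Φ_{B(r)}|⁶ + ⨍_{B(r)} |Ψ-Ψ_{B(r)}|⁶ ≤ C r` for all `r > 1`, then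
`v ≡ 0` and `B ≡ 0`. -/
theorem stmt_13 (v B : E3 → Fin 3 → ℝ) (p : E3 → ℝ)
    (hv : ContDiff ℝ (⊤ : ℕ∞) v) (hB : ContDiff ℝ (⊤ : ℕ∞) B) (hp : ContDiff ℝ (⊤ : ℕ∞) p)
    (heq1 : ∀ x j, -(lap (fun y => v y j) x) + (∑ i, v x i * pd (fun y => v y j) i x)
      = -(pd p j x) + ∑ i, B x i * pd (fun y => B y j) i x)
    (heq2 : ∀ x j, -(lap (fun y => B y j) x) + (∑ i, v x i * pd (fun y => B y j) i x)
      - (∑ i, B x i * pd (fun y => v y j) i x)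
      = curl3 (fun y => cross3 (curl3 B y) (B y)) x j)
    (hdivv : ∀ x, divg v x = 0) (hdivB : ∀ x, divg B x = 0)
    (hBosc : Filter.Tendsto (fun r : ℝ =>
        r ^ (-(8 : ℝ)) * ∫ x in Metric.ball (0 : E3) r,
          ‖(fun i : Fin 3 => B x i - ⨍ y in Metric.ball (0 : E3) r, B y i)‖ ^ 6)
      Filter.atTop (nhds 0))
    (Φ Ψ : E3 → Fin 3 → Fin 3 → ℝ) (hΦ : ContDiff ℝ (⊤ : ℕ∞) Φ) (hΨ : ContDiff ℝ (⊤ : ℕ∞) Ψ)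
    (hΦv : ∀ x j, matDiv Φ x j = v x j) (hΨB : ∀ x j, matDiv Ψ x j = B x j)
    (C : ℝ)
    (hosc : ∀ r : ℝ, 1 < r →
      (⨍ x in Metric.ball (0 : E3) r,
        ‖(fun (i j : Fin 3) => Φ x i j - ⨍ y in Metric.ball (0 : E3) r, Φ y i j)‖ ^ 6)
      + (⨍ x in Metric.ball (0 : E3) r,
        ‖(fun (i j : Fin 3) => Ψ x i j - ⨍ y in Metric.ball (0 : E3) r, Ψ y i j)‖ ^ 6)
      ≤ C * r) :
    (∀ x, v x = 0) ∧ (∀ x, B x = 0) := by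
  have H : IsHallMHD (fun j x => v x j) (fun j x => B x j) p :=
    ⟨fun j => contDiff_pi.1 hv j, fun j => contDiff_pi.1 hB j, hp, heq1, heq2, hdivv, hdivB⟩
  obtain ⟨K, hK, hpot⟩ := exists_hasSlowPotential C
  have h := H.eq_zero hK
    (hpot v Φ hΦ hΦv fun r hr => (le_add_of_nonneg_right
      (setAverage_ball_nonneg (fun _ => by positivity) r)).trans (hosc r hr))
    (hpot B Ψ hΨ hΨB fun r hr => (le_add_of_nonneg_left
      (setAverage_ball_nonneg (fun _ => by positivity) r)).trans (hosc r hr))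
    (hasSmallOscillation_of_tendsto hB hBosc)
  exact ⟨fun x => funext fun j => h.1 j x, fun x => funext fun j => h.2 j x⟩
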